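/- arXiv:1301.6540 — 2 statements merged into one kernel-verified Lean document; each statement's English description precedes it below -/
import Mathlib

section
/- Central limit theorem for the circular crossing number: let (k_n)_{n≥2} be any sequence of integers with 2 ≤ k_n for all n and k_n/√n → 0 as n → ∞, and set μ_n = E(Y_{n,k_n}) and σ_n = √Var(Y_{n,k_n}). Then for every real x, the proportion (#{π ∈ Π_n^{k_n} : cr^c(π) ≤ μ_n + x·σ_n})/S(n,k_n) converges, as n → ∞, to Φ(x) = (2π)^{−1/2} ∫_{−∞}^x e^{−t²/2} dt, the standard normal distribution function. -/
open Finset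

/-- Two elements lie in the same block of the set partition `π` of `[n]`. -/
def sameBlock {n : ℕ} (π : Finpartition (univ : Finset (Fin n))) (a b : Fin n) : Prop :=
  ∃ B ∈ π.parts, a ∈ B ∧ b ∈ B

/-- `(a, b)` is an arc of `π`: `a < b`, they lie in a common block, and no element of that
block lies strictly between them. -/
def IsArc {n : ℕ} (π : Finpartition (univ : Finset (Fin n))) (a b : Fin n) : Prop :=
  a < b ∧ sameBlock π a b ∧ ∀ c : Fin n, a < c → c < b → ¬ sameBlock π a c

/-- The linear crossing number `cr^ℓ(π)`: the number of pairs of arcs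
`((a,b),(c,d))` with `a < c < b < d`. -/
noncomputable def crl {n : ℕ} (π : Finpartition (univ : Finset (Fin n))) : ℕ :=
  Set.ncard {q : (Fin n × Fin n) × (Fin n × Fin n) |
    IsArc π q.1.1 q.1.2 ∧ IsArc π q.2.1 q.2.2 ∧
    q.1.1 < q.2.1 ∧ q.2.1 < q.1.2 ∧ q.1.2 < q.2.2}

/-- `(a, b)` is a chord of `π`: `a < b` lie in a common block `B`, and either they are
consecutive elements of `B`, or `B` has at least 3 elements and `a = min B`, `b = max B`. -/
def IsChord {n : ℕ} (π : Finpartition (univ : Finset (Fin n))) (a b : Fin n) : Prop :=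
  a < b ∧ ∃ B ∈ π.parts, a ∈ B ∧ b ∈ B ∧
    ((∀ c ∈ B, ¬(a < c ∧ c < b)) ∨ (3 ≤ B.card ∧ ∀ c ∈ B, a ≤ c ∧ c ≤ b))

/-- The circular crossing number `cr^c(π)`: the number of unordered pairs of crossing chords,
counted as ordered pairs `((a,b),(c,d))` of chords with `a < c < b < d`. -/
noncomputable def crc {n : ℕ} (π : Finpartition (univ : Finset (Fin n))) : ℕ :=
  Set.ncard {q : (Fin n × Fin n) × (Fin n × Fin n) |
    IsChord π q.1.1 q.1.2 ∧ IsChord π q.2.1 q.2.2 ∧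
    q.1.1 < q.2.1 ∧ q.2.1 < q.1.2 ∧ q.1.2 < q.2.2}

/-- The Stirling number of the second kind `S(n,k)`: the number of set partitions of `[n]`
into exactly `k` blocks. -/
noncomputable def stirling (n k : ℕ) : ℕ :=
  Nat.card {π : Finpartition (univ : Finset (Fin n)) // π.parts.card = k}

/-- Stirling numbers with integer arguments: `S(m,j) = 0` unless `0 ≤ j ≤ m`. -/
noncomputable def stirlingZ (m j : ℤ) : ℕ :=
  if 0 ≤ m ∧ 0 ≤ j then stirling m.toNat j.toNat else 0

/-- The Bell number `B_n`: the number of set partitions of `[n]`. -/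
noncomputable def bell (n : ℕ) : ℕ :=
  Nat.card (Finpartition (univ : Finset (Fin n)))

/-- The set partitions of `[n]` with exactly `k` blocks, as a `Finset`. -/
def Pik (n k : ℕ) : Finset (Finpartition (univ : Finset (Fin n))) :=
  Finset.univ.filter fun π => π.parts.card = k

/-- The mean of the linear crossing number over `Π_n^k`. -/
noncomputable def EX (n k : ℕ) : ℝ :=
  (∑ π ∈ Pik n k, (crl π : ℝ)) / stirling n k

/-- The variance of the linear crossing number over `Π_n^k`. -/
noncomputable def VarX (n k : ℕ) : ℝ :=
  (∑ π ∈ Pik n k, (crl π : ℝ) ^ 2) / stirling n k - EX n k ^ 2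

/-- The mean of the circular crossing number over `Π_n^k`. -/
noncomputable def EY (n k : ℕ) : ℝ :=
  (∑ π ∈ Pik n k, (crc π : ℝ)) / stirling n k

/-- The variance of the circular crossing number over `Π_n^k`. -/
noncomputable def VarY (n k : ℕ) : ℝ :=
  (∑ π ∈ Pik n k, (crc π : ℝ) ^ 2) / stirling n k - EY n k ^ 2

/-- The mean of the linear crossing number over all of `Π_n`. -/
noncomputable def EXall (n : ℕ) : ℝ :=
  (∑ π : Finpartition (univ : Finset (Fin n)), (crl π : ℝ)) / bell n

/-- The variance of the linear crossing number over all of `Π_n`. -/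
noncomputable def VarXall (n : ℕ) : ℝ :=
  (∑ π : Finpartition (univ : Finset (Fin n)), (crl π : ℝ) ^ 2) / bell n - EXall n ^ 2

/-- The mean of the circular crossing number over all of `Π_n`. -/
noncomputable def EYall (n : ℕ) : ℝ :=
  (∑ π : Finpartition (univ : Finset (Fin n)), (crc π : ℝ)) / bell n

/-- The variance of the circular crossing number over all of `Π_n`. -/
noncomputable def VarYall (n : ℕ) : ℝ :=
  (∑ π : Finpartition (univ : Finset (Fin n)), (crc π : ℝ) ^ 2) / bell n - EYall n ^ 2

/-- The standard normal distribution function `Φ`. -/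
noncomputable def stdNormalCDF (x : ℝ) : ℝ :=
  (Real.sqrt (2 * Real.pi))⁻¹ * ∫ t in Set.Iic x, Real.exp (-t ^ 2 / 2)

open Filter MeasureTheory ProbabilityTheory Topology

/-- A mean-zero, unit-variance function bounded by `2` has empirical characteristic function
close to `1 - θ ^ 2 / 2`. -/
lemma norm_avg_cexp_sub_le {k : ℕ} (hk : 0 < k) (f : Fin k → ℝ) (h0 : ∑ j, f j = 0)
    (h1 : ∑ j, f j ^ 2 = k) (hb : ∀ j, |f j| ≤ 2) (θ : ℝ) :
    ‖(k : ℂ)⁻¹ * ∑ j, Complex.exp (θ * f j * Complex.I) - 1 + (θ : ℂ) ^ 2 / 2‖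
      ≤ 8 * |θ| ^ 3 * Real.exp (2 * |θ|) := by
  have hk' : (k : ℂ) ≠ 0 := by exact_mod_cast hk.ne'
  have h0' : ∑ j, (f j : ℂ) = 0 := by exact_mod_cast h0
  have h1' : ∑ j, (f j : ℂ) ^ 2 = k := by exact_mod_cast h1
  have key : (k : ℂ)⁻¹ * ∑ j, Complex.exp (θ * f j * Complex.I) - 1 + (θ : ℂ) ^ 2 / 2
      = (k : ℂ)⁻¹ * ∑ j, (Complex.exp (θ * f j * Complex.I) -
          ∑ m ∈ range 3, (θ * f j * Complex.I) ^ m / (m.factorial : ℂ)) := by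
    have : ∑ j, ∑ m ∈ range 3, ((θ * f j * Complex.I) ^ m / (m.factorial : ℂ))
        = k - (θ : ℂ) ^ 2 / 2 * k := by
      have : ∀ j, ∑ m ∈ range 3, ((θ * f j * Complex.I) ^ m / (m.factorial : ℂ))
          = 1 + (θ * Complex.I) * f j - (θ : ℂ) ^ 2 / 2 * f j ^ 2 := by
        intro j
        simp only [sum_range_succ, sum_range_zero, mul_pow, Complex.I_sq]
        norm_num [Nat.factorial]
        ring
      simp_rw [this]
      rw [sum_sub_distrib, sum_add_distrib, ← mul_sum, ← mul_sum, h0', h1']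
      simp
    rw [sum_sub_distrib, this]
    generalize ∑ j, Complex.exp (θ * f j * Complex.I) = S
    field_simp
    ring
  rw [key, norm_mul, norm_inv, Complex.norm_natCast]
  have hkpos : (0 : ℝ) < k := by exact_mod_cast hk
  rw [inv_mul_le_iff₀ hkpos]
  refine (norm_sum_le _ _).trans ?_
  have hterm : ∀ j ∈ (univ : Finset (Fin k)), ‖Complex.exp (θ * f j * Complex.I) -
          ∑ m ∈ range 3, (θ * f j * Complex.I) ^ m / (m.factorial : ℂ)‖
          ≤ 8 * |θ| ^ 3 * Real.exp (2 * |θ|) := by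
    intro j _
    refine (Complex.norm_exp_sub_sum_le_norm_mul_exp _ 3).trans ?_
    have hn : ‖(θ * f j * Complex.I : ℂ)‖ ≤ 2 * |θ| := by
      simp only [norm_mul, Complex.norm_real, Complex.norm_I, mul_one, Real.norm_eq_abs]
      nlinarith [hb j, abs_nonneg θ]
    calc _ ≤ (2 * |θ|) ^ 3 * Real.exp (2 * |θ|) := by gcongr
      _ = _ := by ring
  refine (sum_le_card_nsmul _ _ _ hterm).trans ?_
  simp

/-- The uniform average of the characters of a sum of independent coordinates. -/
lemma avg_cexp_sum {k n : ℕ} (f : Fin k → ℝ) (s t : ℝ) :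
    ((k ^ n : ℕ) : ℂ)⁻¹ * ∑ c : Fin n → Fin k, Complex.exp (t * ((∑ i, f (c i)) / s : ℝ) * Complex.I)
      = ((k : ℂ)⁻¹ * ∑ j, Complex.exp ((t / s : ℝ) * f j * Complex.I)) ^ n := by
  rw [mul_pow, Fintype.sum_pow]
  push_cast
  rw [inv_pow]
  congr 1
  refine sum_congr rfl fun c _ => ?_
  rw [← Complex.exp_sum]
  congr 1
  rw [sum_div, mul_sum, sum_mul]
  refine sum_congr rfl fun i _ => ?_
  ring

lemma tendsto_avg_cexp_pow {k : ℕ → ℕ} (hk : ∀ n, 0 < k n) (f : ∀ n, Fin (k n) → ℝ)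
    (h0 : ∀ n, ∑ j, f n j = 0) (h1 : ∀ n, ∑ j, f n j ^ 2 = k n) (hb : ∀ n j, |f n j| ≤ 2) (t : ℝ) :
    Tendsto (fun n : ℕ => ((k n : ℂ)⁻¹ *
      ∑ j, Complex.exp ((t / Real.sqrt n : ℝ) * f n j * Complex.I)) ^ n) atTop
      (𝓝 (Complex.exp (-(t : ℂ) ^ 2 / 2))) := by
  have hadd : ∀ z : ℂ, 1 + (z - 1) = z := fun z => by ring
  suffices h : Tendsto (fun n : ℕ => (n : ℂ) * ((k n : ℂ)⁻¹ *
      ∑ j, Complex.exp ((t / Real.sqrt n : ℝ) * f n j * Complex.I) - 1)) atTop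
      (𝓝 (-(t : ℂ) ^ 2 / 2)) by
    simpa only [hadd] using Complex.tendsto_one_add_pow_exp_of_tendsto h
  rw [tendsto_iff_norm_sub_tendsto_zero]
  have hlim : Tendsto (fun n : ℕ => 8 * |t| ^ 3 * Real.exp (2 * |t|) * (Real.sqrt n)⁻¹)
      atTop (𝓝 0) := by
    simpa using (tendsto_inv_atTop_zero.comp (Real.tendsto_sqrt_atTop.comp
      tendsto_natCast_atTop_atTop)).const_mul (8 * |t| ^ 3 * Real.exp (2 * |t|))
  refine squeeze_zero' (Eventually.of_forall fun n => norm_nonneg _) ?_ hlim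
  filter_upwards [eventually_ge_atTop 1] with n hn
  have hn1 : (1 : ℝ) ≤ n := by exact_mod_cast hn
  have hs : 1 ≤ Real.sqrt n := Real.one_le_sqrt.2 hn1
  have hss : Real.sqrt n ^ 2 = n := Real.sq_sqrt (by positivity)
  have hb' := norm_avg_cexp_sub_le (hk n) (f n) (h0 n) (h1 n) (hb n) (t / Real.sqrt n)
  have heq : (n : ℂ) * ((k n : ℂ)⁻¹ * ∑ j, Complex.exp ((t / Real.sqrt n : ℝ) * f n j * Complex.I) - 1)
      - -(t : ℂ) ^ 2 / 2 = n * ((k n : ℂ)⁻¹ *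
        ∑ j, Complex.exp ((t / Real.sqrt n : ℝ) * f n j * Complex.I) - 1
        + ((t / Real.sqrt n : ℝ) : ℂ) ^ 2 / 2) := by
    have : ((t / Real.sqrt n : ℝ) : ℂ) ^ 2 = (t : ℂ) ^ 2 / n := by
      rw [← Complex.ofReal_pow, div_pow, hss]; push_cast; rfl
    rw [this]
    have : (n : ℂ) ≠ 0 := by exact_mod_cast (by omega : n ≠ 0)
    generalize ∑ j, Complex.exp ((t / Real.sqrt n : ℝ) * f n j * Complex.I) = S
    field_simp
    ring
  rw [heq, norm_mul, Complex.norm_natCast]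
  have habs : |t / Real.sqrt n| = |t| / Real.sqrt n := by
    rw [abs_div, abs_of_pos (by positivity : (0:ℝ) < Real.sqrt n)]
  rw [habs] at hb'
  have hle : |t| / Real.sqrt n ≤ |t| := div_le_self (abs_nonneg _) hs
  calc _ ≤ (n : ℝ) * (8 * (|t| / Real.sqrt n) ^ 3 * Real.exp (2 * (|t| / Real.sqrt n))) := by gcongr
    _ ≤ (n : ℝ) * (8 * (|t| / Real.sqrt n) ^ 3 * Real.exp (2 * |t|)) := by gcongr
    _ = _ := by
      rw [← hss]
      have : Real.sqrt n ≠ 0 := by positivity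
      field_simp
      rw [Real.sqrt_sq (by positivity)]
      ring

lemma stdNormalCDF_eq (x : ℝ) : stdNormalCDF x = (gaussianReal 0 1).real (Set.Iic x) := by
  rw [measureReal_def, gaussianReal_apply_eq_integral _ one_ne_zero, ENNReal.toReal_ofReal
    (setIntegral_nonneg measurableSet_Iic fun _ _ => gaussianPDFReal_nonneg _ _ _)]
  simp [gaussianPDFReal, stdNormalCDF, integral_const_mul]

lemma continuous_stdNormalCDF : Continuous stdNormalCDF := by
  unfold stdNormalCDF
  refine continuous_const.mul ?_
  have hi : Integrable (fun t : ℝ => Real.exp (-t ^ 2 / 2)) := by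
    have := integrable_exp_neg_mul_sq (b := 1 / 2) (by norm_num)
    refine this.congr (Eventually.of_forall fun t => ?_)
    ring_nf
  have : (fun x : ℝ => ∫ t in Set.Iic x, Real.exp (-t ^ 2 / 2)) = fun x =>
      (∫ t in Set.Iic 0, Real.exp (-t ^ 2 / 2)) + ∫ t in (0 : ℝ)..x, Real.exp (-t ^ 2 / 2) := by
    funext x
    rw [← intervalIntegral.integral_Iic_sub_Iic hi.integrableOn hi.integrableOn]
    ring
  rw [this]
  exact continuous_const.add (intervalIntegral.continuous_primitive (fun _ _ =>
    hi.intervalIntegrable) 0)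

/-- Central limit theorem for row-wise i.i.d. standardized variables that are uniform on a
finite set and bounded by `2`. -/
lemma tendsto_card_sum_div_sqrt_le {k : ℕ → ℕ} (hk : ∀ n, 0 < k n) (f : ∀ n, Fin (k n) → ℝ)
    (h0 : ∀ n, ∑ j, f n j = 0) (h1 : ∀ n, ∑ j, f n j ^ 2 = k n) (hb : ∀ n j, |f n j| ≤ 2) (x : ℝ) :
    Tendsto (fun n : ℕ => (#{c : Fin n → Fin (k n) | (∑ i, f n (c i)) / Real.sqrt n ≤ x} : ℝ)
      / ((k n ^ n : ℕ) : ℝ)) atTop (𝓝 (stdNormalCDF x)) := by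
  have hne : ∀ n, Nonempty (Fin n → Fin (k n)) := fun n => ⟨fun _ => ⟨0, hk n⟩⟩
  let Z : ∀ n, (Fin n → Fin (k n)) → ℝ := fun n c => (∑ i, f n (c i)) / Real.sqrt n
  have hZ : ∀ n, Measurable (Z n) := fun n => measurable_of_finite _
  let P : ∀ n, Measure (Fin n → Fin (k n)) := fun n => (PMF.uniformOfFintype _).toMeasure
  have hP : ∀ n, IsProbabilityMeasure ((P n).map (Z n)) := fun n =>
    Measure.isProbabilityMeasure_map (hZ n).aemeasurable
  let μ : ℕ → ProbabilityMeasure ℝ := fun n => ⟨(P n).map (Z n), hP n⟩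
  let μ₀ : ProbabilityMeasure ℝ := ⟨gaussianReal 0 1, inferInstance⟩
  have hlim : Tendsto μ atTop (𝓝 μ₀) := by
    rw [ProbabilityMeasure.tendsto_iff_tendsto_charFun]
    intro t
    have hchar : charFun (μ₀ : Measure ℝ) t = Complex.exp (-(t : ℂ) ^ 2 / 2) := by
      change charFun (gaussianReal 0 1) t = _
      rw [charFun_gaussianReal]
      congr 1
      push_cast
      ring
    rw [hchar]
    refine (tendsto_avg_cexp_pow hk f h0 h1 hb t).congr fun n => ?_
    change _ = charFun ((P n).map (Z n)) t
    rw [charFun_apply_real, integral_map (hZ n).aemeasurable (by fun_prop), PMF.integral_eq_sum,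
      ← avg_cexp_sum, mul_sum]
    refine sum_congr rfl fun c _ => ?_
    simp [Z, PMF.uniformOfFintype_apply]
  have hfr : μ₀ (frontier (Set.Iic x)) = 0 := by
    rw [frontier_Iic]
    have : (gaussianReal 0 1) {x} = 0 := by
      have := nullSingletonClass_gaussianReal (μ := 0) (v := 1) one_ne_zero
      exact measure_singleton x
    simp [μ₀, this]
  have := ProbabilityMeasure.tendsto_measure_of_null_frontier_of_tendsto hlim hfr
  rw [stdNormalCDF_eq]
  have h2 := (NNReal.continuous_coe.tendsto _).comp this
  refine h2.congr fun n => ?_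
  classical
  change ((P n).map (Z n)).real (Set.Iic x) = _
  rw [measureReal_def, Measure.map_apply (hZ n) measurableSet_Iic,
    PMF.toMeasure_uniformOfFintype_apply _ (hZ n measurableSet_Iic)]
  simp [Z, Fintype.card_subtype]

/-- Convergence of distribution functions along convergent arguments. -/
lemma tendsto_apply_of_monotone {F : ℕ → ℝ → ℝ} {Φ : ℝ → ℝ} (hF : ∀ n, Monotone (F n))
    (hlim : ∀ y, Tendsto (fun n => F n y) atTop (𝓝 (Φ y))) {x : ℝ} (hΦ : ContinuousAt Φ x)
    {y : ℕ → ℝ} (hy : Tendsto y atTop (𝓝 x)) : Tendsto (fun n => F n (y n)) atTop (𝓝 (Φ x)) := by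
  rw [tendsto_order]
  constructor
  · intro l hl
    have h1 : ∀ᶠ z in 𝓝 x, l < Φ z := hΦ.eventually (lt_mem_nhds hl)
    obtain ⟨z, hz, hzl⟩ := ((h1.filter_mono nhdsWithin_le_nhds).and
      (self_mem_nhdsWithin : Set.Iio x ∈ 𝓝[<] x)).exists
    filter_upwards [hy.eventually (lt_mem_nhds hzl), (hlim z).eventually (lt_mem_nhds hz)]
      with n hn1 hn2
    exact hn2.trans_le (hF n hn1.le)
  · intro u hu
    have h1 : ∀ᶠ z in 𝓝 x, Φ z < u := hΦ.eventually (gt_mem_nhds hu)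
    obtain ⟨z, hz, hzl⟩ := ((h1.filter_mono nhdsWithin_le_nhds).and
      (self_mem_nhdsWithin : Set.Ioi x ∈ 𝓝[>] x)).exists
    filter_upwards [hy.eventually (gt_mem_nhds hzl), (hlim z).eventually (gt_mem_nhds hz)]
      with n hn1 hn2
    exact (hF n hn1.le).trans_lt hn2

/-- A central limit theorem for standardized statistics `Z` on uniform finite spaces transfers
to uniformly close statistics `Y`, self-normalized, on asymptotically full subsets `A`. -/
lemma tendsto_card_le_of_close {Ω : ℕ → Type*} [∀ n, Fintype (Ω n)] [∀ n, DecidableEq (Ω n)]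
    (A : ∀ n, Finset (Ω n)) (Z Y : ∀ n, Ω n → ℝ) {Φ : ℝ → ℝ} (hΦ : Continuous Φ)
    (hlim : ∀ x, Tendsto (fun n => (#{ω | Z n ω ≤ x} : ℝ) / Fintype.card (Ω n)) atTop (𝓝 (Φ x)))
    (hne : ∀ n, Nonempty (Ω n))
    (h0 : ∀ᶠ n in atTop, ∑ ω, Z n ω = 0)
    (h1 : ∀ᶠ n in atTop, ∑ ω, Z n ω ^ 2 = Fintype.card (Ω n))
    {b ε : ℕ → ℝ} (hZb : ∀ᶠ n in atTop, ∀ ω, Z n ω ^ 2 ≤ b n)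
    (hA : Tendsto (fun n => (1 + b n) * ((#(A n)ᶜ : ℝ) / Fintype.card (Ω n))) atTop (𝓝 0))
    (hε : Tendsto ε atTop (𝓝 0)) (hYZ : ∀ᶠ n in atTop, ∀ ω ∈ A n, |Y n ω - Z n ω| ≤ ε n) (x : ℝ) :
    Tendsto (fun n => (#{ω ∈ A n | Y n ω ≤ (∑ ω ∈ A n, Y n ω) / #(A n) + x *
        Real.sqrt ((∑ ω ∈ A n, Y n ω ^ 2) / #(A n) - ((∑ ω ∈ A n, Y n ω) / #(A n)) ^ 2)} : ℝ)
        / #(A n)) atTop (𝓝 (Φ x)) := by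
  let N : ℕ → ℝ := fun n => Fintype.card (Ω n)
  have hN : ∀ n, 0 < N n := fun n => by
    have := hne n
    exact Nat.cast_pos.2 Fintype.card_pos
  have hb0 : ∀ᶠ n in atTop, 0 ≤ b n := by
    filter_upwards [hZb] with n hn
    have := hne n
    exact (sq_nonneg _).trans (hn (Classical.arbitrary _))
  have hcompl : ∀ n, (#(A n) : ℝ) = N n - #(A n)ᶜ := fun n => by
    have : #(A n) + #(A n)ᶜ = Fintype.card (Ω n) := card_add_card_compl _
    have : (#(A n) : ℝ) + #(A n)ᶜ = N n := by
      simp only [N]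
      exact_mod_cast this
    linarith
  have hq : Tendsto (fun n => (#(A n)ᶜ : ℝ) / N n) atTop (𝓝 0) := by
    refine squeeze_zero' (Eventually.of_forall fun n => by have := hN n; positivity) ?_ hA
    filter_upwards [hb0] with n hn
    have : 0 ≤ (#(A n)ᶜ : ℝ) / N n := by have := hN n; positivity
    nlinarith
  have ha : Tendsto (fun n => (#(A n) : ℝ) / N n) atTop (𝓝 1) := by
    have := hq.const_sub 1
    rw [sub_zero] at this
    refine this.congr fun n => ?_
    rw [hcompl, sub_div, div_self (hN n).ne']
  have hZ1 : Tendsto (fun n => (∑ ω ∈ A n, Z n ω) / N n) atTop (𝓝 0) := by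
    refine squeeze_zero_norm' ?_ hA
    filter_upwards [h0, hZb] with n h0 hb
    have hsplit := sum_add_sum_compl (A n) (Z n)
    have : |∑ ω ∈ (A n)ᶜ, Z n ω| ≤ #(A n)ᶜ * (1 + b n) := by
      refine (abs_sum_le_sum_abs _ _).trans ?_
      rw [← nsmul_eq_mul]
      refine sum_le_card_nsmul _ _ _ fun ω _ => ?_
      have := hb ω
      nlinarith [sq_abs (Z n ω), sq_nonneg (|Z n ω| - 1)]
    rw [h0] at hsplit
    rw [Real.norm_eq_abs, abs_div, abs_of_pos (hN n), eq_neg_of_add_eq_zero_left hsplit, abs_neg]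
    calc _ ≤ #(A n)ᶜ * (1 + b n) / N n := by have := hN n; gcongr
      _ = _ := by ring
  have hZ2 : Tendsto (fun n => (∑ ω ∈ A n, Z n ω ^ 2) / N n) atTop (𝓝 1) := by
    rw [tendsto_iff_norm_sub_tendsto_zero]
    refine squeeze_zero' (Eventually.of_forall fun n => norm_nonneg _) ?_ hA
    filter_upwards [h1, hZb] with n h1 hb
    have hsplit := sum_add_sum_compl (A n) (fun ω => Z n ω ^ 2)
    have hle : ∑ ω ∈ (A n)ᶜ, Z n ω ^ 2 ≤ #(A n)ᶜ * (1 + b n) := by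
      rw [← nsmul_eq_mul]
      refine sum_le_card_nsmul _ _ _ fun ω _ => ?_
      have := hb ω
      linarith
    have hnn : 0 ≤ ∑ ω ∈ (A n)ᶜ, Z n ω ^ 2 := sum_nonneg fun _ _ => sq_nonneg _
    have heq : (∑ ω ∈ A n, Z n ω ^ 2) / N n - 1 = -((∑ ω ∈ (A n)ᶜ, Z n ω ^ 2) / N n) := by
      have : N n = _ := h1.symm.trans hsplit.symm
      have hpos := hN n
      field_simp
      linarith
    rw [heq, norm_neg, Real.norm_eq_abs, abs_of_nonneg (by have := hN n; positivity)]
    calc _ ≤ #(A n)ᶜ * (1 + b n) / N n := by have := hN n; gcongr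
      _ = _ := by ring
  have haN : ∀ n, (#(A n) : ℝ) ≤ N n := fun n => by
    rw [hcompl]; linarith [(Nat.cast_nonneg (#(A n)ᶜ) : (0:ℝ) ≤ _)]
  have hεnn : ∀ᶠ n in atTop, 0 ≤ ε n := by
    filter_upwards [hYZ, ha.eventually (lt_mem_nhds one_pos)] with n hn hpos
    have : (A n).Nonempty := by
      rw [nonempty_iff_ne_empty]
      rintro h
      simp [h] at hpos
    obtain ⟨ω, hω⟩ := this
    exact (abs_nonneg _).trans (hn ω hω)
  have hY1 : Tendsto (fun n => (∑ ω ∈ A n, Y n ω) / N n) atTop (𝓝 0) := by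
    have : Tendsto (fun n => (∑ ω ∈ A n, (Y n ω - Z n ω)) / N n) atTop (𝓝 0) := by
      refine squeeze_zero_norm' ?_ hε
      filter_upwards [hYZ, hεnn] with n hn hnn
      rw [Real.norm_eq_abs, abs_div, abs_of_pos (hN n), div_le_iff₀ (hN n)]
      refine (abs_sum_le_sum_abs _ _).trans ((sum_le_card_nsmul _ _ _ hn).trans ?_)
      rw [nsmul_eq_mul, mul_comm]
      gcongr
      exact haN n
    have h := hZ1.add this
    rw [add_zero] at h
    refine h.congr fun n => ?_
    rw [sum_sub_distrib]; ring
  have hY2 : Tendsto (fun n => (∑ ω ∈ A n, Y n ω ^ 2) / N n) atTop (𝓝 1) := by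
    have hbd : Tendsto (fun n => ε n * (2 + ε n)) atTop (𝓝 0) := by
      simpa using hε.mul (hε.const_add 2)
    have : Tendsto (fun n => (∑ ω ∈ A n, (Y n ω ^ 2 - Z n ω ^ 2)) / N n) atTop (𝓝 0) := by
      refine squeeze_zero_norm' ?_ hbd
      filter_upwards [hYZ, hεnn, h1] with n hn hnn h1
      rw [Real.norm_eq_abs, abs_div, abs_of_pos (hN n), div_le_iff₀ (hN n)]
      refine (abs_sum_le_sum_abs _ _).trans ?_
      calc ∑ ω ∈ A n, |Y n ω ^ 2 - Z n ω ^ 2|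
          ≤ ∑ ω ∈ A n, ε n * (1 + ε n + Z n ω ^ 2) := by
            refine sum_le_sum fun ω hω => ?_
            have h := hn ω hω
            have hfac : Y n ω ^ 2 - Z n ω ^ 2 = (Y n ω - Z n ω) * ((Y n ω - Z n ω) + 2 * Z n ω) := by
              ring
            rw [hfac, abs_mul]
            have h2 : |(Y n ω - Z n ω) + 2 * Z n ω| ≤ 1 + ε n + Z n ω ^ 2 := by
              refine (abs_add_le _ _).trans ?_
              rw [abs_mul, abs_two]
              nlinarith [sq_abs (Z n ω), sq_nonneg (|Z n ω| - 1)]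
            gcongr
        _ ≤ ∑ ω, ε n * (1 + ε n + Z n ω ^ 2) :=
            sum_le_sum_of_subset_of_nonneg (subset_univ _) fun _ _ _ => by positivity
        _ = _ := by
            rw [← mul_sum, sum_add_distrib, h1]
            simp [N]
            ring
    have h := hZ2.add this
    rw [add_zero] at h
    refine h.congr fun n => ?_
    rw [sum_sub_distrib]; ring
  have hE : Tendsto (fun n => (∑ ω ∈ A n, Y n ω) / #(A n)) atTop (𝓝 0) := by
    have := hY1.div ha one_ne_zero
    rw [zero_div] at this
    refine this.congr fun n => ?_
    exact div_div_div_cancel_right₀ (hN n).ne' _ _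
  have hV : Tendsto (fun n => (∑ ω ∈ A n, Y n ω ^ 2) / #(A n)) atTop (𝓝 1) := by
    have := hY2.div ha one_ne_zero
    rw [div_one] at this
    refine this.congr fun n => ?_
    exact div_div_div_cancel_right₀ (hN n).ne' _ _
  set y : ℕ → ℝ := fun n => (∑ ω ∈ A n, Y n ω) / #(A n) + x *
        Real.sqrt ((∑ ω ∈ A n, Y n ω ^ 2) / #(A n) - ((∑ ω ∈ A n, Y n ω) / #(A n)) ^ 2) with hy
  have hyx : Tendsto y atTop (𝓝 x) := by
    have := hE.add (((hV.sub (hE.pow 2)).sqrt).const_mul x)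
    simpa using this
  have hmono : ∀ n, Monotone fun z => (#{ω | Z n ω ≤ z} : ℝ) / Fintype.card (Ω n) := by
    intro n z z' hz
    dsimp only
    gcongr
  have hup := tendsto_apply_of_monotone hmono hlim hΦ.continuousAt
    (by simpa using hyx.add hε : Tendsto (fun n => y n + ε n) atTop (𝓝 x))
  have hlo := tendsto_apply_of_monotone hmono hlim hΦ.continuousAt
    (by simpa using hyx.sub hε : Tendsto (fun n => y n - ε n) atTop (𝓝 x))
  have hlo' := hlo.sub hq
  rw [sub_zero] at hlo'
  have hmid : Tendsto (fun n => (#{ω ∈ A n | Y n ω ≤ y n} : ℝ) / N n) atTop (𝓝 (Φ x)) := by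
    refine tendsto_of_tendsto_of_tendsto_of_le_of_le' hlo' hup ?_ ?_
    · filter_upwards [hYZ] with n hn
      have hsub : ({ω | Z n ω ≤ y n - ε n} : Finset (Ω n)) ⊆ {ω ∈ A n | Y n ω ≤ y n} ∪ (A n)ᶜ := by
        intro ω hω
        simp only [mem_filter, mem_univ, true_and, mem_union, mem_compl] at hω ⊢
        by_cases hωA : ω ∈ A n
        · refine Or.inl ⟨hωA, ?_⟩
          have := (abs_le.1 (hn ω hωA)).2
          linarith
        · exact Or.inr hωA
      have hc : (#{ω | Z n ω ≤ y n - ε n} : ℝ) ≤ #{ω ∈ A n | Y n ω ≤ y n} + #(A n)ᶜ := by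
        exact_mod_cast (card_le_card hsub).trans (card_union_le _ _)
      have := hN n
      change _ / N n - _ ≤ _
      rw [← sub_div]
      gcongr
      linarith
    · filter_upwards [hYZ] with n hn
      have := hN n
      change _ ≤ _ / N n
      gcongr
      intro ω hω
      simp only [mem_filter, mem_univ, true_and] at hω ⊢
      have := (abs_le.1 (hn ω hω.1)).1
      linarith
  have := hmid.div ha one_ne_zero
  rw [div_one] at this
  refine this.congr fun n => ?_
  exact div_div_div_cancel_right₀ (hN n).ne' _ _

lemma sum_fin_succ_fun {α M : Type*} [Fintype α] [AddCommMonoid M] {n : ℕ}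
    (F : (Fin (n + 1) → α) → M) :
    ∑ w, F w = ∑ w : Fin n → α, ∑ a, F (Fin.snoc w a) := by
  rw [← (Fin.snocEquiv fun _ => α).sum_comp, Fintype.sum_prod_type_right]
  rfl

lemma sum_sum_apply_eq_zero {k : ℕ} (f : Fin k → ℝ) (h0 : ∑ j, f j = 0) (n : ℕ) :
    ∑ c : Fin n → Fin k, ∑ i, f (c i) = 0 := by
  induction n with
  | zero => simp
  | succ n ih =>
    simp [sum_fin_succ_fun, Fin.sum_univ_castSucc, sum_add_distrib, h0, ← mul_sum, ih]

lemma sum_sq_sum_apply {k : ℕ} (f : Fin k → ℝ) (h0 : ∑ j, f j = 0)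
    (h1 : ∑ j, f j ^ 2 = k) (n : ℕ) :
    ∑ c : Fin n → Fin k, (∑ i, f (c i)) ^ 2 = n * (k ^ n : ℕ) := by
  induction n with
  | zero => simp
  | succ n ih =>
    have : ∀ c : Fin n → Fin k, ∑ a, ((∑ i, f (c i)) + f a) ^ 2 = k * (∑ i, f (c i)) ^ 2 + k := by
      intro c
      simp_rw [add_sq, sum_add_distrib, h1, ← mul_sum, h0]
      simp
    simp only [sum_fin_succ_fun, Fin.sum_univ_castSucc, Fin.snoc_castSucc, Fin.snoc_last, this,
      sum_add_distrib, ← mul_sum, ih]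
    simp
    ring

/-- The standardization of a uniform variable on `{0, …, k - 1}`. -/
noncomputable def stdUnif (k : ℕ) (j : Fin k) : ℝ :=
  ((j : ℝ) - (k - 1) / 2) / Real.sqrt (((k : ℝ) ^ 2 - 1) / 12)

lemma sum_fin_val_real (k : ℕ) : ∑ j : Fin k, (j : ℝ) = k * (k - 1) / 2 := by
  induction k with
  | zero => simp
  | succ k ih => rw [Fin.sum_univ_castSucc]; simp [ih]; ring

lemma sum_fin_val_sq_real (k : ℕ) : ∑ j : Fin k, (j : ℝ) ^ 2 = k * (k - 1) * (2 * k - 1) / 6 := by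
  induction k with
  | zero => simp
  | succ k ih => rw [Fin.sum_univ_castSucc]; simp [ih]; ring

lemma sum_stdUnif (k : ℕ) : ∑ j, stdUnif k j = 0 := by
  simp only [stdUnif, ← sum_div, sum_sub_distrib, sum_fin_val_real]
  simp
  left; ring

lemma sum_stdUnif_sq {k : ℕ} (hk : 2 ≤ k) : ∑ j, stdUnif k j ^ 2 = k := by
  have hk' : (2 : ℝ) ≤ k := by exact_mod_cast hk
  have hpos : 0 < ((k : ℝ) ^ 2 - 1) / 12 := by nlinarith
  simp only [stdUnif, div_pow, Real.sq_sqrt hpos.le, ← sum_div, sub_sq, sum_add_distrib,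
    sum_sub_distrib, ← mul_sum, ← sum_mul, sum_fin_val_real, sum_fin_val_sq_real]
  rw [div_eq_iff hpos.ne']
  simp
  ring

lemma stdUnif_sq_le {k : ℕ} (hk : 2 ≤ k) (j : Fin k) : stdUnif k j ^ 2 ≤ 3 := by
  have hk' : (2 : ℝ) ≤ k := by exact_mod_cast hk
  have hpos : 0 < ((k : ℝ) ^ 2 - 1) / 12 := by nlinarith
  have hj : (j : ℝ) + 1 ≤ k := by exact_mod_cast j.2
  have hj0 : (0 : ℝ) ≤ j := Nat.cast_nonneg _
  rw [stdUnif, div_pow, Real.sq_sqrt hpos.le, div_le_iff₀ hpos]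
  nlinarith

lemma abs_stdUnif_le {k : ℕ} (hk : 2 ≤ k) (j : Fin k) : |stdUnif k j| ≤ 2 :=
  abs_le_of_sq_le_sq (by linarith [stdUnif_sq_le hk j]) (by norm_num)

/-- The position of each letter in the move-to-front list after reading the word `w`. -/
def mtfPos {k : ℕ} : ∀ n, (Fin n → Fin k) → Equiv.Perm (Fin k)
  | 0, _ => 1
  | n + 1, w => (mtfPos n (Fin.init w)).trans
      (Fin.cycleRange (mtfPos n (Fin.init w) (w (Fin.last n))))

/-- The total move-to-front cost of the word `w`. -/
def mtfSum {k : ℕ} : ∀ n, (Fin n → Fin k) → ℕ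
  | 0, _ => 0
  | n + 1, w => mtfSum n (Fin.init w) + (mtfPos n (Fin.init w) (w (Fin.last n)) : ℕ)

/-- The move-to-front cost of a uniform word is a sum of independent uniform variables. -/
lemma sum_mtfSum {k : ℕ} {M : Type*} [AddCommMonoid M] (n : ℕ) (g : ℕ → M) :
    ∑ w : Fin n → Fin k, g (mtfSum n w) = ∑ c : Fin n → Fin k, g (∑ i, (c i : ℕ)) := by
  induction n generalizing g with
  | zero => simp [mtfSum]
  | succ n ih =>
    simp only [sum_fin_succ_fun, mtfSum, Fin.init_snoc, Fin.snoc_last, Fin.sum_univ_castSucc,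
      Fin.snoc_castSucc]
    calc _ = ∑ w : Fin n → Fin k, ∑ a : Fin k, g (mtfSum n w + (a : ℕ)) :=
          sum_congr rfl fun w _ => Equiv.sum_comp (mtfPos n w) fun a => g (mtfSum n w + (a : ℕ))
      _ = _ := ih fun s => ∑ a : Fin k, g (s + (a : ℕ))

lemma mtfPos_lt_iff {k n : ℕ} (w : Fin n → Fin k) {u v : Fin k} (huv : u ≠ v)
    (hu : ∃ i, w i = u) :
    mtfPos n w v < mtfPos n w u ↔ ∃ i, w i = v ∧ ∀ m, i < m → w m ≠ u := by
  induction n with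
  | zero => exact hu.elim fun i _ => i.elim0
  | succ n ih =>
    have hk : NeZero k := ⟨fun h => by subst h; exact u.elim0⟩
    set p := mtfPos n (Fin.init w) with hp
    have hpos : ∀ x, (mtfPos (n + 1) w x : ℕ) = if p x < p (w (Fin.last n)) then (p x : ℕ) + 1
        else if p x = p (w (Fin.last n)) then 0 else p x := by
      intro x
      simp only [mtfPos, Equiv.trans_apply, ← hp]
      rcases lt_trichotomy (p x) (p (w (Fin.last n))) with h | h | h
      · rw [Fin.coe_cycleRange_of_lt h, if_pos h]
      · rw [Fin.cycleRange_of_eq h]; simp [h]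
      · rw [Fin.cycleRange_of_gt h, if_neg h.not_gt, if_neg h.ne']
    rw [Fin.lt_def, hpos, hpos]
    by_cases hau : w (Fin.last n) = u
    · subst hau
      simp only [lt_irrefl, if_false, if_true, not_lt_zero, false_iff, not_exists, not_and,
        not_forall]
      intro i hi
      refine ⟨Fin.last n, lt_of_le_of_ne (Fin.le_last i) ?_, by simp⟩
      rintro rfl
      exact huv hi
    by_cases hav : w (Fin.last n) = v
    · subst hav
      have hne : p u ≠ p (w (Fin.last n)) := fun h => huv (p.injective h)
      simp only [lt_irrefl, if_false, if_true]
      refine iff_of_true ?_ ⟨Fin.last n, rfl, fun m hm => absurd hm (Fin.le_last m).not_gt⟩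
      split_ifs with h
      · omega
      · have : p (w (Fin.last n)) < p u := lt_of_le_of_ne (not_lt.1 h) hne.symm
        exact (Nat.zero_le _).trans_lt this
    · have hu' : ∃ i, Fin.init w i = u := by
        obtain ⟨i, hi⟩ := hu
        refine Fin.lastCases (motive := fun i => w i = u → _) (fun h => absurd h hau)
          (fun j h => ⟨j, h⟩) i hi
      have hneu : (p u : ℕ) ≠ p (w (Fin.last n)) := fun h => hau (p.injective (Fin.ext h)).symm
      have hnev : (p v : ℕ) ≠ p (w (Fin.last n)) := fun h => hav (p.injective (Fin.ext h)).symm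
      have hih := ih (Fin.init w) hu'
      rw [← hp, Fin.lt_def] at hih
      have h1 : (∃ i, w i = v ∧ ∀ m, i < m → w m ≠ u) ↔
          ∃ i, Fin.init w i = v ∧ ∀ m, i < m → Fin.init w m ≠ u := by
        rw [Fin.exists_fin_succ']
        simp only [Fin.forall_fin_succ', hav, false_and, or_false, Fin.castSucc_lt_castSucc_iff,
          Fin.init]
        simp [hau]
      rw [h1, ← hih]
      simp only [Fin.lt_def, Fin.ext_iff]
      generalize (p u : ℕ) = x at *
      generalize (p v : ℕ) = y at *
      generalize (p (w (Fin.last n)) : ℕ) = z at *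
      clear h1 hih hu hu' ih hpos
      split_ifs <;> omega

/-- The pairs `i < j` carrying distinct letters, neither of which occurs strictly in between. -/
def adjPairs {k n : ℕ} (w : Fin n → Fin k) : Finset (Fin n × Fin n) :=
  {p | p.1 < p.2 ∧ w p.1 ≠ w p.2 ∧ ∀ m, p.1 < m → m < p.2 → w m ≠ w p.1 ∧ w m ≠ w p.2}

/-- The last occurrences of the letters that are visible looking back for the letter `a`. -/
def visible {k n : ℕ} (w : Fin n → Fin k) (a : Fin k) : Finset (Fin n) :=
  {i | w i ≠ a ∧ ∀ m, i < m → w m ≠ w i ∧ w m ≠ a}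

lemma card_adjPairs_succ {k n : ℕ} (w : Fin (n + 1) → Fin k) :
    #(adjPairs w) = #(adjPairs (Fin.init w)) + #(visible (Fin.init w) (w (Fin.last n))) := by
  simp only [adjPairs, visible, card_filter, Fintype.sum_prod_type]
  simp only [Fin.sum_univ_castSucc, Fin.forall_fin_succ', Fin.init, sum_add_distrib]
  simp [Fin.castSucc_lt_last, (Fin.castSucc_lt_last _).not_gt, -sum_boole]
  congr!

lemma injOn_visible {k n : ℕ} (w : Fin n → Fin k) (a : Fin k) :
    Set.InjOn w (visible w a : Set (Fin n)) := by
  intro i hi j hj hij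
  simp only [visible, coe_filter, mem_univ, true_and, Set.mem_ofPred_eq] at hi hj
  rcases lt_trichotomy i j with h | h | h
  · exact absurd hij.symm (hi.2 j h).1
  · exact h
  · exact absurd hij (hj.2 i h).1

lemma card_visible_le {k n : ℕ} (w : Fin n → Fin k) (a : Fin k) : #(visible w a) ≤ k := by
  rw [← card_image_of_injOn (injOn_visible w a)]
  exact (card_le_univ _).trans (by simp)

lemma card_visible_eq {k n : ℕ} (w : Fin n → Fin k) (a : Fin k) (ha : ∃ i, w i = a) :
    #(visible w a) = mtfPos n w a := by
  have himg : (visible w a).image w = ({v | mtfPos n w v < mtfPos n w a} : Finset (Fin k)) := by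
    ext v
    simp only [visible, mem_image, mem_filter, mem_univ, true_and]
    constructor
    · rintro ⟨i, ⟨hia, hi⟩, rfl⟩
      exact (mtfPos_lt_iff w (Ne.symm hia) ha).2 ⟨i, rfl, fun m hm => (hi m hm).2⟩
    · intro h
      have hne : a ≠ v := by rintro rfl; exact lt_irrefl _ h
      obtain ⟨i, hi, hm⟩ := (mtfPos_lt_iff w hne ha).1 h
      have hs : ({i | w i = v} : Finset (Fin n)).Nonempty := ⟨i, by simpa using hi⟩
      have hmem := max'_mem _ hs
      simp only [mem_filter, mem_univ, true_and] at hmem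
      refine ⟨_, ⟨hmem.trans_ne hne.symm, fun m hlt => ⟨fun h' => ?_, hm m ?_⟩⟩, hmem⟩
      · exact hlt.not_ge (le_max' _ _ (by simpa using h'.trans hmem))
      · exact (le_max' _ i (by simpa using hi)).trans_lt hlt
  rw [← card_image_of_injOn (injOn_visible w a), himg]
  have : ({v | mtfPos n w v < mtfPos n w a} : Finset (Fin k)) =
      (Iio (mtfPos n w a)).map (mtfPos n w).symm.toEmbedding := by
    ext v; simp [mem_map_equiv]
  rw [this, card_map, Fin.card_Iio]

/-- The move-to-front cost agrees with the number of adjacent pairs up to `k` per letter used. -/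
lemma mtfSum_adjPairs {k n : ℕ} (w : Fin n → Fin k) :
    mtfSum n w ≤ #(adjPairs w) + k * #(univ.image w) ∧
      #(adjPairs w) ≤ mtfSum n w + k * #(univ.image w) := by
  induction n with
  | zero => simp [mtfSum, adjPairs]
  | succ n ih =>
    obtain ⟨h1, h2⟩ := ih (Fin.init w)
    rw [card_adjPairs_succ, mtfSum]
    have himg : univ.image w = insert (w (Fin.last n)) (univ.image (Fin.init w)) := by
      ext v
      simp [Fin.exists_fin_succ', Fin.init, or_comm, eq_comm]
    by_cases ha : ∃ i, Fin.init w i = w (Fin.last n)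
    · rw [card_visible_eq _ _ ha, himg, insert_eq_of_mem (by simpa using ha)]
      omega
    · rw [himg, card_insert_of_notMem (by simpa using ha), mul_add, mul_one]
      have := card_visible_le (Fin.init w) (w (Fin.last n))
      have := (mtfPos n (Fin.init w) (w (Fin.last n))).2
      omega

lemma mtfSum_adjPairs_sq {k n : ℕ} (w : Fin n → Fin k) :
    mtfSum n w ≤ #(adjPairs w) + k ^ 2 ∧ #(adjPairs w) ≤ mtfSum n w + k ^ 2 := by
  have h := mtfSum_adjPairs w
  have : k * #(univ.image w) ≤ k ^ 2 := by
    rw [sq]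
    exact Nat.mul_le_mul_left _ ((card_le_univ _).trans (by simp))
  omega

open Classical in
/-- The partition of positions into the level sets of a word. -/
noncomputable def wordPart {k n : ℕ} (w : Fin n → Fin k) : Finpartition (univ : Finset (Fin n)) :=
  Finpartition.ofSetoid (Setoid.ker w)

lemma mem_part_wordPart {k n : ℕ} (w : Fin n → Fin k) (a b : Fin n) :
    b ∈ (wordPart w).part a ↔ w a = w b := by
  classical
  exact Finpartition.mem_part_ofSetoid_iff_rel (s := Setoid.ker w)

lemma mem_iff_of_mem_parts {k n : ℕ} (w : Fin n → Fin k) {B : Finset (Fin n)}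
    (hB : B ∈ (wordPart w).parts) {a b : Fin n} (ha : a ∈ B) : b ∈ B ↔ w a = w b := by
  rw [← (wordPart w).part_eq_of_mem hB ha, mem_part_wordPart]

lemma sameBlock_wordPart {k n : ℕ} (w : Fin n → Fin k) (a b : Fin n) :
    sameBlock (wordPart w) a b ↔ w a = w b := by
  rw [← mem_part_wordPart, Finpartition.mem_part_iff_exists]
  simp only [sameBlock, and_comm]

lemma isArc_wordPart {k n : ℕ} (w : Fin n → Fin k) (a b : Fin n) :
    IsArc (wordPart w) a b ↔ a < b ∧ w a = w b ∧ ∀ c, a < c → c < b → w c ≠ w a := by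
  simp only [IsArc, sameBlock_wordPart, ne_eq, eq_comm]

lemma IsArc.isChord {n : ℕ} {π : Finpartition (univ : Finset (Fin n))} {a b : Fin n}
    (h : IsArc π a b) : IsChord π a b := by
  obtain ⟨hab, ⟨B, hB, ha, hb⟩, hc⟩ := h
  exact ⟨hab, B, hB, ha, hb, Or.inl fun c hcB hac => hc c hac.1 hac.2 ⟨B, hB, ha, hcB⟩⟩

/-- `a` and `b` are the first and last elements of their common level set. -/
def IsLong {k n : ℕ} (w : Fin n → Fin k) (a b : Fin n) : Prop :=
  w a = w b ∧ ∀ c, w c = w a → a ≤ c ∧ c ≤ b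

lemma IsChord.isArc_or_isLong {k n : ℕ} {w : Fin n → Fin k} {a b : Fin n}
    (h : IsChord (wordPart w) a b) : IsArc (wordPart w) a b ∨ IsLong w a b := by
  obtain ⟨hab, B, hB, ha, hb, h | ⟨-, h⟩⟩ := h
  · refine Or.inl ((isArc_wordPart w a b).2 ⟨hab, (mem_iff_of_mem_parts w hB ha).1 hb, ?_⟩)
    intro c hac hcb hw
    exact h c ((mem_iff_of_mem_parts w hB ha).2 hw.symm) ⟨hac, hcb⟩
  · refine Or.inr ⟨(mem_iff_of_mem_parts w hB ha).1 hb, fun c hc => h c ?_⟩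
    exact (mem_iff_of_mem_parts w hB ha).2 hc.symm

lemma IsLong.unique {k n : ℕ} {w : Fin n → Fin k} {a b a' b' : Fin n} (h : IsLong w a b)
    (h' : IsLong w a' b') (hw : w a = w a') : a = a' ∧ b = b' :=
  ⟨le_antisymm (h.2 a' hw.symm).1 (h'.2 a hw).1,
    le_antisymm (h'.2 b (h.1.symm.trans hw)).2 (h.2 b' (h'.1.symm.trans hw.symm)).2⟩

/-- Two arcs of the same block over a common interior point coincide. -/
lemma IsArc.unique {k n : ℕ} {w : Fin n → Fin k} {a b a' b' x : Fin n}
    (h : IsArc (wordPart w) a b) (h' : IsArc (wordPart w) a' b') (hw : w a = w a')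
    (hax : a < x) (hxb : x < b) (hax' : a' < x) (hxb' : x < b') : a = a' ∧ b = b' := by
  rw [isArc_wordPart] at h h'
  obtain ⟨-, hb, h⟩ := h
  obtain ⟨-, hb', h'⟩ := h'
  constructor
  · rcases lt_trichotomy a a' with hlt | heq | hlt
    · exact absurd hw.symm (h a' hlt (hax'.trans hxb))
    · exact heq
    · exact absurd hw (h' a hlt (hax.trans hxb'))
  · rcases lt_trichotomy b b' with hlt | heq | hlt
    · exact absurd (hb.symm.trans hw) (h' b (hax'.trans hxb) hlt)
    · exact heq
    · exact absurd (hb'.symm.trans hw.symm) (h b' (hax.trans hxb') hlt)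

/-- A set that is determined by two letters has at most `k ^ 2` elements. -/
lemma ncard_le_sq {α : Type*} {k : ℕ} (S : Set α) (f : α → Fin k × Fin k) (hf : Set.InjOn f S) :
    S.ncard ≤ k ^ 2 := by
  rw [← hf.ncard_image]
  refine (Set.ncard_le_card _).trans ?_
  simp [sq]

lemma crl_le_crc {n : ℕ} (π : Finpartition (univ : Finset (Fin n))) : crl π ≤ crc π :=
  Set.ncard_le_ncard (fun _ hq => ⟨hq.1.isChord, hq.2.1.isChord, hq.2.2⟩) (Set.toFinite _)

lemma crc_wordPart_le {k n : ℕ} (w : Fin n → Fin k) :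
    crc (wordPart w) ≤ crl (wordPart w) + 3 * k ^ 2 := by
  let X : Set ((Fin n × Fin n) × (Fin n × Fin n)) :=
    {q | q.1.1 < q.2.1 ∧ q.2.1 < q.1.2 ∧ q.1.2 < q.2.2}
  let S₁ : Set ((Fin n × Fin n) × (Fin n × Fin n)) :=
    {q | IsLong w q.1.1 q.1.2 ∧ IsArc (wordPart w) q.2.1 q.2.2 ∧ q ∈ X}
  let S₂ : Set ((Fin n × Fin n) × (Fin n × Fin n)) :=
    {q | IsArc (wordPart w) q.1.1 q.1.2 ∧ IsLong w q.2.1 q.2.2 ∧ q ∈ X}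
  let S₃ : Set ((Fin n × Fin n) × (Fin n × Fin n)) :=
    {q | IsLong w q.1.1 q.1.2 ∧ IsLong w q.2.1 q.2.2}
  let S₀ : Set ((Fin n × Fin n) × (Fin n × Fin n)) :=
    {q | IsArc (wordPart w) q.1.1 q.1.2 ∧ IsArc (wordPart w) q.2.1 q.2.2 ∧
      q.1.1 < q.2.1 ∧ q.2.1 < q.1.2 ∧ q.1.2 < q.2.2}
  let f : (Fin n × Fin n) × (Fin n × Fin n) → Fin k × Fin k := fun q => (w q.1.1, w q.2.1)
  have h₁ : S₁.ncard ≤ k ^ 2 := by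
    refine ncard_le_sq _ f ?_
    rintro ⟨⟨a, b⟩, ⟨c, d⟩⟩ ⟨hl, ha, -, h1, h2⟩ ⟨⟨a', b'⟩, ⟨c', d'⟩⟩ ⟨hl', ha', -, h1', h2'⟩ hf
    simp only [f, Prod.mk.injEq] at *
    obtain ⟨rfl, rfl⟩ := hl.unique hl' hf.1
    exact ⟨⟨rfl, rfl⟩, ha.unique ha' hf.2 h1 h2 h1' h2'⟩
  have h₂ : S₂.ncard ≤ k ^ 2 := by
    refine ncard_le_sq _ f ?_
    rintro ⟨⟨a, b⟩, ⟨c, d⟩⟩ ⟨ha, hl, h1, h2, -⟩ ⟨⟨a', b'⟩, ⟨c', d'⟩⟩ ⟨ha', hl', h1', h2', -⟩ hf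
    simp only [f, Prod.mk.injEq] at *
    obtain ⟨rfl, rfl⟩ := hl.unique hl' hf.2
    exact ⟨ha.unique ha' hf.1 h1 h2 h1' h2', ⟨rfl, rfl⟩⟩
  have h₃ : S₃.ncard ≤ k ^ 2 := by
    refine ncard_le_sq _ f ?_
    rintro ⟨⟨a, b⟩, ⟨c, d⟩⟩ ⟨hl₁, hl₂⟩ ⟨⟨a', b'⟩, ⟨c', d'⟩⟩ ⟨hl₁', hl₂'⟩ hf
    simp only [f, Prod.mk.injEq] at *
    exact ⟨hl₁.unique hl₁' hf.1, hl₂.unique hl₂' hf.2⟩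
  have hsub : crc (wordPart w) ≤ (S₀ ∪ (S₁ ∪ (S₂ ∪ S₃))).ncard := by
    refine Set.ncard_le_ncard ?_ (Set.toFinite _)
    rintro q ⟨hc₁, hc₂, hX⟩
    rcases hc₁.isArc_or_isLong with h | h <;> rcases hc₂.isArc_or_isLong with h' | h'
    · exact Or.inl ⟨h, h', hX⟩
    · exact Or.inr (Or.inr (Or.inl ⟨h, h', hX⟩))
    · exact Or.inr (Or.inl ⟨h, h', hX⟩)
    · exact Or.inr (Or.inr (Or.inr ⟨h, h'⟩))
  have hu₁ := Set.ncard_union_le S₀ (S₁ ∪ (S₂ ∪ S₃))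
  have hu₂ := Set.ncard_union_le S₁ (S₂ ∪ S₃)
  have hu₃ := Set.ncard_union_le S₂ S₃
  have h₀ : S₀.ncard = crl (wordPart w) := rfl
  omega

lemma crl_wordPart_le {k n : ℕ} (w : Fin n → Fin k) : crl (wordPart w) ≤ #(adjPairs w) := by
  rw [crl, ← Set.ncard_coe_finset]
  refine Set.ncard_le_ncard_of_injOn (fun q => (q.2.1, q.1.2)) ?_ ?_ (Set.toFinite _)
  · rintro ⟨⟨a, b⟩, ⟨c, d⟩⟩ ⟨h₁, h₂, hac, hcb, hbd⟩
    simp only [isArc_wordPart] at *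
    simp only [adjPairs, coe_filter, mem_univ, true_and, Set.mem_ofPred_eq]
    refine ⟨hcb, fun h => h₂.2.2 b hcb hbd h.symm, fun m hcm hmb => ⟨h₂.2.2 m hcm (hmb.trans hbd),
      h₁.2.1 ▸ h₁.2.2 m (hac.trans hcm) hmb⟩⟩
  · rintro ⟨⟨a, b⟩, ⟨c, d⟩⟩ ⟨h₁, h₂, hac, hcb, hbd⟩ ⟨⟨a', b'⟩, ⟨c', d'⟩⟩
      ⟨h₁', h₂', hac', hcb', hbd'⟩ hf
    simp only [Prod.mk.injEq] at *
    obtain ⟨rfl, rfl⟩ := hf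
    have hw : w a = w a' :=
      ((isArc_wordPart w _ _).1 h₁).2.1.trans ((isArc_wordPart w _ _).1 h₁').2.1.symm
    exact ⟨h₁.unique h₁' hw hac hcb hac' hcb', h₂.unique h₂' rfl hcb hbd hcb' hbd'⟩

lemma exists_isArc_left {k n : ℕ} (w : Fin n → Fin k) (b : Fin n) (h : ∃ a < b, w a = w b) :
    ∃ a, IsArc (wordPart w) a b := by
  have hs : ({a | a < b ∧ w a = w b} : Finset (Fin n)).Nonempty := by
    obtain ⟨a, ha⟩ := h
    exact ⟨a, by simpa using ha⟩
  have hmem := max'_mem _ hs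
  simp only [mem_filter, mem_univ, true_and] at hmem
  refine ⟨_, (isArc_wordPart w _ _).2 ⟨hmem.1, hmem.2, fun c hac hcb hw => ?_⟩⟩
  exact hac.not_ge (le_max' _ _ (by simpa using ⟨hcb, hw.trans hmem.2⟩))

lemma exists_isArc_right {k n : ℕ} (w : Fin n → Fin k) (c : Fin n) (h : ∃ d, c < d ∧ w d = w c) :
    ∃ d, IsArc (wordPart w) c d := by
  have hs : ({d | c < d ∧ w d = w c} : Finset (Fin n)).Nonempty := by
    obtain ⟨d, hd⟩ := h
    exact ⟨d, by simpa using hd⟩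
  have hmem := min'_mem _ hs
  simp only [mem_filter, mem_univ, true_and] at hmem
  refine ⟨_, (isArc_wordPart w _ _).2 ⟨hmem.1, hmem.2.symm, fun e hce hed hw => ?_⟩⟩
  exact hed.not_ge (min'_le _ _ (by simpa using ⟨hce, hw⟩))

lemma adjPairs_le_crl {k n : ℕ} (w : Fin n → Fin k) :
    #(adjPairs w) ≤ crl (wordPart w) + 2 * k ^ 2 := by
  let S₁ : Set (Fin n × Fin n) := {p | p ∈ adjPairs w ∧ ∀ a < p.2, w a ≠ w p.2}
  let S₂ : Set (Fin n × Fin n) := {p | p ∈ adjPairs w ∧ ∀ d, p.1 < d → w d ≠ w p.1}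
  let S₀ : Set ((Fin n × Fin n) × (Fin n × Fin n)) :=
    {q | IsArc (wordPart w) q.1.1 q.1.2 ∧ IsArc (wordPart w) q.2.1 q.2.2 ∧
      q.1.1 < q.2.1 ∧ q.2.1 < q.1.2 ∧ q.1.2 < q.2.2}
  let f : Fin n × Fin n → Fin k × Fin k := fun p => (w p.1, w p.2)
  have h₁ : S₁.ncard ≤ k ^ 2 := by
    refine ncard_le_sq _ f ?_
    rintro ⟨c, b⟩ ⟨h, hb⟩ ⟨c', b'⟩ ⟨h', hb'⟩ hf
    simp only [f, adjPairs, mem_filter, mem_univ, true_and, Prod.mk.injEq] at *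
    obtain rfl : b = b' := by
      rcases lt_trichotomy b b' with hlt | heq | hlt
      · exact absurd hf.2 (hb' b hlt)
      · exact heq
      · exact absurd hf.2.symm (hb b' hlt)
    refine ⟨?_, rfl⟩
    rcases lt_trichotomy c c' with hlt | heq | hlt
    · exact absurd hf.1.symm (h.2.2 c' hlt h'.1).1
    · exact heq
    · exact absurd hf.1 (h'.2.2 c hlt h.1).1
  have h₂ : S₂.ncard ≤ k ^ 2 := by
    refine ncard_le_sq _ f ?_
    rintro ⟨c, b⟩ ⟨h, hc⟩ ⟨c', b'⟩ ⟨h', hc'⟩ hf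
    simp only [f, adjPairs, mem_filter, mem_univ, true_and, Prod.mk.injEq] at *
    obtain rfl : c = c' := by
      rcases lt_trichotomy c c' with hlt | heq | hlt
      · exact absurd hf.1.symm (hc c' hlt)
      · exact heq
      · exact absurd hf.1 (hc' c hlt)
    refine ⟨rfl, ?_⟩
    rcases lt_trichotomy b b' with hlt | heq | hlt
    · exact absurd hf.2 (h'.2.2 b h.1 hlt).2
    · exact heq
    · exact absurd hf.2.symm (h.2.2 b' h'.1 hlt).2
  have hsub : (adjPairs w : Set (Fin n × Fin n)) ⊆
      (fun q : (Fin n × Fin n) × (Fin n × Fin n) => (q.2.1, q.1.2)) '' S₀ ∪ (S₁ ∪ S₂) := by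
    rintro ⟨c, b⟩ hp
    by_cases hb : ∀ a < b, w a ≠ w b
    · exact Or.inr (Or.inl ⟨hp, hb⟩)
    by_cases hc : ∀ d, c < d → w d ≠ w c
    · exact Or.inr (Or.inr ⟨hp, hc⟩)
    push Not at hb hc
    obtain ⟨a, ha⟩ := exists_isArc_left w b hb
    obtain ⟨d, hd⟩ := exists_isArc_right w c hc
    refine Or.inl ⟨((a, b), (c, d)), ⟨ha, hd, ?_⟩, rfl⟩
    simp only [adjPairs, coe_filter, mem_univ, true_and, Set.mem_ofPred_eq] at hp
    obtain ⟨hcb, hne, hbt⟩ := hp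
    rw [isArc_wordPart] at ha hd
    refine ⟨?_, hcb, ?_⟩
    · rcases lt_trichotomy a c with hlt | heq | hlt
      · exact hlt
      · exact absurd (heq ▸ ha.2.1) hne
      · exact absurd ha.2.1 (hbt a hlt ha.1).2
    · rcases lt_trichotomy b d with hlt | heq | hlt
      · exact hlt
      · exact absurd (heq ▸ hd.2.1) hne
      · exact absurd hd.2.1.symm (hbt d hd.1 hlt).1
  have hle := Set.ncard_le_ncard hsub (Set.toFinite _)
  rw [Set.ncard_coe_finset] at hle
  have hu₁ := Set.ncard_union_le
    ((fun q : (Fin n × Fin n) × (Fin n × Fin n) => (q.2.1, q.1.2)) '' S₀) (S₁ ∪ S₂)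
  have hu₂ := Set.ncard_union_le S₁ S₂
  have him := Set.ncard_image_le (f := fun q : (Fin n × Fin n) × (Fin n × Fin n) => (q.2.1, q.1.2))
    (Set.toFinite S₀)
  have h₀ : S₀.ncard = crl (wordPart w) := rfl
  omega

/-- The circular crossing number is within `4 * k ^ 2` of the move-to-front cost. -/
lemma abs_crc_sub_mtfSum_le {k n : ℕ} (w : Fin n → Fin k) :
    |(crc (wordPart w) : ℝ) - mtfSum n w| ≤ 4 * k ^ 2 := by
  obtain ⟨h1, h2⟩ := mtfSum_adjPairs_sq w
  have h3 := adjPairs_le_crl w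
  have h4 := crl_wordPart_le w
  have h5 := crc_wordPart_le w
  have h6 := crl_le_crc (wordPart w)
  have hle : crc (wordPart w) ≤ mtfSum n w + 4 * k ^ 2 := by omega
  have hge : mtfSum n w ≤ crc (wordPart w) + 4 * k ^ 2 := by omega
  have hle' : (crc (wordPart w) : ℝ) ≤ mtfSum n w + 4 * k ^ 2 := by exact_mod_cast hle
  have hge' : (mtfSum n w : ℝ) ≤ crc (wordPart w) + 4 * k ^ 2 := by exact_mod_cast hge
  rw [abs_le]
  constructor <;> linarith

lemma finpartition_eq_of_part {n : ℕ} {P Q : Finpartition (univ : Finset (Fin n))}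
    (h : ∀ a, P.part a = Q.part a) : P = Q := by
  have key : ∀ {P Q : Finpartition (univ : Finset (Fin n))}, (∀ a, P.part a = Q.part a) →
      P.parts ⊆ Q.parts := by
    intro P Q h B hB
    obtain ⟨a, ha⟩ := P.nonempty_of_mem_parts hB
    rw [← P.part_eq_of_mem hB ha, h]
    exact Q.part_mem.2 (mem_univ a)
  exact Finpartition.ext ((key h).antisymm (key fun a => (h a).symm))

lemma wordPart_eq_iff {k n : ℕ} (w : Fin n → Fin k) (π : Finpartition (univ : Finset (Fin n))) :
    wordPart w = π ↔ ∀ a b, b ∈ π.part a ↔ w a = w b := by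
  constructor
  · rintro rfl a b
    exact mem_part_wordPart w a b
  · intro h
    refine finpartition_eq_of_part fun a => ?_
    ext b
    rw [mem_part_wordPart, h]

lemma card_parts_wordPart {k n : ℕ} {w : Fin n → Fin k} (hw : Function.Surjective w) :
    (wordPart w).parts.card = k := by
  have hmem : ∀ a, ({b | w b = w a} : Finset (Fin n)) = (wordPart w).part a := by
    intro a
    ext b
    rw [mem_part_wordPart]
    simp [eq_comm]
  refine Eq.trans (Eq.symm ?_) (card_fin k)
  refine card_bij (fun u _ => ({a | w a = u} : Finset (Fin n))) ?_ ?_ ?_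
  · intro u _
    obtain ⟨a, rfl⟩ := hw u
    rw [hmem]
    exact (wordPart w).part_mem.2 (mem_univ a)
  · intro u _ v _ huv
    obtain ⟨a, rfl⟩ := hw u
    have : a ∈ ({b | w b = v} : Finset (Fin n)) := huv ▸ by simp
    simpa using this
  · intro B hB
    obtain ⟨a, ha⟩ := (wordPart w).nonempty_of_mem_parts hB
    exact ⟨w a, mem_univ _, by rw [hmem, (wordPart w).part_eq_of_mem hB ha]⟩

open Classical in
/-- The words of length `n` using all `k` letters. -/
noncomputable def surjWords (n k : ℕ) : Finset (Fin n → Fin k) := {w | Function.Surjective w}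

open Classical in
/-- Every partition into `k` blocks has `k !` labellings of its blocks. -/
lemma card_surjWords_filter {k n : ℕ} (π : Finpartition (univ : Finset (Fin n)))
    (hπ : π.parts.card = k) : #{w ∈ surjWords n k | wordPart w = π} = k.factorial := by
  have hpart : ∀ i, π.part i ∈ π.parts := fun i => π.part_mem.2 (mem_univ i)
  have hcard : Fintype.card π.parts = Fintype.card (Fin k) := by simp [hπ]
  have hfac : Fintype.card (π.parts ≃ Fin k) = k.factorial := by
    rw [Fintype.card_equiv (Fintype.equivOfCardEq hcard), Fintype.card_coe, hπ]
  rw [← hfac, ← card_univ]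
  symm
  refine card_bij (fun e _ i => e ⟨π.part i, hpart i⟩) ?_ ?_ ?_
  · intro e _
    simp only [surjWords, mem_filter, mem_univ, true_and]
    constructor
    · intro u
      obtain ⟨B, rfl⟩ := e.surjective u
      obtain ⟨a, ha⟩ := π.nonempty_of_mem_parts B.2
      exact ⟨a, congrArg e (Subtype.ext (π.part_eq_of_mem B.2 ha))⟩
    · rw [wordPart_eq_iff]
      intro a b
      rw [e.injective.eq_iff, Subtype.mk.injEq, π.mem_part_iff_part_eq_part (mem_univ b)
        (mem_univ a), eq_comm]
  · intro e _ e' _ h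
    ext B : 1
    obtain ⟨a, ha⟩ := π.nonempty_of_mem_parts B.2
    have := congrFun h a
    have hB : (⟨π.part a, hpart a⟩ : π.parts) = B := Subtype.ext (π.part_eq_of_mem B.2 ha)
    simpa only [hB] using this
  · intro w hw
    simp only [surjWords, mem_filter, mem_univ, true_and, wordPart_eq_iff] at hw
    obtain ⟨hsurj, hw⟩ := hw
    choose r hr using fun B : π.parts => π.nonempty_of_mem_parts B.2
    have hrep : ∀ i, w (r ⟨π.part i, hpart i⟩) = w i := fun i => ((hw i _).1 (hr _)).symm
    have hbij : Function.Bijective fun B : π.parts => w (r B) := by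
      refine (Fintype.bijective_iff_surjective_and_card _).2 ⟨fun u => ?_, hcard⟩
      obtain ⟨a, rfl⟩ := hsurj u
      exact ⟨_, hrep a⟩
    exact ⟨Equiv.ofBijective _ hbij, mem_univ _, funext hrep⟩

lemma sum_surjWords (n k : ℕ) (F : Finpartition (univ : Finset (Fin n)) → ℝ) :
    ∑ w ∈ surjWords n k, F (wordPart w) = k.factorial * ∑ π ∈ Pik n k, F π := by
  classical
  rw [← sum_fiberwise_of_maps_to (t := Pik n k) (g := wordPart), mul_sum]
  · refine sum_congr rfl fun π hπ => ?_
    rw [sum_congr rfl (g := fun _ => F π) fun w hw => by rw [(mem_filter.1 hw).2], sum_const,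
      card_surjWords_filter π (by simpa [Pik] using hπ), nsmul_eq_mul]
  · intro w hw
    simpa [Pik] using card_parts_wordPart (by simpa [surjWords] using hw)

lemma stirling_eq_card (n k : ℕ) : stirling n k = #(Pik n k) := by
  classical
  rw [stirling, Nat.card_eq_fintype_card, Fintype.card_subtype, Pik]

lemma card_surjWords (n k : ℕ) : (#(surjWords n k) : ℝ) = k.factorial * stirling n k := by
  have := sum_surjWords n k fun _ => 1
  simpa [stirling_eq_card] using this

lemma avg_surjWords (n k : ℕ) (F : Finpartition (univ : Finset (Fin n)) → ℝ) :
    (∑ w ∈ surjWords n k, F (wordPart w)) / #(surjWords n k)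
      = (∑ π ∈ Pik n k, F π) / stirling n k := by
  rw [sum_surjWords, card_surjWords, mul_div_mul_left]
  exact_mod_cast k.factorial_ne_zero

lemma card_div_stirling (n k : ℕ) (θ : ℝ) :
    (Nat.card {π : Finpartition (univ : Finset (Fin n)) // π.parts.card = k ∧ (crc π : ℝ) ≤ θ} : ℝ)
      / stirling n k
      = (#{w ∈ surjWords n k | (crc (wordPart w) : ℝ) ≤ θ} : ℝ) / #(surjWords n k) := by
  classical
  have h := avg_surjWords n k fun π => if (crc π : ℝ) ≤ θ then 1 else 0
  rw [sum_boole, sum_boole] at h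
  rw [Nat.card_eq_fintype_card, Fintype.card_subtype, h, Pik, filter_filter]

lemma card_compl_surjWords_le (n k : ℕ) : #(surjWords n k)ᶜ ≤ k * (k - 1) ^ n := by
  have hsub : (surjWords n k)ᶜ ⊆
      (univ : Finset (Fin k)).biUnion fun u => Fintype.piFinset fun _ : Fin n => univ.erase u := by
    intro w hw
    have hw' : ¬ Function.Surjective w := fun h => mem_compl.1 hw (by simpa [surjWords] using h)
    simp only [Function.Surjective, not_forall, not_exists] at hw'
    obtain ⟨u, hu⟩ := hw'
    simpa using ⟨u, hu⟩
  refine (card_le_card hsub).trans (card_biUnion_le.trans ?_)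
  simp [Fintype.card_piFinset]

lemma card_compl_div_le {n k : ℕ} (hk : 2 ≤ k) (hkn : (k : ℝ) ≤ Real.sqrt n) :
    (#(surjWords n k)ᶜ : ℝ) / Fintype.card (Fin n → Fin k)
      ≤ Real.sqrt n * Real.exp (-Real.sqrt n) := by
  have hk0 : (0 : ℝ) < k := by positivity
  have h1 : (#(surjWords n k)ᶜ : ℝ) ≤ k * (k - 1) ^ n := by
    have := card_compl_surjWords_le n k
    rw [← Nat.cast_le (α := ℝ)] at this
    rwa [Nat.cast_mul, Nat.cast_pow, Nat.cast_sub (by omega), Nat.cast_one] at this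
  have h2 : (Fintype.card (Fin n → Fin k) : ℝ) = k ^ n := by simp
  rw [h2]
  have h3 : (1 : ℝ) - 1 / k ≤ Real.exp (-(1 / k)) := by
    have := Real.add_one_le_exp (-(1 / (k : ℝ)))
    linarith
  have h4 : (0 : ℝ) ≤ 1 - 1 / k := by
    rw [sub_nonneg, div_le_one hk0]
    exact_mod_cast (by omega : 1 ≤ k)
  have h5 : Real.sqrt n ≤ n * (1 / k) := by
    rw [mul_one_div, le_div_iff₀ hk0]
    calc _ ≤ Real.sqrt n * Real.sqrt n := by gcongr
      _ = _ := Real.mul_self_sqrt (by positivity)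
  calc _ ≤ (k : ℝ) * (k - 1) ^ n / k ^ n := by gcongr
    _ = k * (1 - 1 / k) ^ n := by
      rw [mul_div_assoc, ← div_pow, sub_div, div_self hk0.ne']
    _ ≤ k * Real.exp (-(1 / k)) ^ n := by gcongr
    _ = k * Real.exp (-(n * (1 / k))) := by rw [← Real.exp_nat_mul]; ring_nf
    _ ≤ _ := by gcongr

/-- Standardizing a statistic does not change its self-normalized lower tail. -/
lemma le_mean_add_sd_iff {ι : Type*} (A : Finset ι) (hA : A.Nonempty) (X : ι → ℝ) (m x : ℝ)
    {s : ℝ} (hs : 0 < s) (ω : ι) :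
    (X ω - m) / s ≤ (∑ ω ∈ A, (X ω - m) / s) / #A + x *
        Real.sqrt ((∑ ω ∈ A, ((X ω - m) / s) ^ 2) / #A - ((∑ ω ∈ A, (X ω - m) / s) / #A) ^ 2) ↔
      X ω ≤ (∑ ω ∈ A, X ω) / #A + x *
        Real.sqrt ((∑ ω ∈ A, X ω ^ 2) / #A - ((∑ ω ∈ A, X ω) / #A) ^ 2) := by
  have ha : (#A : ℝ) ≠ 0 := by exact_mod_cast hA.card_pos.ne'
  have h1 : (∑ ω ∈ A, (X ω - m) / s) / #A = ((∑ ω ∈ A, X ω) / #A - m) / s := by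
    rw [← sum_div, sum_sub_distrib, sum_const, nsmul_eq_mul]
    field_simp
  have h2 : (∑ ω ∈ A, ((X ω - m) / s) ^ 2) / #A - ((∑ ω ∈ A, (X ω - m) / s) / #A) ^ 2
      = ((∑ ω ∈ A, X ω ^ 2) / #A - ((∑ ω ∈ A, X ω) / #A) ^ 2) / s ^ 2 := by
    rw [h1]
    simp only [div_pow, sub_sq, ← sum_div, sum_add_distrib, sum_sub_distrib, ← sum_mul, ← mul_sum,
      sum_const, nsmul_eq_mul]
    field_simp
    ring
  rw [h2, h1, Real.sqrt_div' _ (by positivity), Real.sqrt_sq hs.le, ← mul_div_assoc, ← add_div,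
    div_le_div_iff_of_pos_right hs]
  constructor <;> intro h <;> linarith

lemma mtfSum_le {k : ℕ} (n : ℕ) (w : Fin n → Fin k) : mtfSum n w ≤ n * (k - 1) := by
  induction n with
  | zero => simp [mtfSum]
  | succ n ih =>
    have h := (mtfPos n (Fin.init w) (w (Fin.last n))).2
    rw [mtfSum, add_one_mul]
    exact Nat.add_le_add (ih _) (by omega)

/-- The standardization of a sum of `n` independent uniform variables on `{0, …, k - 1}`. -/
noncomputable def unifScore (n k : ℕ) (t : ℝ) : ℝ :=
  (t - n * ((k - 1) / 2)) / (Real.sqrt n * Real.sqrt ((k ^ 2 - 1) / 12))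

lemma sum_stdUnif_div_sqrt {n k : ℕ} (c : Fin n → Fin k) :
    (∑ i, stdUnif k (c i)) / Real.sqrt n = unifScore n k ((∑ i, (c i : ℕ) : ℕ) : ℝ) := by
  simp only [stdUnif, unifScore, ← sum_div, sum_sub_distrib, sum_const, card_univ,
    Fintype.card_fin, nsmul_eq_mul, Nat.cast_sum]
  rw [div_div, mul_comm (Real.sqrt n), mul_div_assoc', mul_sub]

lemma unifScore_sd_pos {n k : ℕ} (hn : 1 ≤ n) (hk : 2 ≤ k) :
    0 < Real.sqrt n * Real.sqrt (((k : ℝ) ^ 2 - 1) / 12) := by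
  have hk' : (2 : ℝ) ≤ k := by exact_mod_cast hk
  have hn' : (0 : ℝ) < n := by exact_mod_cast hn
  have : (0 : ℝ) < ((k : ℝ) ^ 2 - 1) / 12 := by nlinarith
  positivity

lemma sum_unifScore_mtfSum (n k : ℕ) :
    ∑ w : Fin n → Fin k, unifScore n k (mtfSum n w) = 0 := by
  rw [sum_mtfSum n fun t => unifScore n k t]
  simp_rw [← sum_stdUnif_div_sqrt]
  rw [← sum_div, sum_sum_apply_eq_zero _ (sum_stdUnif k), zero_div]

lemma sum_unifScore_mtfSum_sq {n k : ℕ} (hn : 1 ≤ n) (hk : 2 ≤ k) :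
    ∑ w : Fin n → Fin k, unifScore n k (mtfSum n w) ^ 2 = Fintype.card (Fin n → Fin k) := by
  have hn' : (n : ℝ) ≠ 0 := by exact_mod_cast (by omega : n ≠ 0)
  rw [sum_mtfSum n fun t => unifScore n k t ^ 2]
  simp_rw [← sum_stdUnif_div_sqrt, div_pow, Real.sq_sqrt (Nat.cast_nonneg n)]
  rw [← sum_div, sum_sq_sum_apply _ (sum_stdUnif k) (sum_stdUnif_sq hk),
    mul_div_cancel_left₀ _ hn']
  simp

lemma card_unifScore_mtfSum_le (n k : ℕ) (x : ℝ) :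
    #{w : Fin n → Fin k | unifScore n k (mtfSum n w) ≤ x}
      = #{c : Fin n → Fin k | (∑ i, stdUnif k (c i)) / Real.sqrt n ≤ x} := by
  have h := sum_mtfSum (k := k) n fun t => if unifScore n k t ≤ x then 1 else 0
  simp_rw [← sum_stdUnif_div_sqrt] at h
  rwa [← card_filter, ← card_filter] at h

lemma unifScore_mtfSum_sq_le {n k : ℕ} (hk : 2 ≤ k) (w : Fin n → Fin k) :
    unifScore n k (mtfSum n w) ^ 2 ≤ 3 * n := by
  have hk' : (2 : ℝ) ≤ k := by exact_mod_cast hk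
  have hS : (mtfSum n w : ℝ) ≤ n * (k - 1) := by
    have := mtfSum_le n w
    rw [← Nat.cast_le (α := ℝ)] at this
    rwa [Nat.cast_mul, Nat.cast_sub (by omega), Nat.cast_one] at this
  have hS0 : (0 : ℝ) ≤ mtfSum n w := Nat.cast_nonneg _
  have hn : (0 : ℝ) ≤ n := Nat.cast_nonneg _
  have hq : (0 : ℝ) ≤ ((k : ℝ) ^ 2 - 1) / 12 := by nlinarith
  rw [unifScore, div_pow, mul_pow, Real.sq_sqrt hn, Real.sq_sqrt hq]
  refine div_le_of_le_mul₀ (by positivity) (by positivity) ?_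
  have h1 : ((mtfSum n w : ℝ) - n * ((k - 1) / 2)) ^ 2 ≤ (n * ((k - 1) / 2)) ^ 2 := by
    apply sq_le_sq' <;> linarith
  refine h1.trans ?_
  have h2 : 3 * (n : ℝ) * (n * ((k ^ 2 - 1) / 12)) - (n * ((k - 1) / 2)) ^ 2
      = n ^ 2 * ((k - 1) / 2) := by ring
  have h3 : (0 : ℝ) ≤ n ^ 2 * ((k - 1) / 2) := mul_nonneg (sq_nonneg _) (by linarith)
  linarith

lemma abs_unifScore_crc_sub_le {n k : ℕ} (hn : 1 ≤ n) (hk : 2 ≤ k) (w : Fin n → Fin k) :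
    |unifScore n k (crc (wordPart w)) - unifScore n k (mtfSum n w)|
      ≤ 16 * (k / Real.sqrt n) := by
  have hk' : (2 : ℝ) ≤ k := by exact_mod_cast hk
  have hn' : (0 : ℝ) < Real.sqrt n := Real.sqrt_pos.2 (by exact_mod_cast hn)
  have hq : (k : ℝ) / 4 ≤ Real.sqrt (((k : ℝ) ^ 2 - 1) / 12) :=
    Real.le_sqrt_of_sq_le (by nlinarith)
  rw [unifScore, unifScore, ← sub_div, sub_sub_sub_cancel_right, abs_div,
    abs_of_pos (unifScore_sd_pos hn hk)]
  calc _ ≤ 4 * (k : ℝ) ^ 2 / (Real.sqrt n * (k / 4)) := by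
        gcongr
        exact abs_crc_sub_mtfSum_le w
    _ = _ := by field_simp; norm_num

lemma tendsto_sqrt_natCast_atTop : Tendsto (fun n : ℕ => Real.sqrt n) atTop atTop :=
  Real.tendsto_sqrt_atTop.comp tendsto_natCast_atTop_atTop

lemma tendsto_mul_card_compl_surjWords {k : ℕ → ℕ} (hk1 : ∀ n, 2 ≤ k n)
    (hk2 : Tendsto (fun n : ℕ => (k n : ℝ) / Real.sqrt n) atTop (𝓝 0)) :
    Tendsto (fun n : ℕ => (1 + 3 * (n : ℝ)) *
      ((#(surjWords n (k n))ᶜ : ℝ) / Fintype.card (Fin n → Fin (k n)))) atTop (𝓝 0) := by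
  have h1 := ((Real.tendsto_pow_mul_exp_neg_atTop_nhds_zero 1).comp tendsto_sqrt_natCast_atTop)
  have h3 := ((Real.tendsto_pow_mul_exp_neg_atTop_nhds_zero 3).comp tendsto_sqrt_natCast_atTop)
  have hlim := h1.add (h3.const_mul 3)
  simp only [mul_zero, add_zero] at hlim
  refine squeeze_zero' (Eventually.of_forall fun n => by positivity) ?_ hlim
  filter_upwards [hk2.eventually_lt_const one_pos, eventually_ge_atTop 1] with n hn hn1
  have hs : 0 < Real.sqrt n := Real.sqrt_pos.2 (by exact_mod_cast hn1)
  have hkn : (k n : ℝ) ≤ Real.sqrt n := by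
    rw [div_lt_one hs] at hn
    exact hn.le
  have hsq : (n : ℝ) = Real.sqrt n ^ 2 := (Real.sq_sqrt (Nat.cast_nonneg n)).symm
  calc _ ≤ (1 + 3 * (n : ℝ)) * (Real.sqrt n * Real.exp (-Real.sqrt n)) := by
        gcongr
        exact card_compl_div_le (hk1 n) hkn
    _ = _ := by
        simp only [Function.comp_apply]
        nth_rw 1 [hsq]
        ring

lemma eventually_surjWords_nonempty {k : ℕ → ℕ} (hk1 : ∀ n, 2 ≤ k n)
    (hk2 : Tendsto (fun n : ℕ => (k n : ℝ) / Real.sqrt n) atTop (𝓝 0)) :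
    ∀ᶠ n in atTop, (surjWords n (k n)).Nonempty := by
  filter_upwards [(tendsto_mul_card_compl_surjWords hk1 hk2).eventually_lt_const one_pos] with n hn
  rw [nonempty_iff_ne_empty]
  intro h
  have : Nonempty (Fin (k n)) := ⟨⟨0, by linarith [hk1 n]⟩⟩
  rw [h, compl_empty, card_univ, div_self (by exact_mod_cast Fintype.card_ne_zero)] at hn
  have : (0 : ℝ) ≤ n := Nat.cast_nonneg n
  linarith

/-- Central limit theorem for the circular crossing number on `Π_n^{k_n}`, `k_n = o(√n)`. -/
theorem clt_crc (k : ℕ → ℕ) (hk1 : ∀ n, 2 ≤ k n)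
    (hk2 : Filter.Tendsto (fun n : ℕ => (k n : ℝ) / Real.sqrt n) Filter.atTop (nhds 0))
    (x : ℝ) :
    Filter.Tendsto (fun n : ℕ =>
        (Nat.card {π : Finpartition (univ : Finset (Fin n)) //
            π.parts.card = k n ∧
            (crc π : ℝ) ≤ EY n (k n) + x * Real.sqrt (VarY n (k n))} : ℝ)
          / (stirling n (k n) : ℝ))
      Filter.atTop (nhds (stdNormalCDF x)) := by
  have hclt : ∀ x, Tendsto (fun n => (#{w : Fin n → Fin (k n) |
      unifScore n (k n) (mtfSum n w) ≤ x} : ℝ) / Fintype.card (Fin n → Fin (k n)))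
      atTop (𝓝 (stdNormalCDF x)) := by
    intro x
    have h := tendsto_card_sum_div_sqrt_le (k := k) (fun n => by linarith [hk1 n])
      (fun n => stdUnif (k n)) (fun n => sum_stdUnif (k n)) (fun n => sum_stdUnif_sq (hk1 n))
      (fun n => abs_stdUnif_le (hk1 n)) x
    refine h.congr fun n => ?_
    rw [card_unifScore_mtfSum_le]
    simp
  have h := tendsto_card_le_of_close (fun n => surjWords n (k n))
    (fun n w => unifScore n (k n) (mtfSum n w))
    (fun n w => unifScore n (k n) (crc (wordPart w)))
    continuous_stdNormalCDF hclt (fun n => ⟨fun _ => ⟨0, by linarith [hk1 n]⟩⟩)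
    (Eventually.of_forall fun n => sum_unifScore_mtfSum n (k n))
    ((eventually_ge_atTop 1).mono fun n hn => sum_unifScore_mtfSum_sq hn (hk1 n))
    (Eventually.of_forall fun n w => unifScore_mtfSum_sq_le (hk1 n) w)
    (tendsto_mul_card_compl_surjWords hk1 hk2)
    (by simpa using hk2.const_mul 16)
    ((eventually_ge_atTop 1).mono fun n hn w _ => abs_unifScore_crc_sub_le hn (hk1 n) w) x
  refine h.congr' ?_
  filter_upwards [eventually_ge_atTop 1, eventually_surjWords_nonempty hk1 hk2] with n hn hne
  have hEY : EY n (k n) = (∑ w ∈ surjWords n (k n), (crc (wordPart w) : ℝ))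
      / #(surjWords n (k n)) := (avg_surjWords n (k n) fun π => (crc π : ℝ)).symm
  have hVarY : VarY n (k n) = (∑ w ∈ surjWords n (k n), (crc (wordPart w) : ℝ) ^ 2)
      / #(surjWords n (k n)) - EY n (k n) ^ 2 := by
    rw [VarY, avg_surjWords n (k n) fun π => (crc π : ℝ) ^ 2]
  rw [card_div_stirling, hVarY, hEY]
  congr 3
  exact filter_congr fun w _ => le_mean_add_sd_iff _ hne (fun w => (crc (wordPart w) : ℝ)) _ x
    (unifScore_sd_pos hn (hk1 n)) w
end

section
/- As n → ∞, the variance of the linear crossing number over all partitions of [n] satisfies Var(X_n) = (n³/(3·(log n)²))·(1 + 2·(log log n/log n)·(1+o(1))); equivalently, the quantity ((3·(log n)²·Var(X_n)/n³) − 1)·(log n)/(2·log log n) tends to 1 as n → ∞. -/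
open Finset

namespace CrossingVariance

section

variable {n : ℕ} {α : Type*} [DecidableEq α]

/-- The positions of a word at which a letter occurs for the first time. -/
def firstSet (f : Fin n → α) : Finset (Fin n) := {q | ∀ r < q, f r ≠ f q}

/-- The new letters met strictly after position `c`, before the next occurrence of `f c`. -/
def gapSet (f : Fin n → α) (c : Fin n) : Finset (Fin n) :=
  {b | c < b ∧ (∃ d, b < d ∧ f d = f c) ∧ (∀ e, c < e → e ≤ b → f e ≠ f c) ∧
    ∀ r, c < r → r < b → f r ≠ f b}

/-- The total gap count of a word. -/
def gapSum (f : Fin n → α) : ℕ := ∑ c, #(gapSet f c)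

/-- The number of letters occurring in a word. -/
def letters (f : Fin n → α) : ℕ := #(univ.image f)

lemma mem_firstSet {f : Fin n → α} {q : Fin n} :
    q ∈ firstSet f ↔ ∀ r < q, f r ≠ f q := by simp [firstSet]

lemma mem_gapSet {f : Fin n → α} {c b : Fin n} :
    b ∈ gapSet f c ↔ c < b ∧ (∃ d, b < d ∧ f d = f c) ∧ (∀ e, c < e → e ≤ b → f e ≠ f c) ∧
      ∀ r, c < r → r < b → f r ≠ f b := by simp [gapSet]

lemma injOn_firstSet (f : Fin n → α) : Set.InjOn f (firstSet f) := by
  intro a ha b hb hab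
  rw [mem_coe, mem_firstSet] at ha hb
  rcases lt_trichotomy a b with h | h | h
  · exact absurd hab (hb a h)
  · exact h
  · exact absurd hab.symm (ha b h)

lemma exists_first (f : Fin n → α) (a : Fin n) : ∃ q ∈ firstSet f, f q = f a ∧ q ≤ a := by
  have hne : ({r | f r = f a} : Finset (Fin n)).Nonempty := ⟨a, by simp⟩
  refine ⟨_, ?_, (mem_filter.1 (min'_mem _ hne)).2, min'_le _ _ (by simp)⟩
  rw [mem_firstSet]
  intro r hr h
  have h2 := (mem_filter.1 (min'_mem _ hne)).2
  exact absurd (min'_le _ r (by simp [h, h2])) (not_le.2 hr)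

lemma image_firstSet (f : Fin n → α) : (firstSet f).image f = univ.image f := by
  ext x
  simp only [mem_image, mem_univ, true_and]
  constructor
  · rintro ⟨a, -, h⟩; exact ⟨a, h⟩
  · rintro ⟨a, rfl⟩
    obtain ⟨q, h, h', -⟩ := exists_first f a
    exact ⟨q, h, h'⟩

lemma card_firstSet (f : Fin n → α) : #(firstSet f) = letters f := by
  rw [letters, ← image_firstSet, card_image_of_injOn (injOn_firstSet f)]

lemma gapSet_cons_succ (x : α) (f : Fin n → α) (c : Fin n) :
    gapSet (Fin.cons x f : Fin (n + 1) → α) c.succ = (gapSet f c).map (Fin.succEmb n) := by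
  ext b
  refine Fin.cases ?_ (fun b => ?_) b
  · simp [mem_gapSet]
  · simp only [mem_gapSet, mem_map, Fin.coe_succEmb, Fin.succ_inj, exists_eq_right]
    simp [Fin.exists_fin_succ, Fin.forall_fin_succ]

lemma gapSet_cons_zero (x : α) (f : Fin n → α) :
    gapSet (Fin.cons x f : Fin (n + 1) → α) 0 =
      ({b ∈ firstSet f | (∃ d, b < d ∧ f d = x) ∧ ∀ e ≤ b, f e ≠ x}).map (Fin.succEmb n) := by
  ext b
  refine Fin.cases ?_ (fun b => ?_) b
  · simp [mem_gapSet]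
  · simp only [mem_gapSet, mem_map, Fin.coe_succEmb, Fin.succ_inj, exists_eq_right, mem_filter,
      mem_firstSet]
    simp [Fin.exists_fin_succ, Fin.forall_fin_succ]
    tauto

lemma gapSum_cons (x : α) (f : Fin n → α) :
    gapSum (Fin.cons x f : Fin (n + 1) → α) =
      #{b ∈ firstSet f | (∃ d, b < d ∧ f d = x) ∧ ∀ e ≤ b, f e ≠ x} + gapSum f := by
  simp [gapSum, Fin.sum_univ_succ, gapSet_cons_zero, gapSet_cons_succ]

lemma letters_cons (x : α) (f : Fin n → α) :
    letters (Fin.cons x f : Fin (n + 1) → α) =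
      letters f + if x ∈ univ.image f then 0 else 1 := by
  have : univ.image (Fin.cons x f : Fin (n + 1) → α) = insert x (univ.image f) := by
    ext y; simp [Fin.exists_fin_succ, eq_comm]
  rw [letters, this]
  split_ifs with h
  · rw [insert_eq_of_mem h]; rfl
  · rw [card_insert_of_notMem h]; rfl

/-- The ranks of the elements of a finite linearly ordered set are `0, …, #s - 1`. -/
lemma sum_rank {β : Type*} [LinearOrder β] (s : Finset β) (φ : ℕ → ℝ) :
    ∑ p ∈ s, φ #{b ∈ s | b < p} = ∑ r ∈ range #s, φ r := by
  induction s using Finset.induction_on_max with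
  | empty => simp
  | insert a s ha ih =>
    have hn : a ∉ s := fun h => lt_irrefl _ (ha a h)
    rw [sum_insert hn, card_insert_of_notMem hn, sum_range_succ, ← ih, add_comm]
    congr 1
    · refine sum_congr rfl fun p hp => ?_
      congr 2
      rw [filter_insert, if_neg (ha p hp).not_gt]
    · congr 2
      rw [filter_insert, if_neg (lt_irrefl a), filter_true_of_mem ha]

lemma sum_gap_cons (f : Fin n → α) (φ : ℕ → ℝ) :
    ∑ x ∈ univ.image f, φ #{b ∈ firstSet f | (∃ d, b < d ∧ f d = x) ∧ ∀ e ≤ b, f e ≠ x} =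
      ∑ r ∈ range (letters f), φ r := by
  rw [← image_firstSet, sum_image (injOn_firstSet f), ← card_firstSet, ← sum_rank]
  refine sum_congr rfl fun p hp => ?_
  congr 2
  refine filter_congr fun b hb => ?_
  rw [mem_firstSet] at hp
  constructor
  · rintro ⟨-, h⟩
    by_contra h'
    exact h p (not_lt.1 h') rfl
  · intro h
    exact ⟨⟨p, h, rfl⟩, fun e he => hp e (he.trans_lt h)⟩

/-- Arcs of the kernel partition of a word. -/
def WordArc (f : Fin n → α) (a b : Fin n) : Prop :=
  a < b ∧ f a = f b ∧ ∀ c, a < c → c < b → f a ≠ f c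

/-- The linear crossing number of the kernel partition of a word. -/
noncomputable def wordCr (f : Fin n → α) : ℕ :=
  Set.ncard {q : (Fin n × Fin n) × (Fin n × Fin n) |
    WordArc f q.1.1 q.1.2 ∧ WordArc f q.2.1 q.2.2 ∧
    q.1.1 < q.2.1 ∧ q.2.1 < q.1.2 ∧ q.1.2 < q.2.2}

/-- Pairs of first occurrences `(q, b)`, `q < b`, such that the letter at `q` does not recur
after `b`. -/
def sepSet (f : Fin n → α) : Finset (Fin n × Fin n) :=
  {p | p.1 ∈ firstSet f ∧ p.2 ∈ firstSet f ∧ p.1 < p.2 ∧ ∀ d > p.2, f d ≠ f p.1}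

lemma exists_first_after (f : Fin n → α) {b c d : Fin n} (hd : b < d) (h : f d = f c) :
    ∃ e, b < e ∧ f e = f c ∧ ∀ r, b < r → r < e → f r ≠ f c := by
  have hne : ({r | b < r ∧ f r = f c} : Finset (Fin n)).Nonempty := ⟨d, by simp [hd, h]⟩
  have h2 := (mem_filter.1 (min'_mem _ hne)).2
  refine ⟨_, h2.1, h2.2, fun r hr hr' h => ?_⟩
  exact absurd (min'_le _ r (by simp [h, hr])) (not_le.2 hr')

lemma exists_last_before (f : Fin n → α) {b c d : Fin n} (hd : d < b) (h : f d = f c) :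
    ∃ e, e < b ∧ f e = f c ∧ ∀ r, e < r → r < b → f r ≠ f c := by
  have hne : ({r | r < b ∧ f r = f c} : Finset (Fin n)).Nonempty := ⟨d, by simp [hd, h]⟩
  have h2 := (mem_filter.1 (max'_mem _ hne)).2
  refine ⟨_, h2.1, h2.2, fun r hr hr' h => ?_⟩
  exact absurd (le_max' _ r (by simp [h, hr'])) (not_le.2 hr)

lemma wordCr_eq (f : Fin n → α) :
    wordCr f = #{p : Fin n × Fin n | p.2 ∈ gapSet f p.1 ∧ p.2 ∉ firstSet f} := by
  rw [wordCr, ← Set.ncard_coe_finset]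
  refine Set.ncard_congr (fun q _ => (q.2.1, q.1.2)) ?_ ?_ ?_
  · rintro ⟨⟨a, b⟩, c, d⟩ ⟨⟨h1, h2, h3⟩, ⟨h4, h5, h6⟩, h7, h8, h9⟩
    simp only at h1 h2 h3 h4 h5 h6 h7 h8 h9
    simp only [coe_filter, mem_univ, true_and, Set.mem_ofPred_eq, mem_gapSet, mem_firstSet]
    refine ⟨⟨h8, ⟨d, h9, h5.symm⟩, fun e he he' => (h6 e he (he'.trans_lt h9)).symm, ?_⟩, ?_⟩
    · intro r hr hr'
      rw [← h2]
      exact (h3 r (h7.trans hr) hr').symm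
    · intro h
      exact h a h1 h2
  · rintro ⟨⟨a, b⟩, c, d⟩ ⟨⟨a', b'⟩, c', d'⟩ ⟨⟨h1, h2, h3⟩, ⟨h4, h5, h6⟩, h7, h8, h9⟩
      ⟨⟨h1', h2', h3'⟩, ⟨h4', h5', h6'⟩, h7', h8', h9'⟩ heq
    simp only [Prod.mk.injEq] at heq h1 h2 h3 h4 h5 h6 h7 h8 h9 h1' h2' h3' h4' h5' h6' h7' h8' h9'
    obtain ⟨rfl, rfl⟩ := heq
    have e1 : a = a' := by
      rcases lt_trichotomy a a' with h | h | h
      · exact absurd (h2.trans h2'.symm) (h3 a' h h1')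
      · exact h
      · exact absurd (h2'.trans h2.symm) (h3' a h h1)
    have e2 : d = d' := by
      rcases lt_trichotomy d d' with h | h | h
      · exact absurd h5 (h6' d h4 h)
      · exact h
      · exact absurd h5' (h6 d' h4' h)
    rw [e1, e2]
  · rintro ⟨c, b⟩ h
    simp only [coe_filter, mem_univ, true_and, Set.mem_ofPred_eq, mem_gapSet, mem_firstSet] at h
    obtain ⟨⟨h1, ⟨d₀, h2, h3⟩, h4, h5⟩, h6⟩ := h
    push Not at h6
    obtain ⟨a₀, h6, h7⟩ := h6
    obtain ⟨d, hd, hd', hd''⟩ := exists_first_after f h2 h3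
    obtain ⟨a, ha, ha', ha''⟩ := exists_last_before f h6 h7
    have hac : a < c := by
      rcases lt_trichotomy a c with h | h | h
      · exact h
      · subst h; exact absurd ha'.symm (h4 b h1 le_rfl)
      · exact absurd ha' (h5 a h ha)
    refine ⟨((a, b), (c, d)), ⟨⟨ha, ha', fun r hr hr' => ?_⟩,
      ⟨h1.trans hd, hd'.symm, fun r hr hr' => ?_⟩, hac, h1, hd⟩, rfl⟩
    · rw [ha']; exact (ha'' r hr hr').symm
    · rcases le_or_gt r b with h | h
      · exact (h4 r hr h).symm
      · exact (hd'' r h hr').symm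

lemma card_gap_first (f : Fin n → α) :
    #{p : Fin n × Fin n | p.2 ∈ gapSet f p.1 ∧ p.2 ∈ firstSet f} =
      #{p : Fin n × Fin n | p.1 ∈ firstSet f ∧ p.2 ∈ firstSet f ∧ p.1 < p.2 ∧
        ∃ d > p.2, f d = f p.1} := by
  choose F hF1 hF2 hF3 using exists_first f
  refine card_nbij (fun p => (F p.1, p.2)) ?_ ?_ ?_
  · rintro ⟨c, b⟩ h
    simp only [coe_filter, mem_univ, true_and, Set.mem_ofPred_eq, mem_gapSet] at h ⊢
    obtain ⟨⟨h1, ⟨d, h2, h3⟩, h4, h5⟩, h6⟩ := h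
    exact ⟨hF1 c, h6, (hF3 c).trans_lt h1, d, h2, h3.trans (hF2 c).symm⟩
  · rintro ⟨c, b⟩ h ⟨c', b'⟩ h' heq
    simp only [coe_filter, mem_univ, true_and, Set.mem_ofPred_eq, mem_gapSet, Prod.mk.injEq]
      at h h' heq ⊢
    obtain ⟨heq, rfl⟩ := heq
    have hc : f c = f c' := by rw [← hF2 c, ← hF2 c', heq]
    refine ⟨?_, rfl⟩
    rcases lt_trichotomy c c' with h0 | h0 | h0
    · exact absurd hc.symm (h.1.2.2.1 c' h0 h'.1.1.le)
    · exact h0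
    · exact absurd hc (h'.1.2.2.1 c h0 h.1.1.le)
  · rintro ⟨q, b⟩ h
    simp only [coe_filter, mem_univ, true_and, Set.mem_ofPred_eq] at h
    obtain ⟨h1, h2, h3, d, h4, h5⟩ := h
    obtain ⟨c, hc, hc', hc''⟩ := exists_last_before f (c := q) h3 rfl
    have hb : f b ≠ f q := (mem_firstSet.1 h2 q h3).symm
    refine ⟨(c, b), ?_, ?_⟩
    · simp only [coe_filter, mem_univ, true_and, Set.mem_ofPred_eq, mem_gapSet]
      refine ⟨⟨hc, ⟨d, h4, h5.trans hc'.symm⟩, fun e he he' => ?_, fun r _ hr => ?_⟩, h2⟩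
      · rw [hc']
        rcases he'.lt_or_eq with h | rfl
        · exact hc'' e he h
        · exact hb
      · exact mem_firstSet.1 h2 r hr
    · simp only [Prod.mk.injEq, and_true]
      exact injOn_firstSet f (hF1 c) h1 ((hF2 c).trans hc')

lemma card_pairs_lt {β : Type*} [LinearOrder β] [Fintype β] (s : Finset β) :
    (#{p : β × β | p.1 ∈ s ∧ p.2 ∈ s ∧ p.1 < p.2} : ℝ) = #s * (#s - 1) / 2 := by
  have h1 : #{p : β × β | p.1 ∈ s ∧ p.2 ∈ s ∧ p.1 < p.2} = ∑ b ∈ s, #{a ∈ s | a < b} := by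
    have : ({p : β × β | p.1 ∈ s ∧ p.2 ∈ s ∧ p.1 < p.2} : Finset (β × β)) =
        {p ∈ s ×ˢ s | p.1 < p.2} := by ext; simp [and_assoc]
    rw [this, card_filter, sum_product_right]
    simp only [card_filter]
  rw [h1, Nat.cast_sum, sum_rank s (fun k => (k : ℝ)), ← Nat.cast_sum]
  have h2 := sum_range_id_mul_two #s
  rcases Nat.eq_zero_or_pos #s with h | h
  · simp [h]
  · have h3 : ((∑ i ∈ range #s, i : ℕ) : ℝ) * 2 = #s * (#s - 1) := by
      have h4 : ((#s - 1 : ℕ) : ℝ) = #s - 1 := by push_cast [Nat.one_le_iff_ne_zero.2 h.ne']; rfl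
      rw [← h4]; exact_mod_cast h2
    linarith

lemma wordCr_add (f : Fin n → α) :
    (wordCr f : ℝ) = gapSum f - letters f * (letters f - 1) / 2 + #(sepSet f) := by
  have h1 : gapSum f = wordCr f +
      #{p : Fin n × Fin n | p.2 ∈ gapSet f p.1 ∧ p.2 ∈ firstSet f} := by
    have : gapSum f = #{p : Fin n × Fin n | p.2 ∈ gapSet f p.1} := by
      rw [gapSum, card_filter, ← univ_product_univ, sum_product]
      simp
    rw [this, wordCr_eq, add_comm, ← card_filter_add_card_filter_not (fun p => p.2 ∈ firstSet f),
      filter_filter, filter_filter]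
  have h2 : #{p : Fin n × Fin n | p.1 ∈ firstSet f ∧ p.2 ∈ firstSet f ∧ p.1 < p.2} =
      #{p : Fin n × Fin n | p.1 ∈ firstSet f ∧ p.2 ∈ firstSet f ∧ p.1 < p.2 ∧
        ∃ d > p.2, f d = f p.1} + #(sepSet f) := by
    rw [← card_filter_add_card_filter_not (fun p : Fin n × Fin n => ∃ d > p.2, f d = f p.1),
      filter_filter, filter_filter, sepSet]
    push Not
    simp only [and_assoc]
  have h3 := card_pairs_lt (firstSet f)
  rw [card_firstSet] at h3
  rw [← h3, h2, h1, card_gap_first]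
  push_cast
  ring

end

section

variable {n m : ℕ}

/-- The compensated gap count of a word over an alphabet with `m` letters. -/
noncomputable def compGap (f : Fin n → Fin m) : ℝ :=
  gapSum f + (letters f * ((m : ℝ) - 1) / 2 + letters f * ((letters f : ℝ) - 1) / 4)

/-- The number of letters not occurring in a word. -/
def unused (f : Fin n → Fin m) : ℕ := #(univ.image f)ᶜ

lemma letters_add_unused (f : Fin n → Fin m) : (letters f : ℝ) + unused f = m := by
  have := card_add_card_compl (univ.image f)
  rw [Fintype.card_fin] at this
  exact_mod_cast this

lemma wordCr_eq_compGap (f : Fin n → Fin m) :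
    (wordCr f : ℝ) = compGap f - 5 / 4 * (m * (m - 1)) +
      (unused f * ((m : ℝ) - 1) / 2 + 3 / 4 * (unused f * ((m : ℝ) + letters f - 1)) +
        #(sepSet f)) := by
  have h := letters_add_unused f
  have h' : (unused f : ℝ) = m - letters f := by linarith
  rw [wordCr_add, compGap, h']
  ring

lemma sum_cons (F : (Fin (n + 1) → Fin m) → ℝ) :
    ∑ f, F f = ∑ f : Fin n → Fin m, ∑ x, F (Fin.cons x f) := by
  rw [sum_comm, ← Fintype.sum_prod_type' (f := fun x f => F (Fin.cons x f))]
  exact (Equiv.sum_comp (Fin.consEquiv fun _ => Fin m) F).symm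

lemma compGap_cons (x : Fin m) (f : Fin n → Fin m) :
    compGap (Fin.cons x f : Fin (n + 1) → Fin m) = compGap f +
      if x ∈ univ.image f
      then (#{b ∈ firstSet f | (∃ d, b < d ∧ f d = x) ∧ ∀ e ≤ b, f e ≠ x} : ℝ)
      else ((m : ℝ) - 1) / 2 + (letters f : ℝ) / 2 := by
  rw [compGap, compGap, gapSum_cons, letters_cons]
  split_ifs with h
  · push_cast; ring
  · have : ({b ∈ firstSet f | (∃ d, b < d ∧ f d = x) ∧ ∀ e ≤ b, f e ≠ x} : Finset _) = ∅ := by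
      refine filter_eq_empty_iff.2 fun b _ hb => h ?_
      obtain ⟨⟨d, -, hd⟩, -⟩ := hb
      exact mem_image.2 ⟨d, mem_univ _, hd⟩
    rw [this]
    push_cast
    simp
    ring

lemma sum_step (f : Fin n → Fin m) (φ : ℝ → ℝ) :
    ∑ x, φ (compGap (Fin.cons x f : Fin (n + 1) → Fin m) - compGap f) =
      ∑ r ∈ range (letters f), φ r + unused f * φ (((m : ℝ) - 1) / 2 + (letters f : ℝ) / 2) := by
  rw [← sum_add_sum_compl (univ.image f), ← sum_gap_cons f fun r => φ r, unused,
    ← nsmul_eq_mul, ← sum_const]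
  congr 1
  · refine sum_congr rfl fun x hx => ?_
    rw [compGap_cons, if_pos hx, add_sub_cancel_left]
  · refine sum_congr rfl fun x hx => ?_
    rw [compGap_cons, if_neg (mem_compl.1 hx), add_sub_cancel_left]

lemma sum_range_sub (k : ℕ) (c : ℝ) :
    ∑ r ∈ range k, ((r : ℝ) - c) = k * (k - 1) / 2 - k * c := by
  induction k with
  | zero => simp
  | succ k ih => rw [sum_range_succ, ih]; push_cast; ring

lemma sum_range_sub_sq (k : ℕ) (c : ℝ) :
    ∑ r ∈ range k, ((r : ℝ) - c) ^ 2 =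
      k * (k - 1) * (2 * k - 1) / 6 - c * (k * (k - 1)) + k * c ^ 2 := by
  induction k with
  | zero => simp
  | succ k ih => rw [sum_range_succ, ih]; push_cast; ring

lemma sum_step_centered (f : Fin n → Fin m) :
    ∑ x, (compGap (Fin.cons x f : Fin (n + 1) → Fin m) - compGap f - ((m : ℝ) - 1) / 2) = 0 := by
  have h := letters_add_unused f
  rw [sum_step f (fun t => t - ((m : ℝ) - 1) / 2), sum_range_sub]
  have h' : (unused f : ℝ) = m - letters f := by linarith
  rw [h']; ring

lemma sum_step_centered_sq (f : Fin n → Fin m) :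
    ∑ x, (compGap (Fin.cons x f : Fin (n + 1) → Fin m) - compGap f - ((m : ℝ) - 1) / 2) ^ 2 =
      ((m : ℝ) * (m ^ 2 - 1) - unused f * ((unused f : ℝ) ^ 2 - 1)) / 12 := by
  have h := letters_add_unused f
  rw [sum_step f (fun t => (t - ((m : ℝ) - 1) / 2) ^ 2), sum_range_sub_sq]
  have h' : (unused f : ℝ) = m - letters f := by linarith
  rw [h']; ring

lemma sum_compGap (n m : ℕ) :
    ∑ f : Fin n → Fin m, (compGap f - n * (((m : ℝ) - 1) / 2)) = 0 := by
  induction n with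
  | zero => simp [compGap, gapSum, letters]
  | succ n ih =>
    rw [sum_cons]
    have : ∀ f : Fin n → Fin m, ∑ x, (compGap (Fin.cons x f : Fin (n + 1) → Fin m)
        - (n + 1 : ℕ) * (((m : ℝ) - 1) / 2)) = m * (compGap f - n * (((m : ℝ) - 1) / 2)) := by
      intro f
      have h0 := sum_step_centered f
      have : ∀ x, compGap (Fin.cons x f : Fin (n + 1) → Fin m) - (n + 1 : ℕ) * (((m : ℝ) - 1) / 2)
          = (compGap f - n * (((m : ℝ) - 1) / 2)) +
            (compGap (Fin.cons x f : Fin (n + 1) → Fin m) - compGap f - ((m : ℝ) - 1) / 2) := by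
        intro x; push_cast; ring
      simp_rw [this]
      rw [sum_add_distrib, h0]
      simp [mul_sub]
    simp_rw [this]
    rw [← mul_sum, ih, mul_zero]

lemma sum_compGap_sq_succ (n m : ℕ) :
    ∑ f : Fin (n + 1) → Fin m, (compGap f - (n + 1 : ℕ) * (((m : ℝ) - 1) / 2)) ^ 2 =
      (m : ℝ) * ∑ f : Fin n → Fin m, (compGap f - n * (((m : ℝ) - 1) / 2)) ^ 2 +
      ∑ f : Fin n → Fin m, ((m : ℝ) * (m ^ 2 - 1) - unused f * ((unused f : ℝ) ^ 2 - 1)) / 12 := by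
  rw [sum_cons, mul_sum, ← sum_add_distrib]
  refine sum_congr rfl fun f _ => ?_
  rw [← sum_step_centered_sq]
  have h0 := sum_step_centered f
  have : ∀ x, (compGap (Fin.cons x f : Fin (n + 1) → Fin m)
      - (n + 1 : ℕ) * (((m : ℝ) - 1) / 2)) ^ 2 = (compGap f - n * (((m : ℝ) - 1) / 2)) ^ 2 +
      2 * (compGap f - n * (((m : ℝ) - 1) / 2)) *
        (compGap (Fin.cons x f : Fin (n + 1) → Fin m) - compGap f - ((m : ℝ) - 1) / 2) +
      (compGap (Fin.cons x f : Fin (n + 1) → Fin m) - compGap f - ((m : ℝ) - 1) / 2) ^ 2 := by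
    intro x; push_cast; ring
  simp_rw [this]
  rw [sum_add_distrib, sum_add_distrib, ← mul_sum, h0]
  simp

lemma card_pi_filter (S : Fin n → Finset (Fin m)) :
    #{f : Fin n → Fin m | ∀ r, f r ∈ S r} = ∏ r, #(S r) := by
  rw [← Fintype.card_piFinset]
  congr 1
  ext f; simp

lemma card_avoid (i : Fin m) : #{f : Fin n → Fin m | ∀ r, f r ≠ i} = (m - 1) ^ n := by
  have := card_pi_filter (fun _ : Fin n => ({i}ᶜ : Finset (Fin m)))
  simpa [card_compl] using this

lemma unused_eq (f : Fin n → Fin m) : unused f = ∑ i, if ∀ r, f r ≠ i then 1 else 0 := by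
  rw [← card_filter, unused]
  congr 1
  ext; simp

lemma sum_unused (n m : ℕ) : ∑ f : Fin n → Fin m, unused f = m * (m - 1) ^ n := by
  simp_rw [unused_eq]
  rw [sum_comm]
  simp_rw [← card_filter, card_avoid]
  simp

lemma sum_unused_sq (n m : ℕ) :
    ∑ f : Fin n → Fin m, unused f ^ 2 ≤ m * (m - 1) ^ n + m ^ 2 * (m - 2) ^ n := by
  have h1 : ∀ f : Fin n → Fin m, unused f ^ 2 =
      ∑ i, ∑ j, if ∀ r, f r ≠ i ∧ f r ≠ j then 1 else 0 := by
    intro f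
    rw [unused_eq, sq, sum_mul_sum]
    refine sum_congr rfl fun i _ => sum_congr rfl fun j _ => ?_
    simp only [forall_and]
    split_ifs <;> first | rfl | tauto
  simp_rw [h1]
  rw [sum_comm]
  simp_rw [sum_comm (s := (univ : Finset (Fin n → Fin m))), ← card_filter]
  have h2 : ∀ i j : Fin m, #{f : Fin n → Fin m | ∀ r, f r ≠ i ∧ f r ≠ j} ≤
      (if i = j then (m - 1) ^ n else 0) + (m - 2) ^ n := by
    intro i j
    split_ifs with h
    · subst h
      simp only [and_self]
      rw [card_avoid]; exact Nat.le_add_right _ _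
    · have := card_pi_filter (fun _ : Fin n => ({i, j}ᶜ : Finset (Fin m)))
      simp only [mem_compl, mem_insert, mem_singleton, not_or, prod_const, card_univ,
        Fintype.card_fin, card_compl, card_pair h] at this
      simp only [ne_eq, this, zero_add, le_refl]
  calc _ ≤ ∑ i : Fin m, ∑ j : Fin m, ((if i = j then (m - 1) ^ n else 0) + (m - 2) ^ n) :=
        sum_le_sum fun i _ => sum_le_sum fun j _ => h2 i j
    _ = _ := by simp [sum_add_distrib]; ring

lemma sum_compGap_sq_le (n m : ℕ) :
    ∑ f : Fin n → Fin m, (compGap f - n * (((m : ℝ) - 1) / 2)) ^ 2 ≤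
      (m : ℝ) ^ n * (n * (m ^ 2 - 1) / 12) := by
  induction n with
  | zero => simp [compGap, gapSum, letters]
  | succ n ih =>
    rw [sum_compGap_sq_succ]
    have h1 : ∑ f : Fin n → Fin m,
        ((m : ℝ) * (m ^ 2 - 1) - unused f * ((unused f : ℝ) ^ 2 - 1)) / 12 ≤
        ∑ f : Fin n → Fin m, (m : ℝ) * (m ^ 2 - 1) / 12 := by
      refine sum_le_sum fun f _ => ?_
      have : 0 ≤ (unused f : ℝ) * ((unused f : ℝ) ^ 2 - 1) := by
        rcases Nat.eq_zero_or_pos (unused f) with h | h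
        · simp [h]
        · have : (1 : ℝ) ≤ unused f := by exact_mod_cast h
          exact mul_nonneg (by linarith) (by nlinarith)
      linarith
    have h2 := mul_le_mul_of_nonneg_left ih (Nat.cast_nonneg (α := ℝ) m)
    refine (add_le_add h2 h1).trans_eq ?_
    simp
    ring

lemma le_sum_compGap_sq (n m : ℕ) :
    (m : ℝ) ^ n * (n * (m ^ 2 - 1) / 12) - m ^ 3 / 12 * (m ^ n - ((m - 1 : ℕ) : ℝ) ^ n) ≤
    ∑ f : Fin n → Fin m, (compGap f - n * (((m : ℝ) - 1) / 2)) ^ 2 := by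
  induction n with
  | zero => simp [compGap, gapSum, letters]
  | succ n ih =>
    rw [sum_compGap_sq_succ]
    have h1 : ∑ f : Fin n → Fin m, ((m : ℝ) * (m ^ 2 - 1) / 12 - m ^ 2 / 12 * unused f) ≤
        ∑ f : Fin n → Fin m,
        ((m : ℝ) * (m ^ 2 - 1) - unused f * ((unused f : ℝ) ^ 2 - 1)) / 12 := by
      refine sum_le_sum fun f _ => ?_
      have h0 := letters_add_unused f
      have h2 : (unused f : ℝ) ≤ m := by linarith [Nat.cast_nonneg (α := ℝ) (letters f)]
      have h3 : (0 : ℝ) ≤ unused f := Nat.cast_nonneg _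
      have : (unused f : ℝ) * ((unused f : ℝ) ^ 2 - 1) ≤ m ^ 2 * unused f := by
        rw [mul_comm]
        exact mul_le_mul_of_nonneg_right (by nlinarith) h3
      linarith
    have h2 := mul_le_mul_of_nonneg_left ih (Nat.cast_nonneg (α := ℝ) m)
    refine le_trans (le_of_eq ?_) (add_le_add h2 h1)
    rw [sum_sub_distrib, ← mul_sum, ← Nat.cast_sum, sum_unused]
    rcases Nat.eq_zero_or_pos m with rfl | h
    · simp
    · have : ((m - 1 : ℕ) : ℝ) = m - 1 := by push_cast [Nat.one_le_iff_ne_zero.2 h.ne']; rfl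
      simp [this]
      ring

/-- The letter `i` does not occur after the first occurrence of the letter `j`. -/
def Separated (f : Fin n → Fin m) (i j : Fin m) : Prop :=
  ∃ p, f p = j ∧ (∀ r < p, f r ≠ j) ∧ ∀ r > p, f r ≠ i

instance (f : Fin n → Fin m) (i j : Fin m) : Decidable (Separated f i j) := by
  unfold Separated; infer_instance

lemma card_sepSet_le (f : Fin n → Fin m) :
    #(sepSet f) ≤ #{P ∈ (univ : Finset (Fin m)).offDiag | Separated f P.1 P.2} := by
  refine card_le_card_of_injOn (fun p => (f p.1, f p.2)) ?_ ?_
  · rintro ⟨q, b⟩ h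
    simp only [sepSet, coe_filter, mem_univ, true_and, Set.mem_ofPred_eq] at h
    simp only [coe_filter, mem_offDiag, mem_univ, true_and, Set.mem_ofPred_eq]
    obtain ⟨h1, h2, h3, h4⟩ := h
    rw [mem_firstSet] at h1 h2
    exact ⟨h2 q h3, b, rfl, h2, h4⟩
  · rintro ⟨q, b⟩ h ⟨q', b'⟩ h' heq
    simp only [sepSet, coe_filter, mem_univ, true_and, Set.mem_ofPred_eq] at h h'
    simp only [Prod.mk.injEq] at heq ⊢
    exact ⟨injOn_firstSet f h.1 h'.1 heq.1, injOn_firstSet f h.2.1 h'.2.1 heq.2⟩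

lemma card_separated_le {i j : Fin m} (hij : i ≠ j) :
    #{f : Fin n → Fin m | Separated f i j} ≤ n * (m - 1) ^ (n - 1) := by
  let S : Fin n → Fin n → Finset (Fin m) := fun p r => if r = p then {i} else {j}ᶜ
  let merge : Fin n → (Fin n → Fin m) → (Fin n → Fin m) :=
    fun p f r => if f r = i ∧ p ≤ r then j else f r
  have hsub : ({f : Fin n → Fin m | Separated f i j} : Finset _) ⊆
      univ.biUnion fun p => ({f : Fin n → Fin m | ∀ r, f r ∈ S p r} : Finset _).image
        (merge p) := by
    intro f hf
    obtain ⟨p, h1, h2, h3⟩ := (mem_filter.1 hf).2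
    simp only [mem_biUnion, mem_univ, true_and, mem_image, mem_filter]
    refine ⟨p, fun r => if f r = j then i else f r, fun r => ?_, funext fun r => ?_⟩
    · by_cases hr : r = p
      · subst hr; simp [S, h1]
      · by_cases hr' : f r = j <;> simp [S, hr, hr', hij]
    · by_cases hr' : f r = j
      · have : p ≤ r := not_lt.1 fun h => h2 r h hr'
        simp [merge, hr', this]
      · have : ¬ (f r = i ∧ p ≤ r) := by
          rintro ⟨h, h'⟩
          rcases h'.lt_or_eq with h' | rfl
          · exact h3 r h' h
          · exact hr' h1
        simp [merge, hr', this]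
  refine (card_le_card hsub).trans (card_biUnion_le.trans ?_)
  have hS : ∀ p : Fin n, #{f : Fin n → Fin m | ∀ r, f r ∈ S p r} = (m - 1) ^ (n - 1) := by
    intro p
    rw [card_pi_filter]
    have : ∀ r, #(S p r) = if r = p then 1 else m - 1 := by
      intro r
      simp only [S]
      split_ifs <;> simp [card_compl]
    simp_rw [this]
    rw [prod_ite]
    simp [filter_ne']
  calc _ ≤ ∑ p : Fin n, #{f : Fin n → Fin m | ∀ r, f r ∈ S p r} :=
        sum_le_sum fun p _ => card_image_le
    _ = _ := by simp [hS]

lemma card_separated_two_le {i j k l : Fin m} (hij : i ≠ j) (hkl : k ≠ l) (hik : i ≠ k)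
    (hil : i ≠ l) (hjk : j ≠ k) (hjl : j ≠ l) :
    #{f : Fin n → Fin m | Separated f i j ∧ Separated f k l} ≤ n ^ 2 * (m - 2) ^ (n - 2) := by
  let S : Fin n × Fin n → Fin n → Finset (Fin m) :=
    fun p r => if r = p.1 then {i} else if r = p.2 then {k} else {j, l}ᶜ
  let merge : Fin n × Fin n → (Fin n → Fin m) → (Fin n → Fin m) :=
    fun p f r => if f r = i ∧ p.1 ≤ r then j else if f r = k ∧ p.2 ≤ r then l else f r
  have hsub : ({f : Fin n → Fin m | Separated f i j ∧ Separated f k l} : Finset _) ⊆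
      ((univ : Finset (Fin n)).offDiag).biUnion fun p =>
        ({f : Fin n → Fin m | ∀ r, f r ∈ S p r} : Finset _).image (merge p) := by
    intro f hf
    obtain ⟨⟨p, h1, h2, h3⟩, ⟨q, h4, h5, h6⟩⟩ := (mem_filter.1 hf).2
    have hpq : p ≠ q := by rintro rfl; exact hjl (h1.symm.trans h4)
    simp only [mem_biUnion, mem_offDiag, mem_univ, true_and, mem_image, mem_filter]
    refine ⟨(p, q), hpq, fun r => if f r = j then i else if f r = l then k else f r,
      fun r => ?_, funext fun r => ?_⟩
    · by_cases hr : r = p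
      · subst hr; simp [S, h1]
      · by_cases hrq : r = q
        · subst hrq; simp [S, h4, hr, hjl.symm]
        · by_cases hr' : f r = j
          · simp [S, hr, hrq, hr', hij, hil]
          · by_cases hr'' : f r = l <;> simp [S, hr, hrq, hr', hr'', hkl, hjk.symm, hjl.symm]
    · by_cases hr' : f r = j
      · have : p ≤ r := not_lt.1 fun h => h2 r h hr'
        simp [merge, hr', this]
      · by_cases hr'' : f r = l
        · have : q ≤ r := not_lt.1 fun h => h5 r h hr''
          simp [merge, hr'', this, hjl.symm, hik.symm]
        · have h7 : ¬ (f r = i ∧ p ≤ r) := by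
            rintro ⟨h, h'⟩
            rcases h'.lt_or_eq with h' | rfl
            · exact h3 r h' h
            · exact hr' h1
          have h8 : ¬ (f r = k ∧ q ≤ r) := by
            rintro ⟨h, h'⟩
            rcases h'.lt_or_eq with h' | rfl
            · exact h6 r h' h
            · exact hr'' h4
          simp [merge, hr', hr'', h7, h8]
  refine (card_le_card hsub).trans (card_biUnion_le.trans ?_)
  have hS : ∀ p ∈ (univ : Finset (Fin n)).offDiag,
      #{f : Fin n → Fin m | ∀ r, f r ∈ S p r} = (m - 2) ^ (n - 2) := by
    intro p hp
    have hp' : p.1 ≠ p.2 := by simpa using hp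
    rw [card_pi_filter]
    have : ∀ r, #(S p r) = if r ∈ ({p.1, p.2} : Finset (Fin n)) then 1 else m - 2 := by
      intro r
      by_cases h1 : r = p.1
      · simp [S, h1]
      · by_cases h2 : r = p.2
        · simp [S, h2, hp'.symm]
        · have h3 : r ∉ ({p.1, p.2} : Finset (Fin n)) := by simp [h1, h2]
          simp only [S, if_neg h1, if_neg h2, if_neg h3]
          rw [card_compl, card_pair hjl, Fintype.card_fin]
    simp_rw [this]
    rw [prod_ite]
    have h3 : ({r | r ∉ ({p.1, p.2} : Finset (Fin n))} : Finset (Fin n)) = {p.1, p.2}ᶜ := by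
      ext; simp
    rw [prod_const_one, one_mul, prod_const, h3, card_compl, card_pair hp', Fintype.card_fin]
  calc _ ≤ ∑ p ∈ (univ : Finset (Fin n)).offDiag, #{f : Fin n → Fin m | ∀ r, f r ∈ S p r} :=
        sum_le_sum fun p _ => card_image_le
    _ = #(univ : Finset (Fin n)).offDiag * (m - 2) ^ (n - 2) := by
        rw [sum_congr rfl hS, sum_const, smul_eq_mul]
    _ ≤ _ := by
        refine Nat.mul_le_mul_right _ ?_
        simp [offDiag_card, sq]

lemma sum_card_sepSet_sq (n m : ℕ) :
    ∑ f : Fin n → Fin m, #(sepSet f) ^ 2 ≤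
      m ^ 4 * (n ^ 2 * (m - 2) ^ (n - 2)) + 4 * m ^ 3 * (n * (m - 1) ^ (n - 1)) := by
  set D := (univ : Finset (Fin m)).offDiag with hD
  set a := n ^ 2 * (m - 2) ^ (n - 2)
  set b := n * (m - 1) ^ (n - 1)
  have h1 : ∀ f : Fin n → Fin m, #(sepSet f) ^ 2 ≤
      ∑ P ∈ D, ∑ Q ∈ D, if Separated f P.1 P.2 ∧ Separated f Q.1 Q.2 then 1 else 0 := by
    intro f
    refine (Nat.pow_le_pow_left (card_sepSet_le f) 2).trans_eq ?_
    rw [card_filter, sq, sum_mul_sum]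
    refine sum_congr rfl fun P _ => sum_congr rfl fun Q _ => ?_
    split_ifs <;> first | rfl | tauto
  have h2 : ∀ P ∈ D, ∀ Q ∈ D,
      #{f : Fin n → Fin m | Separated f P.1 P.2 ∧ Separated f Q.1 Q.2} ≤
      a + ((if P.1 = Q.1 then b else 0) + (if P.1 = Q.2 then b else 0) +
        (if P.2 = Q.1 then b else 0) + (if P.2 = Q.2 then b else 0)) := by
    rintro ⟨i, j⟩ hP ⟨k, l⟩ hQ
    have hij : i ≠ j := by simpa [hD] using hP
    have hkl : k ≠ l := by simpa [hD] using hQ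
    have hb : #{f : Fin n → Fin m | Separated f i j ∧ Separated f k l} ≤ b :=
      (card_le_card (monotone_filter_right _ fun f _ h => h.1)).trans (card_separated_le hij)
    by_cases h : i ≠ k ∧ i ≠ l ∧ j ≠ k ∧ j ≠ l
    · exact (card_separated_two_le hij hkl h.1 h.2.1 h.2.2.1 h.2.2.2).trans (Nat.le_add_right _ _)
    · refine hb.trans ?_
      dsimp only
      split_ifs <;> omega
  calc _ ≤ ∑ f : Fin n → Fin m, ∑ P ∈ D, ∑ Q ∈ D,
        (if Separated f P.1 P.2 ∧ Separated f Q.1 Q.2 then 1 else 0) :=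
        sum_le_sum fun f _ => h1 f
    _ = ∑ P ∈ D, ∑ Q ∈ D,
        #{f : Fin n → Fin m | Separated f P.1 P.2 ∧ Separated f Q.1 Q.2} := by
        rw [sum_comm]
        refine sum_congr rfl fun P _ => ?_
        rw [sum_comm]
        simp only [card_filter]
    _ ≤ ∑ P ∈ D, ∑ Q ∈ D,
        (a + ((if P.1 = Q.1 then b else 0) + (if P.1 = Q.2 then b else 0) +
        (if P.2 = Q.1 then b else 0) + (if P.2 = Q.2 then b else 0))) :=
        sum_le_sum fun P hP => sum_le_sum fun Q hQ => h2 P hP Q hQ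
    _ ≤ ∑ P : Fin m × Fin m, ∑ Q : Fin m × Fin m,
        (a + ((if P.1 = Q.1 then b else 0) + (if P.1 = Q.2 then b else 0) +
        (if P.2 = Q.1 then b else 0) + (if P.2 = Q.2 then b else 0))) :=
        (sum_le_sum fun P _ => sum_le_sum_of_subset (subset_univ _)).trans
          (sum_le_sum_of_subset (subset_univ _))
    _ = _ := by
        have e1 : ∀ x : Fin m, ∑ Q : Fin m × Fin m, (if x = Q.1 then b else 0) = m * b := by
          intro x
          rw [Fintype.sum_prod_type_right]
          simp
        have e2 : ∀ x : Fin m, ∑ Q : Fin m × Fin m, (if x = Q.2 then b else 0) = m * b := by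
          intro x
          rw [Fintype.sum_prod_type]
          simp
        simp only [sum_add_distrib, e1, e2, sum_const, card_univ, Fintype.card_prod,
          Fintype.card_fin, smul_eq_mul]
        ring

end

section

variable {n m : ℕ}

lemma sameBlock_iff_mem_part (π : Finpartition (univ : Finset (Fin n))) (a b : Fin n) :
    sameBlock π a b ↔ a ∈ π.part b := π.mem_part_iff_exists.symm

lemma sameBlock_iff_part_eq (π : Finpartition (univ : Finset (Fin n))) (a b : Fin n) :
    sameBlock π a b ↔ π.part a = π.part b := by
  rw [sameBlock_iff_mem_part, π.mem_part_iff_part_eq_part (mem_univ _) (mem_univ _)]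

lemma parts_eq_image_part (π : Finpartition (univ : Finset (Fin n))) :
    π.parts = univ.image π.part := by
  ext B
  simp only [mem_image, mem_univ, true_and]
  constructor
  · intro hB
    obtain ⟨a, ha⟩ := π.nonempty_of_mem_parts hB
    exact ⟨a, π.part_eq_of_mem hB ha⟩
  · rintro ⟨a, rfl⟩
    exact π.part_mem.2 (mem_univ a)

instance (f : Fin n → Fin m) : DecidableRel (Setoid.ker f).r :=
  fun a b => decEq (f a) (f b)

/-- The kernel partition of a word: positions carrying the same letter form the blocks. -/
def kerPart (f : Fin n → Fin m) : Finpartition (univ : Finset (Fin n)) :=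
  Finpartition.ofSetoid (Setoid.ker f)

lemma sameBlock_kerPart (f : Fin n → Fin m) (a b : Fin n) :
    sameBlock (kerPart f) a b ↔ f a = f b := by
  rw [sameBlock_iff_mem_part, kerPart, Finpartition.mem_part_ofSetoid_iff_rel]
  exact eq_comm

lemma kerPart_eq_iff (f : Fin n → Fin m) (π : Finpartition (univ : Finset (Fin n))) :
    kerPart f = π ↔ ∀ a b, f a = f b ↔ sameBlock π a b := by
  constructor
  · rintro rfl a b
    exact (sameBlock_kerPart f a b).symm
  · intro h
    have : (kerPart f).part = π.part := by
      funext b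
      ext a
      rw [← sameBlock_iff_mem_part, ← sameBlock_iff_mem_part, sameBlock_kerPart, h]
    ext1
    rw [parts_eq_image_part, parts_eq_image_part, this]

lemma crl_kerPart (f : Fin n → Fin m) : crl (kerPart f) = wordCr f := by
  simp only [crl, wordCr, IsArc, WordArc, sameBlock_kerPart, ne_eq]

lemma card_kerPart_eq (π : Finpartition (univ : Finset (Fin n))) (m : ℕ) :
    #{f : Fin n → Fin m | kerPart f = π} = m.descFactorial #π.parts := by
  have h : m.descFactorial #π.parts = Fintype.card (π.parts ↪ Fin m) := by
    rw [Fintype.card_embedding_eq]; simp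
  rw [h, ← card_univ]
  symm
  refine card_bij (fun e _ a => e ⟨π.part a, π.part_mem.2 (mem_univ a)⟩) ?_ ?_ ?_
  · intro e _
    simp only [mem_filter, mem_univ, true_and, kerPart_eq_iff, sameBlock_iff_part_eq,
      EmbeddingLike.apply_eq_iff_eq, Subtype.mk.injEq, implies_true]
  · intro e _ e' _ h
    ext ⟨B, hB⟩
    obtain ⟨a, ha⟩ := π.nonempty_of_mem_parts hB
    have h1 := congrFun h a
    simp only [π.part_eq_of_mem hB ha] at h1
    rw [h1]
  · intro f hf
    simp only [mem_filter, mem_univ, true_and, kerPart_eq_iff] at hf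
    refine ⟨⟨fun B => f (π.nonempty_of_mem_parts B.2).choose, ?_⟩, mem_univ _, ?_⟩
    · rintro ⟨B, hB⟩ ⟨B', hB'⟩ h
      simp only [hf, sameBlock_iff_part_eq] at h
      rw [π.part_eq_of_mem hB (π.nonempty_of_mem_parts hB).choose_spec,
        π.part_eq_of_mem hB' (π.nonempty_of_mem_parts hB').choose_spec] at h
      exact Subtype.ext h
    · funext a
      change f _ = f a
      rw [hf, sameBlock_iff_mem_part]
      exact (π.nonempty_of_mem_parts (π.part_mem.2 (mem_univ a))).choose_spec

lemma sum_word_eq_sum_partition (G : Finpartition (univ : Finset (Fin n)) → ℝ) (m : ℕ) :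
    ∑ f : Fin n → Fin m, G (kerPart f) = ∑ π, G π * (m.descFactorial #π.parts : ℝ) := by
  rw [← sum_fiberwise univ kerPart]
  refine sum_congr rfl fun π _ => ?_
  rw [sum_congr rfl (g := fun _ => G π) (fun f hf => by rw [(mem_filter.1 hf).2]), sum_const,
    card_kerPart_eq, nsmul_eq_mul, mul_comm]

lemma hasSum_inv_factorial : HasSum (fun m : ℕ => 1 / (m.factorial : ℝ)) (Real.exp 1) := by
  have := NormedSpace.expSeries_div_hasSum_exp (𝔸 := ℝ) 1
  simpa [← Real.exp_eq_exp_ℝ] using this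

lemma hasSum_shift {g : ℕ → ℝ} {s : ℝ} :
    HasSum (fun m : ℕ => m * g (m - 1) / m.factorial) s ↔
      HasSum (fun m : ℕ => g m / m.factorial) s := by
  rw [← hasSum_nat_add_iff' 1]
  simp only [range_one, sum_singleton, Nat.cast_zero, zero_mul, zero_div, sub_zero]
  refine iff_of_eq (congrArg (fun u => HasSum u s) (funext fun m => ?_))
  rw [Nat.add_sub_cancel, Nat.factorial_succ]
  push_cast
  have : (m.factorial : ℝ) ≠ 0 := by positivity
  field_simp

lemma hasSum_descFactorial (k : ℕ) :
    HasSum (fun m : ℕ => (m.descFactorial k : ℝ) / m.factorial) (Real.exp 1) := by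
  induction k with
  | zero => simpa using hasSum_inv_factorial
  | succ k ih =>
    rw [← hasSum_shift] at ih
    convert ih using 3 with m
    rcases m with _ | m
    · simp
    · rw [Nat.succ_descFactorial_succ]; push_cast; simp

/-- `g` has expectation `s` under the Poisson distribution of mean one: `∑ g(m) / m! = s e`. -/
def PoissonMean (g : ℕ → ℝ) (s : ℝ) : Prop :=
  HasSum (fun m : ℕ => g m / m.factorial) (s * Real.exp 1)

lemma poissonMean_word (G : Finpartition (univ : Finset (Fin n)) → ℝ) :
    PoissonMean (fun m => ∑ f : Fin n → Fin m, G (kerPart f)) (∑ π, G π) := by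
  have := hasSum_sum (s := univ) fun (π : Finpartition (univ : Finset (Fin n))) _ =>
    (hasSum_descFactorial #π.parts).mul_left (G π)
  simpa only [PoissonMean, sum_word_eq_sum_partition, sum_div, mul_div_assoc, sum_mul] using this

lemma poissonMean_wordCr_pow (n j : ℕ) :
    PoissonMean (fun m => ∑ f : Fin n → Fin m, (wordCr f : ℝ) ^ j)
      (∑ π : Finpartition (univ : Finset (Fin n)), (crl π : ℝ) ^ j) := by
  have := poissonMean_word (n := n) fun π => (crl π : ℝ) ^ j
  simpa only [crl_kerPart] using this

end

namespace PoissonMean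

variable {g h : ℕ → ℝ} {s t : ℝ}

lemma pow (n : ℕ) : PoissonMean (fun m => (m : ℝ) ^ n) (bell n) := by
  have := poissonMean_word (n := n) fun _ => 1
  simpa [bell, Nat.card_eq_fintype_card] using this

lemma add (hg : PoissonMean g s) (hh : PoissonMean h t) :
    PoissonMean (fun m => g m + h m) (s + t) := by
  simpa only [PoissonMean, add_div, add_mul] using HasSum.add hg hh

lemma sub (hg : PoissonMean g s) (hh : PoissonMean h t) :
    PoissonMean (fun m => g m - h m) (s - t) := by
  simpa only [PoissonMean, sub_div, sub_mul] using HasSum.sub hg hh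

lemma const_mul (c : ℝ) (hg : PoissonMean g s) : PoissonMean (fun m => c * g m) (c * s) := by
  simpa only [PoissonMean, mul_div_assoc, mul_assoc] using HasSum.mul_left c hg

lemma shift (hg : PoissonMean g s) : PoissonMean (fun m => m * g (m - 1)) s := hasSum_shift.2 hg

lemma congr (hg : PoissonMean g s) (heq : ∀ m, h m = g m) : PoissonMean h s := by
  simpa only [PoissonMean, heq] using hg

lemma mono (hg : PoissonMean g s) (hh : PoissonMean h t) (hle : ∀ m, g m ≤ h m) : s ≤ t :=
  le_of_mul_le_mul_right (hasSum_le
    (fun m => div_le_div_of_nonneg_right (hle m) (Nat.cast_nonneg _)) hg hh) (Real.exp_pos 1)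

lemma nonneg (hg : PoissonMean g s) (h0 : ∀ m, 0 ≤ g m) : 0 ≤ s :=
  nonneg_of_mul_nonneg_left (HasSum.nonneg (fun m => div_nonneg (h0 m) (Nat.cast_nonneg _)) hg)
    (Real.exp_pos 1)

/-- Comparison: a nonnegative function below one with mean `t` has some mean at most `t`. -/
lemma exists_of_le (hh : PoissonMean h t) (h0 : ∀ m, 0 ≤ g m) (hle : ∀ m, g m ≤ h m) :
    ∃ s ≤ t, PoissonMean g s := by
  have hg : Summable fun m : ℕ => g m / m.factorial :=
    Summable.of_nonneg_of_le (fun m => div_nonneg (h0 m) (Nat.cast_nonneg _))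
      (fun m => div_le_div_of_nonneg_right (hle m) (Nat.cast_nonneg _)) hh.summable
  have hG : PoissonMean g ((∑' m : ℕ, g m / m.factorial) / Real.exp 1) := by
    rw [PoissonMean, div_mul_cancel₀ _ (Real.exp_pos 1).ne']
    exact hg.hasSum
  exact ⟨_, hG.mono hh hle, hG⟩

end PoissonMean

lemma hasSum_pow (n : ℕ) :
    HasSum (fun m : ℕ => (m : ℝ) ^ n / m.factorial) (bell n * Real.exp 1) := PoissonMean.pow n

lemma bell_pos (n : ℕ) : 0 < bell n := by
  rw [bell, Nat.card_pos_iff]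
  exact ⟨⟨⊥⟩, inferInstance⟩

lemma cast_bell_pos (n : ℕ) : (0 : ℝ) < bell n := by exact_mod_cast bell_pos n

lemma bell_succ (n : ℕ) : (bell (n + 1) : ℝ) = ∑ k ∈ range (n + 1), (n.choose k : ℝ) * bell k := by
  have h1 : HasSum (fun m : ℕ => ((m : ℝ) + 1) ^ n / m.factorial)
      ((∑ k ∈ range (n + 1), n.choose k * (bell k : ℝ)) * Real.exp 1) := by
    have := hasSum_sum (s := range (n + 1)) fun k _ => (hasSum_pow k).mul_left (n.choose k : ℝ)
    simp only [← mul_assoc, ← sum_mul] at this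
    have e : ∀ m : ℕ, ((m : ℝ) + 1) ^ n / m.factorial =
        ∑ k ∈ range (n + 1), (n.choose k : ℝ) * ((m : ℝ) ^ k / m.factorial) := by
      intro m
      rw [add_pow, sum_div]
      exact sum_congr rfl fun k _ => by ring
    simpa only [e] using this
  rw [← hasSum_shift] at h1
  have h2 : (fun m : ℕ => (m : ℝ) * (((m - 1 : ℕ) : ℝ) + 1) ^ n / m.factorial) =
      fun m : ℕ => (m : ℝ) ^ (n + 1) / m.factorial := by
    funext m
    rcases m with _ | m
    · simp
    · simp only [Nat.add_sub_cancel]; push_cast; ring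
  rw [h2] at h1
  exact mul_right_cancel₀ (Real.exp_pos 1).ne' ((hasSum_pow (n + 1)).unique h1)

lemma bell_zero : bell 0 = 1 := by
  have h := (hasSum_pow 0).unique (by simpa using hasSum_inv_factorial)
  have h1 : (bell 0 : ℝ) = 1 := by
    have := Real.exp_pos 1
    exact mul_right_cancel₀ this.ne' (by rw [h, one_mul])
  exact_mod_cast h1

lemma bell_one : bell 1 = 1 := by
  have := bell_succ 0
  simp [bell_zero] at this
  exact_mod_cast this

/-- The ratio of consecutive Bell numbers. -/
noncomputable def bellRatio (n : ℕ) : ℝ := bell (n + 1) / bell n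

lemma bellRatio_pos (n : ℕ) : 0 < bellRatio n := div_pos (cast_bell_pos _) (cast_bell_pos _)

lemma bell_succ_eq (n : ℕ) : (bell (n + 1) : ℝ) = bellRatio n * bell n := by
  rw [bellRatio, div_mul_cancel₀ _ (cast_bell_pos n).ne']

lemma bellRatio_le_succ (n : ℕ) : bellRatio n ≤ bellRatio (n + 1) := by
  have h0 := (((PoissonMean.pow (n + 2)).sub
    ((PoissonMean.pow (n + 1)).const_mul (2 * bellRatio n))).add
    ((PoissonMean.pow n).const_mul (bellRatio n ^ 2))).nonneg fun m => by
      have : 0 ≤ (m : ℝ) ^ n * (m - bellRatio n) ^ 2 := by positivity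
      convert this using 1; ring
  rw [bell_succ_eq (n + 1), bell_succ_eq n] at h0
  have : 0 ≤ (bellRatio (n + 1) - bellRatio n) * (bellRatio n * bell n) := by linarith
  have := nonneg_of_mul_nonneg_left this (mul_pos (bellRatio_pos n) (cast_bell_pos n))
  linarith

lemma bellRatio_mono : Monotone bellRatio := monotone_nat_of_le_succ bellRatio_le_succ

/-- A recursion `k p(k+1) = ∑ p(k-j) / j!` forces log-concavity. -/
lemma logConcave_of_recursion (p : ℕ → ℝ) (hp0 : p 0 = 0) (hpos : ∀ k, 0 < p (k + 1))
    (hrec : ∀ k : ℕ, k * p (k + 1) = ∑ j ∈ range k, p (k - j) / j.factorial)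
    (hanti : ∀ k, p (k + 2) ≤ p (k + 1)) (hgrow : ∀ k : ℕ, p (k + 2) < (k + 2) * p (k + 3))
    (k : ℕ) :
    p (k + 2) * p k ≤ p (k + 1) ^ 2 := by
  induction k using Nat.strong_induction_on with
  | _ k ih =>
  rcases k with _ | _ | k
  · simp only [hp0, mul_zero]
    positivity
  · have h1 := hrec 1
    have h2 := hrec 2
    norm_num [sum_range_succ] at h1 h2
    norm_num
    nlinarith [hpos 0]
  set P := p (k + 3) with hP
  set M := p (k + 2) with hM
  have hPpos : 0 < P := hpos _
  have hMpos : 0 < M := hpos _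
  let u : ℕ → ℝ := fun i => p (k + 2 - i)
  let w : ℕ → ℝ := fun i => p (k + 1 - i)
  let b : ℕ → ℝ := fun i => 1 / i.factorial
  have R1 : (k + 3) * p (k + 4) = P + ∑ i ∈ range (k + 2), b (i + 1) * u i := by
    have := hrec (k + 3)
    rw [sum_range_succ'] at this
    push_cast at this
    rw [this, add_comm]
    congr 1
    · simp [hP]
    · refine sum_congr rfl fun i _ => ?_
      simp only [b, u]
      ring
  have R2 : (k + 2) * P = ∑ i ∈ range (k + 2), b i * u i := by
    have := hrec (k + 2)
    push_cast at this
    rw [this]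
    exact sum_congr rfl fun i _ => by simp only [b, u]; ring
  have R3 : (k + 2) * P = M + ∑ i ∈ range (k + 2), b (i + 1) * w i := by
    have := hrec (k + 2)
    rw [sum_range_succ'] at this
    push_cast at this
    rw [this, sum_range_succ _ (k + 1), add_comm]
    simp only [b, w, Nat.sub_self, hp0, mul_zero, add_zero]
    congr 1
    · simp [hM]
    · refine sum_congr rfl fun i _ => ?_
      ring
  have R4 : (k + 1) * M = ∑ i ∈ range (k + 2), b i * w i := by
    have := hrec (k + 1)
    push_cast at this
    rw [this, sum_range_succ _ (k + 1)]
    simp only [b, w, Nat.sub_self, hp0, mul_zero, add_zero]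
    exact sum_congr rfl fun i _ => by ring
  have hupos : ∀ i ≤ k + 1, 0 < u i := fun i hi => by
    simp only [u]; rw [show k + 2 - i = (k + 1 - i) + 1 by omega]; exact hpos _
  let q : ℕ → ℝ := fun l => p l / p (l + 1)
  have hq : ∀ l ≤ k + 1, q l ≤ q (l + 1) := by
    intro l hl
    simp only [q]
    rw [div_le_div_iff₀ (hpos _) (hpos _)]
    nlinarith [ih l (by omega)]
  have hqm : ∀ d l, l + d ≤ k + 2 → q l ≤ q (l + d) := by
    intro d
    induction d with
    | zero => intro l _; exact le_rfl
    | succ d ihd => intro l h; exact (ihd l (by omega)).trans (hq (l + d) (by omega))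
  let τ : ℕ → ℝ := fun i => M - P * q (k + 1 - i)
  have hτ : ∀ i ≤ k + 1, u i * τ i = u i * M - P * w i := by
    intro i hi
    have := (hupos i hi).ne'
    simp only [τ, q, u, w] at this ⊢
    rw [show k + 1 - i + 1 = k + 2 - i by omega]
    field_simp
  have hτm : ∀ i j, i ≤ j → τ i ≤ τ j := by
    intro i j hij
    have := hqm (k + 1 - i - (k + 1 - j)) (k + 1 - j) (by omega)
    rw [show k + 1 - j + (k + 1 - i - (k + 1 - j)) = k + 1 - i by omega] at this
    simp only [τ]
    nlinarith
  obtain ⟨s, hs, hs1, hs2⟩ : ∃ s ≤ k, (s + 1) * P ≤ M ∧ M < (s + 2) * P := by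
    have h1 : 1 ≤ M / P := (one_le_div hPpos).2 (hanti _)
    have h2 : 1 ≤ ⌊M / P⌋₊ := Nat.le_floor (by simpa using h1)
    have h3 : M / P < k + 2 := (div_lt_iff₀ hPpos).2 (hgrow k)
    have h4 : ⌊M / P⌋₊ < k + 2 := (Nat.floor_lt (by linarith)).2 (by push_cast; exact h3)
    refine ⟨⌊M / P⌋₊ - 1, by omega, ?_, ?_⟩
    · rw [Nat.cast_sub h2, Nat.cast_one, sub_add_cancel, ← le_div_iff₀ hPpos]
      exact Nat.floor_le (by linarith)
    · rw [Nat.cast_sub h2, Nat.cast_one, ← div_lt_iff₀ hPpos]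
      have := Nat.lt_floor_add_one (M / P)
      linarith
  have hkey : ∀ i ∈ range (k + 2), (b (i + 1) * M - b i * P) * u i * τ i ≤
      (b (i + 1) * M - b i * P) * u i * τ s := by
    intro i hi
    have hb : b i = (i + 1) * b (i + 1) := by
      simp only [b, Nat.factorial_succ]; push_cast; field_simp
    have hb0 : 0 < b (i + 1) := by simp only [b]; positivity
    have hu := hupos i (by simpa [Nat.lt_succ_iff] using hi)
    have e : b (i + 1) * M - b i * P = b (i + 1) * (M - (i + 1) * P) := by rw [hb]; ring
    rw [e]
    rcases le_or_gt i s with h | h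
    · have : (i : ℝ) ≤ s := by exact_mod_cast h
      exact mul_le_mul_of_nonneg_left (hτm i s h) (mul_nonneg (mul_nonneg hb0.le
        (by nlinarith)) hu.le)
    · have : (s : ℝ) + 1 ≤ i := by exact_mod_cast h
      exact mul_le_mul_of_nonpos_left (hτm s i h.le) (mul_nonpos_of_nonpos_of_nonneg
        (mul_nonpos_of_nonneg_of_nonpos hb0.le (by nlinarith)) hu.le)
  have hsum := sum_le_sum hkey
  rw [← sum_mul] at hsum
  have e1 : ∑ i ∈ range (k + 2), (b (i + 1) * M - b i * P) * u i =
      M * ((k + 3) * p (k + 4) - P) - P * ((k + 2) * P) := by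
    rw [R1, R2, add_sub_cancel_left, mul_sum, mul_sum, ← sum_sub_distrib]
    exact sum_congr rfl fun i _ => by ring
  have e2 : ∑ i ∈ range (k + 2), (b (i + 1) * M - b i * P) * u i * τ i =
      M * (M * ((k + 3) * p (k + 4) - P) - P * ((k + 2) * P - M)) -
        P * (M * ((k + 2) * P) - P * ((k + 1) * M)) := by
    have h1 : (k + 3) * p (k + 4) - P = ∑ i ∈ range (k + 2), b (i + 1) * u i := by rw [R1]; ring
    have h2 : (k + 2) * P - M = ∑ i ∈ range (k + 2), b (i + 1) * w i := by rw [R3]; ring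
    rw [h1, h2, R2, R4]
    simp only [mul_sum, ← sum_sub_distrib]
    refine sum_congr rfl fun i hi => ?_
    rw [mul_assoc, hτ i (by simpa [Nat.lt_succ_iff] using hi)]
    ring
  rw [e1, e2] at hsum
  have hs3 : 0 ≤ τ s := by
    have h1 := hqm (s + 1) (k + 1 - s) (by omega)
    rw [show k + 1 - s + (s + 1) = k + 2 by omega] at h1
    have h2 : P * q (k + 2) = M := by
      simp only [q]; rw [← hM, ← hP]; field_simp
    simp only [τ]
    nlinarith
  have hs4 : 0 < M - τ s := by
    have : 0 < q (k + 1 - s) := by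
      simp only [q]; rw [show k + 1 - s = (k - s) + 1 by omega]; exact div_pos (hpos _) (hpos _)
    simp only [τ]
    nlinarith [mul_pos hPpos this]
  have hPM : P ≤ M := hanti _
  have hfin : 0 ≤ (M - τ s) * ((k + 3) * (P ^ 2 - p (k + 4) * M)) := by
    have : 0 ≤ τ s * (P * (M - P)) := mul_nonneg hs3 (mul_nonneg hPpos.le (by linarith))
    nlinarith
  have h5 := nonneg_of_mul_nonneg_right hfin hs4
  have h6 := nonneg_of_mul_nonneg_right h5 (by positivity)
  change p (k + 4) * M ≤ P ^ 2
  linarith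

lemma bell_le_succ (n : ℕ) : (bell n : ℝ) ≤ bell (n + 1) := by
  rw [bell_succ]
  have := single_le_sum (s := range (n + 1)) (f := fun k => (n.choose k : ℝ) * bell k)
    (fun k _ => by positivity) (self_mem_range_succ n)
  simpa using this

lemma bell_lt_succ_succ (n : ℕ) : (bell (n + 1) : ℝ) < bell (n + 2) := by
  rw [bell_succ (n + 1), sum_range_succ, Nat.choose_self, Nat.cast_one, one_mul]
  have := single_le_sum (s := range (n + 1)) (f := fun k => ((n + 1).choose k : ℝ) * bell k)
    (fun k _ => by positivity) (mem_range.2 n.succ_pos)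
  simp only [Nat.choose_zero_right, bell_zero, Nat.cast_one, one_mul] at this
  linarith

lemma bell_le_mul (n : ℕ) : (bell (n + 1) : ℝ) ≤ (n + 1) * bell n := by
  induction n using Nat.strong_induction_on with
  | _ n ih =>
  rcases n with _ | n
  · simp [bell_zero, bell_one]
  have h1 : (1 : ℝ) ≤ bell (n + 1) := by exact_mod_cast bell_pos (n + 1)
  have h2 : ∀ j ∈ range (n + 1), ((n + 1).choose (j + 1) : ℝ) * bell (j + 1) ≤
      (n + 1) * (n.choose j * bell j) := by
    intro j hj
    have h3 : ((n : ℝ) + 1) * n.choose j = (n + 1).choose (j + 1) * (j + 1) := by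
      exact_mod_cast Nat.add_one_mul_choose_eq n j
    calc ((n + 1).choose (j + 1) : ℝ) * bell (j + 1)
        ≤ (n + 1).choose (j + 1) * ((j + 1) * bell j) :=
          mul_le_mul_of_nonneg_left (ih j (mem_range.1 hj)) (Nat.cast_nonneg _)
      _ = _ := by rw [← mul_assoc, ← h3, mul_assoc]
  have h4 := sum_le_sum h2
  rw [← mul_sum, ← bell_succ] at h4
  rw [bell_succ (n + 1), sum_range_succ']
  simp only [Nat.choose_zero_right, bell_zero, Nat.cast_one, mul_one]
  push_cast
  linarith

lemma bellRatio_div_antitone (n : ℕ) : bellRatio (n + 1) / (n + 2) ≤ bellRatio n / (n + 1) := by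
  let p : ℕ → ℝ := fun k => k * bell (k - 1) / k.factorial
  have hp : ∀ k, p (k + 1) = bell k / k.factorial := by
    intro k
    simp only [p, Nat.add_sub_cancel, Nat.factorial_succ]
    push_cast
    field_simp
  have hrec : ∀ k : ℕ, k * p (k + 1) = ∑ j ∈ range k, p (k - j) / j.factorial := by
    intro k
    rcases k with _ | k
    · simp
    rw [hp, bell_succ, ← sum_range_reflect, sum_div, mul_sum]
    refine sum_congr rfl fun j hj => ?_
    have hj' : j ≤ k := Nat.lt_succ_iff.1 (mem_range.1 hj)
    rw [show k + 1 - j = (k - j) + 1 by omega, hp, show k + 1 - 1 - j = k - j by omega,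
      Nat.choose_symm hj', Nat.cast_choose ℝ hj', Nat.factorial_succ]
    push_cast
    field_simp
  have hpos : ∀ k, 0 < p (k + 1) := fun k => by
    rw [hp]; exact div_pos (cast_bell_pos k) (by positivity)
  have := logConcave_of_recursion p (by simp [p]) hpos hrec ?_ ?_ (n + 1)
  · rw [hp, hp, hp] at this
    rw [bellRatio, bellRatio, div_div, div_div,
      div_le_div_iff₀ (by have := cast_bell_pos (n + 1); positivity)
      (by have := cast_bell_pos n; positivity)]
    rw [div_mul_div_comm, div_pow, div_le_div_iff₀ (by positivity) (by positivity)] at this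
    rw [Nat.factorial_succ (n + 1), Nat.factorial_succ n] at this
    push_cast at this
    have h0 : (0 : ℝ) < n.factorial ^ 2 * (n + 1) := by positivity
    refine le_of_mul_le_mul_right ?_ h0
    nlinarith
  · intro k
    rw [hp, hp, Nat.factorial_succ, div_le_div_iff₀ (by positivity) (by positivity)]
    push_cast
    have := bell_le_mul k
    have h0 : (0 : ℝ) < k.factorial := by positivity
    nlinarith
  · intro k
    rw [hp, hp, Nat.factorial_succ (k + 1)]
    push_cast
    have h0 : (0 : ℝ) < (k + 1).factorial := by positivity
    have := bell_lt_succ_succ k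
    rw [mul_div_assoc', div_lt_div_iff₀ h0 (by positivity)]
    nlinarith [mul_pos h0 (show (0:ℝ) < k + 2 by positivity)]

lemma one_le_bellRatio (n : ℕ) : 1 ≤ bellRatio n :=
  (one_le_div (cast_bell_pos n)).2 (bell_le_succ n)

lemma two_le_bellRatio (n : ℕ) : 2 ≤ bellRatio (n + 1) := by
  refine le_trans ?_ (bellRatio_mono (Nat.le_add_left 1 n))
  rw [bellRatio, bell_succ 1]
  norm_num [sum_range_succ, bell_zero, bell_one]

lemma bell_le_pow_mul (n k : ℕ) : (bell (n + k) : ℝ) ≤ bellRatio (n + k) ^ k * bell n := by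
  induction k with
  | zero => simp
  | succ k ih =>
    have h1 := bellRatio_le_succ (n + k)
    have h0 := bellRatio_pos (n + k)
    rw [← add_assoc, bell_succ_eq, pow_succ']
    calc _ ≤ bellRatio (n + k) * (bellRatio (n + k) ^ k * bell n) :=
          mul_le_mul_of_nonneg_left ih h0.le
      _ = bellRatio (n + k) * bellRatio (n + k) ^ k * bell n := by ring
      _ ≤ _ := by
        have := cast_bell_pos n
        have := (bellRatio_pos (n + k + 1)).le
        gcongr

lemma one_add_inv_pow_le_bellRatio (n : ℕ) : (1 + 1 / bellRatio n) ^ n ≤ bellRatio n := by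
  have h0 := bellRatio_pos n
  have hb := cast_bell_pos n
  rw [bellRatio, le_div_iff₀ hb, ← bellRatio, bell_succ, add_pow, sum_mul]
  refine sum_le_sum fun k hk => ?_
  have hk' : k ≤ n := Nat.lt_succ_iff.1 (mem_range.1 hk)
  have := bell_le_pow_mul k (n - k)
  rw [Nat.add_sub_cancel' hk'] at this
  rw [one_pow, one_mul, div_pow, one_pow, mul_right_comm, mul_comm, div_mul_eq_mul_div, one_mul]
  exact mul_le_mul_of_nonneg_left ((div_le_iff₀' (by positivity)).2 this) (Nat.cast_nonneg _)

lemma le_bellRatio_log (n : ℕ) : n ≤ (bellRatio n + 1) * Real.log (bellRatio n) := by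
  have h0 := bellRatio_pos n
  have h1 := Real.log_le_log (by positivity) (one_add_inv_pow_le_bellRatio n)
  rw [Real.log_pow] at h1
  have h2 := Real.one_sub_inv_le_log_of_pos (show 0 < 1 + 1 / bellRatio n by positivity)
  have h3 : 1 - (1 + 1 / bellRatio n)⁻¹ = 1 / (bellRatio n + 1) := by field_simp; ring
  rw [h3] at h2
  have h4 : (n : ℝ) * (1 / (bellRatio n + 1)) ≤ Real.log (bellRatio n) :=
    (mul_le_mul_of_nonneg_left h2 (Nat.cast_nonneg n)).trans h1
  rw [mul_one_div, div_le_iff₀ (by positivity)] at h4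
  linarith

lemma bellRatio_mul_pow_le_one (n : ℕ) (hn : 1 ≤ n) :
    bellRatio n * (1 - 1 / bellRatio n) ^ n ≤ 1 := by
  set r := bellRatio n with hr
  have h2 : 2 ≤ r := by
    obtain ⟨k, rfl⟩ := Nat.exists_eq_add_of_le' hn
    exact two_le_bellRatio k
  set q := 1 - 1 / r with hq
  have hq0 : 0 < q := by
    rw [hq, sub_pos, div_lt_one (by linarith)]; linarith
  have hb := cast_bell_pos n
  have hM := ((PoissonMean.pow (n + 1)).add (((PoissonMean.pow (n + 1)).const_mul (1 / r)).sub
    (PoissonMean.pow n) |>.const_mul (n / q))).const_mul (q ^ n)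
  have h := hM.mono (PoissonMean.pow n).shift ?_
  · rw [bell_succ_eq, ← hr] at h
    have e : q ^ n * (r * bell n + n / q * (1 / r * (r * bell n) - bell n)) =
        (r * q ^ n) * bell n := by field_simp; ring
    rw [e] at h
    exact le_of_mul_le_mul_right (by linarith) hb
  · intro m
    rcases m with _ | m
    · simp [show n ≠ 0 by omega]
    set x : ℝ := m + 1 with hx
    have hx0 : 0 < x := by positivity
    have e1 : ((m + 1 : ℕ) : ℝ) = x := by push_cast; rfl
    have e2 : ((m + 1 - 1 : ℕ) : ℝ) = x - 1 := by rw [Nat.add_sub_cancel]; simp [hx]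
    rw [e1, e2]
    have hB := one_add_mul_le_pow (a := (x - 1) / (x * q) - 1) (by
      have : 0 ≤ (x - 1) / (x * q) := div_nonneg (by simp [hx]) (by positivity)
      linarith) n
    rw [add_sub_cancel, div_pow, mul_pow, le_div_iff₀ (by positivity)] at hB
    calc _ = x * ((1 + n * ((x - 1) / (x * q) - 1)) * (x ^ n * q ^ n)) := by
          have hr0 : r ≠ 0 := by linarith
          have hq1 : q ≠ 0 := hq0.ne'
          have hqr : q * r = r - 1 := by rw [hq]; field_simp
          have : (x - 1) / (x * q) - 1 = (x / r - 1) / (q * x) := by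
            rw [div_sub_one (by positivity), mul_comm x q]
            congr 1
            rw [hq]; field_simp; ring
          rw [this]
          field_simp
          ring
      _ ≤ _ := mul_le_mul_of_nonneg_left hB hx0.le

lemma bellRatio_log_le (n : ℕ) : (bellRatio n - 1) * Real.log (bellRatio n) ≤ n := by
  rcases n with _ | k
  · simp [bellRatio, bell_zero, bell_one]
  set n := k + 1
  have h2 := two_le_bellRatio k
  have h := bellRatio_mul_pow_le_one n (by omega)
  set r := bellRatio n
  have hq0 : 0 < 1 - 1 / r := by
    rw [sub_pos, div_lt_one (by linarith)]; linarith
  have h1 := Real.log_le_log (by positivity) h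
  rw [Real.log_one, Real.log_mul (by linarith) (by positivity), Real.log_pow] at h1
  have h3 := Real.one_sub_inv_le_log_of_pos hq0
  have h4 : 1 - (1 - 1 / r)⁻¹ = - (1 / (r - 1)) := by
    have : r - 1 ≠ 0 := by linarith
    have : r ≠ 0 := by linarith
    have : 1 - 1 / r = (r - 1) / r := by field_simp
    rw [this, inv_div]
    field_simp
    ring
  rw [h4] at h3
  have h5 : Real.log r ≤ n * (1 / (r - 1)) := by
    nlinarith [mul_le_mul_of_nonneg_left h3 (Nat.cast_nonneg (α := ℝ) n)]
  rw [mul_one_div, le_div_iff₀ (by linarith)] at h5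
  linarith

lemma bellRatio_div_le (k j : ℕ) :
    bellRatio (k + j) / (k + j + 1) ≤ bellRatio k / (k + 1) := by
  induction j with
  | zero => simp
  | succ j ih =>
    have := bellRatio_div_antitone (k + j)
    push_cast at this ⊢
    refine le_trans (le_of_eq ?_) (this.trans ih)
    rw [← add_assoc, ← add_assoc]
    congr 1
    ring

lemma bell_mul_pow_le (k j : ℕ) (h : j ≤ k + 1) :
    bell k * (bellRatio (k + j) / 2) ^ j ≤ bell (k + j) := by
  have hr := bellRatio_pos (k + j)
  have key : ∀ i ≤ j, bell k * (bellRatio (k + j) / 2) ^ i ≤ bell (k + i) := by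
    intro i
    induction i with
    | zero => simp
    | succ i ih =>
      intro hi
      have h1 := bellRatio_div_le (k + i) (j - i)
      rw [add_assoc, Nat.add_sub_cancel' (by omega : i ≤ j)] at h1
      push_cast [Nat.cast_sub (by omega : i ≤ j)] at h1
      rw [div_le_div_iff₀ (by
        have : (i : ℝ) ≤ j := by exact_mod_cast (by omega : i ≤ j)
        have : (0 : ℝ) ≤ k := by positivity
        have : (0 : ℝ) ≤ i := by positivity
        linarith) (by positivity)] at h1
      have h2 : bellRatio (k + j) / 2 ≤ bellRatio (k + i) := by
        have hj : (j : ℝ) ≤ k + 1 := by exact_mod_cast h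
        have hi0 : (0 : ℝ) ≤ i := by positivity
        have hk0 : (0 : ℝ) ≤ k := by positivity
        have h0 := bellRatio_pos (k + i)
        have e : (k : ℝ) + i + (j - i) + 1 = k + j + 1 := by ring
        rw [e] at h1
        by_contra! hc
        nlinarith
      rw [pow_succ, ← mul_assoc, ← add_assoc, bell_succ_eq, mul_comm (bellRatio _)]
      exact mul_le_mul (ih (by omega)) h2 (by positivity) (by positivity)
  exact key j le_rfl

lemma bell_sub_le (n j : ℕ) (h : 2 * j ≤ n + 1) :
    (bell (n - j) : ℝ) ≤ 2 ^ j / bellRatio n ^ j * bell n := by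
  have h1 := bell_mul_pow_le (n - j) j (by omega)
  have hr := bellRatio_pos n
  rw [Nat.sub_add_cancel (by omega), div_pow] at h1
  rw [div_mul_eq_mul_div, le_div_iff₀ (by positivity)]
  rw [mul_div_assoc', div_le_iff₀ (by positivity)] at h1
  linarith

lemma mul_bell_sub_two_le (n : ℕ) (h : 5 ≤ n) :
    n * (bell (n - 2) : ℝ) ≤ (n + 4) / bellRatio n ^ 2 * bell n := by
  obtain ⟨k, rfl⟩ := Nat.exists_eq_add_of_le' (by omega : 2 ≤ n)
  have hk : (3 : ℝ) ≤ k := by exact_mod_cast (by omega : 3 ≤ k)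
  have h1 := bellRatio_div_le k 2
  have h2 := bellRatio_div_le (k + 1) 1
  push_cast at h1 h2
  rw [div_le_div_iff₀ (by positivity) (by positivity)] at h1 h2
  have hb := bell_succ_eq (k + 1)
  have hb' := bell_succ_eq k
  rw [show k + 1 + 1 = k + 2 by ring] at hb h2
  set r := bellRatio (k + 2)
  have hr : 0 < r := bellRatio_pos _
  have hb0 := cast_bell_pos k
  rw [hb, hb', Nat.add_sub_cancel, div_mul_eq_mul_div, le_div_iff₀ (by positivity)]
  push_cast
  set s := bellRatio (k + 1)
  set t := bellRatio k
  have hs : r * (k + 2) ≤ s * (k + 3) := by linarith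
  have ht : r * (k + 1) ≤ t * (k + 3) := by linarith
  have h3 : r * (k + 2) * (r * (k + 1)) ≤ s * (k + 3) * (t * (k + 3)) :=
    mul_le_mul hs ht (by positivity) (by have : 0 < s := bellRatio_pos _; positivity)
  have h4 : 0 < s * t := mul_pos (bellRatio_pos _) (bellRatio_pos _)
  have h5 : (k + 2) * r ^ 2 ≤ (k + 6) * (s * t) := by
    have h6 : (k + 2) * r ^ 2 * (k + 1) ≤ (k + 6) * (s * t) * (k + 1) := by
      nlinarith
    exact le_of_mul_le_mul_right h6 (by positivity)
  nlinarith

/-- Comparison of consecutive values of `x (1 - 1/x) ^ n`. -/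
lemma weight_succ_le (n : ℕ) {x : ℝ} (hx : 1 ≤ x) :
    (x + 1) * (x / (x + 1)) ^ n ≤
      x * ((x - 1) / x) ^ n * (1 + (1 / x + n / x ^ 2) + (2 / x ^ 2 + 2 * n ^ 2 / x ^ 4)) +
        8 * (1 / x ^ 2 + n ^ 3 / x ^ 5) := by
  set V' := (x + 1) * (x / (x + 1)) ^ n with hV'
  set V := x * ((x - 1) / x) ^ n with hV
  set γ := 1 / x + n / x ^ 2 with hγ
  have hx0 : 0 < x := by linarith
  have hγ0 : 0 ≤ γ := by positivity
  have hV0 : 0 ≤ V := mul_nonneg hx0.le (pow_nonneg (div_nonneg (by linarith) hx0.le) n)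
  have hV'0 : 0 ≤ V' := by positivity
  have hV'1 : V' ≤ 2 * x := by
    have : (x / (x + 1)) ^ n ≤ 1 :=
      pow_le_one₀ (by positivity) ((div_le_one (by positivity)).2 (by linarith))
    nlinarith
  have h1 : V' * (1 - γ) ≤ V := by
    have hB := one_add_mul_le_pow (a := -(1 / x ^ 2)) (by
      have : 1 / x ^ 2 ≤ 1 := (div_le_one (by positivity)).2 (one_le_pow₀ hx)
      linarith) n
    have e1 : (x - 1) / x = x / (x + 1) * (1 + -(1 / x ^ 2)) := by field_simp; ring
    rw [hV, e1, mul_pow]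
    have hP : 0 ≤ (x / (x + 1)) ^ n := by positivity
    calc V' * (1 - γ) = (x / (x + 1)) ^ n * ((x + 1) * (1 - γ)) := by rw [hV']; ring
      _ ≤ (x / (x + 1)) ^ n * (x * (1 + n * -(1 / x ^ 2))) := by
        refine mul_le_mul_of_nonneg_left ?_ hP
        have e2 : x * (1 + n * -(1 / x ^ 2)) - (x + 1) * (1 - γ) = 1 / x + n / x ^ 2 := by
          rw [hγ]; field_simp; ring
        linarith [hγ0]
      _ ≤ (x / (x + 1)) ^ n * (x * (1 + -(1 / x ^ 2)) ^ n) := by gcongr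
      _ = _ := by ring
  have h2 : γ ^ 2 ≤ 2 / x ^ 2 + 2 * n ^ 2 / x ^ 4 := by
    have : 2 / x ^ 2 + 2 * n ^ 2 / x ^ 4 - γ ^ 2 = (1 / x - n / x ^ 2) ^ 2 := by
      rw [hγ]; field_simp; ring
    nlinarith [sq_nonneg (1 / x - n / x ^ 2)]
  have h3 : γ ^ 3 ≤ 4 * (1 / x ^ 3 + n ^ 3 / x ^ 6) := by
    have e : 4 * (1 / x ^ 3 + n ^ 3 / x ^ 6) - γ ^ 3 =
        3 * γ * (1 / x - n / x ^ 2) ^ 2 := by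
      rw [hγ]; field_simp; ring
    have : 0 ≤ 3 * γ * (1 / x - n / x ^ 2) ^ 2 := by positivity
    linarith
  calc V' = V' * (1 - γ) * (1 + γ + γ ^ 2) + V' * γ ^ 3 := by ring
    _ ≤ V * (1 + γ + (2 / x ^ 2 + 2 * n ^ 2 / x ^ 4)) +
        2 * x * (4 * (1 / x ^ 3 + n ^ 3 / x ^ 6)) := by
      gcongr
    _ = _ := by field_simp; ring

lemma exists_weight_sq_mean (n : ℕ) (hn : 9 ≤ n) (h2 : (n : ℝ) ^ 2 ≤ bellRatio n ^ 3)
    (h3 : (n : ℝ) ^ 3 ≤ bellRatio n ^ 4) :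
    ∃ s ≤ (1 + (n / bellRatio n ^ 2 + 334 / bellRatio n)) * bell n,
      PoissonMean (fun m => (m : ℝ) ^ n * ((m + 1) * (m / (m + 1)) ^ n)) s := by
  set r := bellRatio n with hr
  have hr1 : 1 ≤ r := one_le_bellRatio n
  have hr0 : 0 < r := by linarith
  let h : ℝ → ℝ := fun x => 1 + (1 / x + n / x ^ 2) + (2 / x ^ 2 + 2 * n ^ 2 / x ^ 4)
  have hH := ((((PoissonMean.pow n).add (PoissonMean.pow (n - 1))).add
    ((PoissonMean.pow (n - 2)).const_mul (n + 2))).add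
    ((PoissonMean.pow (n - 4)).const_mul (2 * n ^ 2)))
  obtain ⟨t, ht, hT⟩ := hH.exists_of_le (g := fun m => (m : ℝ) ^ n * h (m + 1))
    (fun m => by positivity) (fun m => by
      rcases m with _ | m
      · simp [show n ≠ 0 by omega, show n - 1 ≠ 0 by omega, show n - 2 ≠ 0 by omega,
          show n - 4 ≠ 0 by omega]
      set x : ℝ := ((m + 1 : ℕ) : ℝ) with hx
      have hx0 : 0 < x := by positivity
      obtain ⟨k, hk⟩ := Nat.exists_eq_add_of_le' (by omega : 4 ≤ n)
      have e : x ^ n + x ^ (n - 1) + (n + 2) * x ^ (n - 2) + 2 * n ^ 2 * x ^ (n - 4) =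
          x ^ n * h x := by
        simp only [h]
        rw [show n - 1 = k + 3 by omega, show n - 2 = k + 2 by omega, show n - 4 = k by omega]
        generalize hc : (n : ℝ) = c
        rw [hk]
        field_simp
        ring
      rw [e]
      simp only [h]
      gcongr <;> linarith)
  have hF := hT.shift.add (((PoissonMean.pow (n - 2)).add
    ((PoissonMean.pow (n - 5)).const_mul ((n : ℝ) ^ 3))).const_mul 8)
  obtain ⟨s, hs, hS⟩ := hF.exists_of_le
    (g := fun m => (m : ℝ) ^ n * ((m + 1) * (m / (m + 1)) ^ n))
    (fun m => by positivity) (fun m => by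
      rcases m with _ | m
      · simp [show n ≠ 0 by omega, show n - 2 ≠ 0 by omega, show n - 5 ≠ 0 by omega]
      have e1 : ((m + 1 - 1 : ℕ) : ℝ) = ((m + 1 : ℕ) : ℝ) - 1 := by push_cast; simp
      rw [e1]
      set x : ℝ := ((m + 1 : ℕ) : ℝ) with hx
      have hx1 : 1 ≤ x := by simp [hx]
      have hx0 : 0 < x := by linarith
      obtain ⟨k, hk⟩ := Nat.exists_eq_add_of_le' (by omega : 5 ≤ n)
      have := mul_le_mul_of_nonneg_left (weight_succ_le n hx1) (by positivity : 0 ≤ x ^ n)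
      refine this.trans (le_of_eq ?_)
      simp only [h, sub_add_cancel]
      rw [div_pow, mul_add]
      congr 1
      · field_simp
      · rw [show n - 2 = k + 3 by omega, show n - 5 = k by omega]
        generalize hc : (n : ℝ) = c
        rw [hk]
        field_simp
        ring)
  refine ⟨s, hs.trans ?_, hS⟩
  have b1 := bell_sub_le n 1 (by omega)
  have b2 := bell_sub_le n 2 (by omega)
  have b2' := mul_bell_sub_two_le n (by omega)
  have b4 := bell_sub_le n 4 (by omega)
  have b5 := bell_sub_le n 5 (by omega)
  rw [← hr] at b1 b2 b2' b4 b5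
  have hb := cast_bell_pos n
  set B : ℝ := (bell n : ℝ)
  have c4 : 2 * (n : ℝ) ^ 2 * bell (n - 4) ≤ 32 / r * B := by
    calc _ ≤ 2 * r ^ 3 * (2 ^ 4 / r ^ 4 * B) := by gcongr
      _ = _ := by field_simp; ring
  have c5 : (n : ℝ) ^ 3 * bell (n - 5) ≤ 32 / r * B := by
    calc _ ≤ r ^ 4 * (2 ^ 5 / r ^ 5 * B) := by gcongr
      _ = _ := by field_simp; ring
  have d : 1 / r ^ 2 ≤ 1 / r := by
    gcongr
    nlinarith
  have d' : 1 / r ^ 2 * B ≤ 1 / r * B := by gcongr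
  have b1' : (bell (n - 1) : ℝ) ≤ 2 * (1 / r * B) := by
    refine b1.trans (le_of_eq ?_); ring
  have b2'' : (bell (n - 2) : ℝ) ≤ 4 * (1 / r ^ 2 * B) := by
    refine b2.trans (le_of_eq ?_); ring
  have e2 : (n + 4) / r ^ 2 * B = n / r ^ 2 * B + 4 * (1 / r ^ 2 * B) := by ring
  have e3 : 32 / r * B = 32 * (1 / r * B) := by ring
  have e4 : (1 + (n / r ^ 2 + 334 / r)) * B = B + n / r ^ 2 * B + 334 * (1 / r * B) := by ring
  have : 0 ≤ 1 / r * B := by positivity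
  rw [e4]
  linarith

/-- The lower bound for the variance of the tilted Poisson law, by Cauchy-Schwarz. -/
lemma bell_variance_lower (n : ℕ) (hn : 9 ≤ n) (h2 : (n : ℝ) ^ 2 ≤ bellRatio n ^ 3)
    (h3 : (n : ℝ) ^ 3 ≤ bellRatio n ^ 4) :
    bellRatio n ^ 2 / n * (1 - 334 * bellRatio n / n) ≤
      bellRatio n * (bellRatio (n + 1) - bellRatio n) := by
  obtain ⟨s, hs, hS⟩ := exists_weight_sq_mean n hn h2 h3
  set r := bellRatio n with hr
  set r1 := bellRatio (n + 1) with hr1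
  have hr0 : 0 < r := bellRatio_pos n
  have hn0 : (0 : ℝ) < n := by exact_mod_cast (by omega : 0 < n)
  set Q := n / r ^ 2 + 334 / r with hQ
  have hQ0 : 0 < Q := by positivity
  set t := 1 / Q with ht
  have hb := cast_bell_pos n
  have hW := (PoissonMean.pow n).shift
  have hMW := ((PoissonMean.pow (n + 1)).add (PoissonMean.pow n)).shift
  have hV := hS.shift
  have key := ((((PoissonMean.pow (n + 2)).sub ((PoissonMean.pow (n + 1)).const_mul (2 * r))).add
    ((PoissonMean.pow n).const_mul (r ^ 2))).sub
    ((((hMW.sub (PoissonMean.pow (n + 1))).sub (hW.const_mul r)).add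
      ((PoissonMean.pow n).const_mul r)).const_mul (2 * t))).add
    (((hV.sub (hW.const_mul 2)).add (PoissonMean.pow n)).const_mul (t ^ 2))
  have h := key.nonneg ?_
  · rw [bell_succ_eq (n + 1), bell_succ_eq n, ← hr, ← hr1] at h
    have hs' : t ^ 2 * (s - bell n) ≤ t ^ 2 * (Q * bell n) :=
      mul_le_mul_of_nonneg_left (by linarith) (by positivity)
    have e : t ^ 2 * (Q * bell n) = t * bell n := by rw [ht]; field_simp
    have h4 : 0 ≤ (r * (r1 - r) - t) * bell n := by nlinarith
    have h5 := nonneg_of_mul_nonneg_left h4 hb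
    have h6 : r ^ 2 / n * (1 - 334 * r / n) ≤ t := by
      rw [ht, hQ, le_div_iff₀ hQ0]
      have : r ^ 2 / n * (1 - 334 * r / n) * (n / r ^ 2 + 334 / r) = 1 - (334 * r / n) ^ 2 := by
        field_simp; ring
      rw [this]
      nlinarith [sq_nonneg (334 * r / n)]
    linarith
  · intro m
    rcases m with _ | m
    · simp [show n ≠ 0 by omega]
    set x : ℝ := ((m + 1 : ℕ) : ℝ) with hx
    have hx0 : 0 < x := by positivity
    have e1 : ((m + 1 - 1 : ℕ) : ℝ) = x - 1 := by rw [hx]; push_cast; simp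
    rw [e1]
    have : 0 ≤ x ^ n * (x - r - t * (x * ((x - 1) / x) ^ n - 1)) ^ 2 := by positivity
    refine this.trans_eq ?_
    rw [sub_add_cancel, div_pow]
    field_simp
    ring

lemma bellRatio_add_le (n j : ℕ) :
    bellRatio (n + j) * (n + 1) ≤ bellRatio n * (n + j + 1) := by
  have := bellRatio_div_le n j
  rwa [div_le_div_iff₀ (by positivity) (by positivity)] at this

/-- The conditional mean of the compensated statistic for words on `m` letters. -/
noncomputable def condMean (n m : ℕ) : ℝ := n * ((m - 1) / 2) - 5 / 4 * (m * (m - 1))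

lemma condMean_variance (n : ℕ) :
    ∃ d : ℝ, ∃ W ≥ 0, W ≤ bellRatio n * bellRatio (n + 1) *
        (bellRatio (n + 2) * bellRatio (n + 3) - bellRatio n * bellRatio (n + 1)) ∧
      ∀ c : ℝ, PoissonMean (fun m => (m : ℝ) ^ n * (condMean n m - c) ^ 2)
      (bell n * (n ^ 2 / 4 * (bellRatio n * (bellRatio (n + 1) - bellRatio n)) -
        5 * n / 4 * (bellRatio n * (bellRatio (n + 1) * (bellRatio (n + 2) - bellRatio n) -
          (bellRatio (n + 1) - bellRatio n))) + 25 / 16 * W + (d - c) ^ 2)) := by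
  have hb := cast_bell_pos n
  have h1 := bell_succ_eq n
  have h2 := bell_succ_eq (n + 1)
  have h3 := bell_succ_eq (n + 2)
  have h4 := bell_succ_eq (n + 3)
  have hr1 := one_le_bellRatio (n + 1)
  have hm0 := bellRatio_le_succ n
  have hm1 := bellRatio_le_succ (n + 1)
  have hr0 := bellRatio_pos n
  rw [h1] at h2
  rw [h2] at h3
  rw [h3] at h4
  set r := bellRatio n
  set r1 := bellRatio (n + 1)
  set r2 := bellRatio (n + 2)
  set r3 := bellRatio (n + 3)
  set B := (bell n : ℝ)
  set W := r * r1 * (r2 * r3 - r * r1) - 2 * r * r1 * (r2 - r) + r * (r1 - r) with hW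
  have M0 := PoissonMean.pow n
  have M1 := PoissonMean.pow (n + 1)
  have M2 := PoissonMean.pow (n + 2)
  have M3 := PoissonMean.pow (n + 3)
  have M4 := PoissonMean.pow (n + 4)
  rw [h1] at M1
  rw [h2] at M2
  rw [h3] at M3
  rw [h4] at M4
  refine ⟨n * (r - 1) / 2 - 5 / 4 * (r * r1 - r), W, ?_, ?_, fun c => ?_⟩
  · set a := r * r1 - r with ha
    have hp := ((((M4.sub (M3.const_mul 2)).add M2).sub ((M2.sub M1).const_mul (2 * a))).add
      (M0.const_mul (a ^ 2))).nonneg (fun m => by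
        have : 0 ≤ (m : ℝ) ^ n * ((m : ℝ) ^ 2 - m - a) ^ 2 := by positivity
        refine this.trans_eq ?_
        ring)
    have : 0 ≤ W * B := by
      refine hp.trans_eq ?_
      rw [hW, ha]; ring
    exact nonneg_of_mul_nonneg_left this hb
  · rw [hW]
    have : r * (r1 - r) ≤ 2 * r * r1 * (r2 - r) := by
      have : r1 - r ≤ 2 * r1 * (r2 - r) := by nlinarith
      nlinarith
    linarith
  · set a := (n : ℝ) / 2 + 5 / 4 with ha
    set b := -(n : ℝ) / 2 - c with hb'
    have hp := ((((M4.const_mul (25 / 16)).add (M3.const_mul (-(5 / 2) * a))).add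
      (M2.const_mul (a ^ 2 - 5 / 2 * b))).add (M1.const_mul (2 * a * b))).add
      (M0.const_mul (b ^ 2))
    have hp' := hp.congr (h := fun m => (m : ℝ) ^ n * (condMean n m - c) ^ 2) (fun m => by
      rw [condMean, ha, hb']; ring)
    convert hp' using 1
    rw [hW, ha, hb']
    ring

lemma sum_sq_decomp (n m : ℕ) (c : ℝ) :
    ∑ f : Fin n → Fin m, (compGap f - 5 / 4 * (m * (m - 1)) - c) ^ 2 =
      ∑ f : Fin n → Fin m, (compGap f - n * ((m - 1) / 2)) ^ 2 +
        (m : ℝ) ^ n * (condMean n m - c) ^ 2 := by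
  have h := sum_compGap n m
  have e : ∀ f : Fin n → Fin m, (compGap f - 5 / 4 * (m * (m - 1)) - c) ^ 2 =
      (compGap f - n * ((m - 1) / 2)) ^ 2 +
      2 * (condMean n m - c) * (compGap f - n * ((m - 1) / 2)) + (condMean n m - c) ^ 2 := by
    intro f; rw [condMean]; ring
  simp_rw [e]
  rw [sum_add_distrib, sum_add_distrib, ← mul_sum, h, mul_zero, add_zero, sum_const, card_univ]
  simp

/-- The correction of the crossing number by unused letters and separated pairs. -/
noncomputable def correction {n m : ℕ} (f : Fin n → Fin m) : ℝ :=
  wordCr f - (compGap f - 5 / 4 * (m * (m - 1)))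

lemma correction_sq_le {n m : ℕ} (f : Fin n → Fin m) :
    correction f ^ 2 ≤ 8 * m ^ 2 * (unused f : ℝ) ^ 2 + 2 * (#(sepSet f) : ℝ) ^ 2 := by
  have h := wordCr_eq_compGap f
  have hl := letters_add_unused f
  set u := (unused f : ℝ)
  set l := (letters f : ℝ)
  set N := (#(sepSet f) : ℝ)
  have hu : 0 ≤ u := Nat.cast_nonneg _
  have hl0 : 0 ≤ l := Nat.cast_nonneg _
  have hN : 0 ≤ N := Nat.cast_nonneg _
  have e : correction f = u * (m - 1) / 2 + 3 / 4 * (u * (m + l - 1)) + N := by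
    rw [correction, h]; ring
  have h0 : 0 ≤ u * (m - 1) := by
    rcases Nat.eq_zero_or_pos m with rfl | hm
    · have : u = 0 := by simp at hl; linarith
      simp [this]
    · have : (1 : ℝ) ≤ m := by exact_mod_cast hm
      exact mul_nonneg hu (by linarith)
  have h1 : 0 ≤ correction f := by rw [e]; nlinarith [mul_nonneg hu hl0]
  have h2 : correction f ≤ 2 * m * u + N := by
    rw [e]
    have : u * l ≤ u * m := mul_le_mul_of_nonneg_left (by linarith) hu
    nlinarith
  calc _ ≤ (2 * m * u + N) ^ 2 := by gcongr
    _ ≤ _ := by nlinarith [sq_nonneg (2 * m * u - N)]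

lemma sum_correction_sq_le (n m : ℕ) :
    ∑ f : Fin n → Fin m, correction f ^ 2 ≤
      8 * ((m : ℝ) ^ 3 * ((m - 1 : ℕ) : ℝ) ^ n + (m : ℝ) ^ 4 * ((m - 2 : ℕ) : ℝ) ^ n) +
      2 * (n ^ 2 * ((m : ℝ) ^ 4 * ((m - 2 : ℕ) : ℝ) ^ (n - 2)) +
        4 * n * ((m : ℝ) ^ 3 * ((m - 1 : ℕ) : ℝ) ^ (n - 1))) := by
  have h1 : (∑ f : Fin n → Fin m, (unused f : ℝ) ^ 2) ≤
      m * ((m - 1 : ℕ) : ℝ) ^ n + m ^ 2 * ((m - 2 : ℕ) : ℝ) ^ n := by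
    exact_mod_cast sum_unused_sq n m
  have h2 : (∑ f : Fin n → Fin m, (#(sepSet f) : ℝ) ^ 2) ≤
      m ^ 4 * (n ^ 2 * ((m - 2 : ℕ) : ℝ) ^ (n - 2)) +
        4 * m ^ 3 * (n * ((m - 1 : ℕ) : ℝ) ^ (n - 1)) := by
    exact_mod_cast sum_card_sepSet_sq n m
  calc _ ≤ ∑ f : Fin n → Fin m, (8 * m ^ 2 * (unused f : ℝ) ^ 2 + 2 * (#(sepSet f) : ℝ) ^ 2) :=
        sum_le_sum fun f _ => correction_sq_le f
    _ = 8 * m ^ 2 * ∑ f : Fin n → Fin m, (unused f : ℝ) ^ 2 +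
        2 * ∑ f : Fin n → Fin m, (#(sepSet f) : ℝ) ^ 2 := by
        rw [sum_add_distrib, mul_sum, mul_sum]
    _ ≤ 8 * m ^ 2 * (m * ((m - 1 : ℕ) : ℝ) ^ n + m ^ 2 * ((m - 2 : ℕ) : ℝ) ^ n) +
        2 * (m ^ 4 * (n ^ 2 * ((m - 2 : ℕ) : ℝ) ^ (n - 2)) +
        4 * m ^ 3 * (n * ((m - 1 : ℕ) : ℝ) ^ (n - 1))) := by gcongr
    _ = _ := by ring

lemma cube_mul_pred_pow_le (k m : ℕ) (hk : k ≠ 0) :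
    (m : ℝ) ^ 3 * ((m - 1 : ℕ) : ℝ) ^ k ≤ m * (4 * ((m - 1 : ℕ) : ℝ) ^ (k + 2)) := by
  rcases m with _ | _ | m
  · simp
  · simp [hk]
  · rw [Nat.add_sub_cancel]
    set x : ℝ := ((m + 1 : ℕ) : ℝ) with hx
    have e : ((m + 1 + 1 : ℕ) : ℝ) = x + 1 := by rw [hx]; push_cast; ring
    have hx1 : 1 ≤ x := by simp [hx]
    rw [e]
    have h1 : (x + 1) ^ 2 ≤ 4 * x ^ 2 := by nlinarith
    have h2 : 0 ≤ (x + 1) * x ^ k := by positivity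
    calc _ = (x + 1) ^ 2 * ((x + 1) * x ^ k) := by ring
      _ ≤ 4 * x ^ 2 * ((x + 1) * x ^ k) := by gcongr
      _ = _ := by ring

lemma fourth_mul_pred_pow_le (k m : ℕ) (hk : k ≠ 0) :
    (m : ℝ) ^ 4 * ((m - 2 : ℕ) : ℝ) ^ k ≤
      m * (((m - 1 : ℕ) : ℝ) * (27 * ((m - 1 - 1 : ℕ) : ℝ) ^ (k + 2))) := by
  rcases m with _ | _ | _ | m
  · simp
  · simp [hk]
  · simp [hk]
  · rw [show m + 1 + 1 + 1 - 2 = m + 1 by omega, Nat.add_sub_cancel, Nat.add_sub_cancel]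
    set x : ℝ := ((m + 1 : ℕ) : ℝ) with hx
    have e : ((m + 1 + 1 + 1 : ℕ) : ℝ) = x + 2 := by rw [hx]; push_cast; ring
    have e' : ((m + 1 + 1 : ℕ) : ℝ) = x + 1 := by rw [hx]; push_cast; ring
    have hx1 : 1 ≤ x := by simp [hx]
    rw [e, e']
    have h1 : (x + 2) ^ 3 ≤ (3 * x) ^ 3 := by gcongr; linarith
    have h3 : (3 * x) ^ 3 ≤ 27 * x ^ 2 * (x + 1) := by nlinarith [sq_nonneg x]
    calc _ = (x + 2) ^ 3 * ((x + 2) * x ^ k) := by ring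
      _ ≤ 27 * x ^ 2 * (x + 1) * ((x + 2) * x ^ k) := by gcongr; exact h1.trans h3
      _ = _ := by ring

lemma exists_correction_mean (n : ℕ) (hn : 3 ≤ n) (hrn : bellRatio n ≤ n) :
    ∃ z : ℝ, z ≤ 600 * n ^ 2 * bell n ∧
      PoissonMean (fun m => ∑ f : Fin n → Fin m, correction f ^ 2) z := by
  have hG := ((((PoissonMean.pow (n + 2)).const_mul 4).shift.add
      ((PoissonMean.pow (n + 2)).const_mul 27).shift.shift).const_mul 8).add
    (((((PoissonMean.pow n).const_mul 27).shift.shift.const_mul ((n : ℝ) ^ 2)).add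
      (((PoissonMean.pow (n + 1)).const_mul 4).shift.const_mul (4 * n))).const_mul 2)
  obtain ⟨z, hz, hZ⟩ := hG.exists_of_le
    (g := fun m => ∑ f : Fin n → Fin m, correction f ^ 2)
    (fun m => sum_nonneg fun f _ => sq_nonneg _) (fun m => by
      refine (sum_correction_sq_le n m).trans ?_
      have h1 := cube_mul_pred_pow_le n m (by omega)
      have h2 := fourth_mul_pred_pow_le n m (by omega)
      have h3 := cube_mul_pred_pow_le (n - 1) m (by omega)
      have h4 := fourth_mul_pred_pow_le (n - 2) m (by omega)
      rw [show n - 1 + 2 = n + 1 by omega] at h3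
      rw [show n - 2 + 2 = n by omega] at h4
      gcongr)
  refine ⟨z, hz.trans ?_, hZ⟩
  have hb := cast_bell_pos n
  have hr0 := bellRatio_pos n
  have hr1 := bellRatio_add_le n 1
  rw [bell_succ_eq (n + 1), bell_succ_eq n]
  set r := bellRatio n
  set r1 := bellRatio (n + 1)
  have hn0 : (3 : ℝ) ≤ n := by exact_mod_cast hn
  have hr2 : r1 ≤ 2 * r := by
    have : r1 * (n + 1) ≤ 2 * r * (n + 1) := by push_cast at hr1; nlinarith
    exact le_of_mul_le_mul_right this (by positivity)
  have h5 : r1 * r ≤ 2 * n ^ 2 := by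
    calc r1 * r ≤ 2 * r * r := by gcongr
      _ ≤ 2 * n * n := by gcongr
      _ = _ := by ring
  have h6 : n * r ≤ (n : ℝ) ^ 2 := by nlinarith
  set B := (bell n : ℝ)
  have h7 : r1 * (r * B) ≤ 2 * n ^ 2 * B := by rw [← mul_assoc]; gcongr
  have h8 : n * (r * B) ≤ (n : ℝ) ^ 2 * B := by rw [← mul_assoc]; gcongr
  have h9 : 0 ≤ (n : ℝ) ^ 2 * B := by positivity
  linarith

lemma exists_gap_mean (n : ℕ) :
    ∃ s : ℝ, PoissonMean
      (fun m => ∑ f : Fin n → Fin m, (compGap f - n * (((m : ℝ) - 1) / 2)) ^ 2) s ∧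
      s ≤ n * (bell (n + 2) - bell n) / 12 ∧
      n * (bell (n + 2) - bell n) / 12 - bell (n + 3) / 12 ≤ s := by
  have hU := ((PoissonMean.pow (n + 2)).sub (PoissonMean.pow n)).const_mul (n / 12)
  obtain ⟨s, hs, hS⟩ := hU.exists_of_le
    (g := fun m => ∑ f : Fin n → Fin m, (compGap f - n * (((m : ℝ) - 1) / 2)) ^ 2)
    (fun m => sum_nonneg fun f _ => sq_nonneg _) (fun m => by
      refine (sum_compGap_sq_le n m).trans_eq ?_
      ring)
  refine ⟨s, hS, by linarith, ?_⟩
  have hL := hU.sub ((PoissonMean.pow (n + 3)).const_mul (1 / 12))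
  have := hL.mono hS fun m => by
    refine le_trans ?_ (le_sum_compGap_sq n m)
    have : 0 ≤ (m : ℝ) ^ 3 / 12 * ((m - 1 : ℕ) : ℝ) ^ n := by positivity
    linear_combination this
  linarith

lemma bellRatio_one_bounds (n : ℕ) (hn : 9 ≤ n) :
    bellRatio (n + 1) ≤ 2 * bellRatio n ∧ bellRatio (n + 2) ≤ 2 * bellRatio n ∧
    n * (bellRatio (n + 1) - bellRatio n) ≤ bellRatio n ∧
    n * (bellRatio (n + 2) - bellRatio n) ≤ 2 * bellRatio n ∧
    n * (bellRatio (n + 2) * bellRatio (n + 3) - bellRatio n * bellRatio (n + 1)) ≤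
      8 * bellRatio n ^ 2 := by
  have h1 := bellRatio_add_le n 1
  have h2 := bellRatio_add_le n 2
  have h3 := bellRatio_add_le n 3
  have m1 := bellRatio_le_succ n
  have m2 := bellRatio_le_succ (n + 1)
  have m3 := bellRatio_le_succ (n + 2)
  have h0 := bellRatio_pos n
  push_cast at h1 h2 h3
  set r := bellRatio n
  set r1 := bellRatio (n + 1)
  set r2 := bellRatio (n + 2)
  set r3 := bellRatio (n + 3)
  have hn' : (9 : ℝ) ≤ n := by exact_mod_cast hn
  have e1 : n * (r1 - r) ≤ r := by nlinarith
  have e2 : n * (r2 - r) ≤ 2 * r := by nlinarith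
  have e3 : n * (r3 - r) ≤ 3 * r := by nlinarith
  have f1 : r1 ≤ 2 * r := by nlinarith
  have f2 : r2 ≤ 2 * r := by nlinarith
  refine ⟨f1, f2, e1, e2, ?_⟩
  have : r2 * r3 - r * r1 ≤ r2 * (r3 - r) + r * (r2 - r) := by nlinarith
  calc _ ≤ n * (r2 * (r3 - r) + r * (r2 - r)) := by gcongr
    _ = r2 * (n * (r3 - r)) + r * (n * (r2 - r)) := by ring
    _ ≤ 2 * r * (3 * r) + r * (2 * r) := by
      have : 0 ≤ n * (r3 - r) := mul_nonneg (by linarith) (by linarith)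
      gcongr
    _ = _ := by ring

lemma exists_compGap_mean (n : ℕ) (hn : 9 ≤ n) (hrn : bellRatio n ≤ n)
    (h2 : (n : ℝ) ^ 2 ≤ bellRatio n ^ 3) (h3 : (n : ℝ) ^ 3 ≤ bellRatio n ^ 4) :
    ∃ d : ℝ, ∀ c : ℝ, ∃ s : ℝ, PoissonMean
      (fun m => ∑ f : Fin n → Fin m, (compGap f - 5 / 4 * ((m : ℝ) * (m - 1)) - c) ^ 2) s ∧
      s ≤ bell n * (n * bellRatio n ^ 2 / 3 + 26 * bellRatio n ^ 3 + (d - c) ^ 2) ∧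
      bell n * (n * bellRatio n ^ 2 / 3 - 91 * bellRatio n ^ 3) ≤ s := by
  obtain ⟨s, hS, hsu, hsl⟩ := exists_gap_mean n
  obtain ⟨d, W, hW0, hW, hM⟩ := condMean_variance n
  refine ⟨d, fun c => ⟨_, (hS.add (hM c)).congr fun m => sum_sq_decomp n m c, ?_⟩⟩
  have hl := bell_variance_lower n hn h2 h3
  have hb := cast_bell_pos n
  have hr1 := one_le_bellRatio n
  have hN : (9 : ℝ) ≤ n := by exact_mod_cast hn
  have m1 := bellRatio_le_succ n
  have m2 := bellRatio_le_succ (n + 1)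
  obtain ⟨f1, f2, e1, e2, e3⟩ := bellRatio_one_bounds n hn
  rw [bell_succ_eq (n + 2), bell_succ_eq (n + 1), bell_succ_eq n] at hsl
  rw [bell_succ_eq (n + 1), bell_succ_eq n] at hsu
  set r := bellRatio n
  set r1 := bellRatio (n + 1)
  set r2 := bellRatio (n + 2)
  set r3 := bellRatio (n + 3)
  set B := (bell n : ℝ)
  set N := (n : ℝ)
  have hN0 : 0 < N := by linarith
  have hr0 : 0 < r := by linarith
  have hr10 : 0 < r1 := by linarith
  have hV0 : 0 ≤ r * (r1 - r) := mul_nonneg hr0.le (by linarith)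
  have hVu : N ^ 2 * (r * (r1 - r)) ≤ N * r ^ 2 := by
    calc _ = N * r * (N * (r1 - r)) := by ring
      _ ≤ N * r * r := by gcongr
      _ = _ := by ring
  have hVl : N * r ^ 2 - 334 * r ^ 3 ≤ N ^ 2 * (r * (r1 - r)) := by
    calc _ = N ^ 2 * (r ^ 2 / N * (1 - 334 * r / N)) := by field_simp
      _ ≤ _ := by gcongr
  have hVs : N * (r * (r1 - r)) ≤ r ^ 3 := by
    have : N * (r * (r1 - r)) ≤ r ^ 2 := by nlinarith
    exact this.trans (by nlinarith [sq_nonneg r])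
  have hK0 : 0 ≤ r * (r1 * (r2 - r) - (r1 - r)) := by
    refine mul_nonneg hr0.le ?_
    have : r2 - r ≤ r1 * (r2 - r) := le_mul_of_one_le_left (by linarith) (by linarith)
    linarith
  have hK : N * (r * (r1 * (r2 - r) - (r1 - r))) ≤ 4 * r ^ 3 := by
    calc _ ≤ r * (r1 * (N * (r2 - r))) := by
          have : 0 ≤ r * (N * (r1 - r)) := mul_nonneg hr0.le (mul_nonneg hN0.le (by linarith))
          linarith
      _ ≤ r * (2 * r * (2 * r)) := by
          have : 0 ≤ N * (r2 - r) := mul_nonneg hN0.le (by linarith)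
          gcongr
      _ = _ := by ring
  have hWu : W ≤ 16 * r ^ 3 := by
    have h : N * W ≤ N * (16 * r ^ 3) := by
      calc N * W ≤ N * (r * r1 * (r2 * r3 - r * r1)) := by gcongr
        _ = r * r1 * (N * (r2 * r3 - r * r1)) := by ring
        _ ≤ r * r1 * (8 * r ^ 2) := by gcongr
        _ ≤ r * (2 * r) * (8 * r ^ 2) := by gcongr
        _ = r * (16 * r ^ 3) := by ring
        _ ≤ _ := by gcongr
    exact le_of_mul_le_mul_left h hN0
  have hN3 : N ≤ r ^ 3 := by nlinarith
  have hE3 : r2 * (r1 * r) ≤ 4 * r ^ 3 := by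
    calc _ ≤ 2 * r * (2 * r * r) := by gcongr
      _ = _ := by ring
  constructor
  · have hs' : s ≤ B * (N * r ^ 2 / 12 + r ^ 3 / 12) := by
      calc s ≤ N * (r1 * (r * B) - B) / 12 := hsu
        _ = B * (N * r ^ 2 / 12 + N * (r * (r1 - r)) / 12 - N / 12) := by ring
        _ ≤ _ := mul_le_mul_of_nonneg_left (by linarith) hb.le
    have hc : N ^ 2 / 4 * (r * (r1 - r)) - 5 * N / 4 * (r * (r1 * (r2 - r) - (r1 - r))) +
        25 / 16 * W + (d - c) ^ 2 ≤ N * r ^ 2 / 4 + 25 * r ^ 3 + (d - c) ^ 2 := by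
      have : 0 ≤ N * (r * (r1 * (r2 - r) - (r1 - r))) := mul_nonneg hN0.le hK0
      linarith
    calc _ ≤ B * (N * r ^ 2 / 12 + r ^ 3 / 12) +
          B * (N * r ^ 2 / 4 + 25 * r ^ 3 + (d - c) ^ 2) := by gcongr
      _ = B * (N * r ^ 2 / 3 + (25 + 1 / 12) * r ^ 3 + (d - c) ^ 2) := by ring
      _ ≤ _ := by gcongr; norm_num
  · have hs' : B * (N * r ^ 2 / 12 - r ^ 3 * (5 / 12)) ≤ s := by
      calc _ ≤ B * (N * r ^ 2 / 12 + N * (r * (r1 - r)) / 12 - N / 12 - r2 * (r1 * r) / 12) := by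
            refine mul_le_mul_of_nonneg_left ?_ hb.le
            have := mul_nonneg hN0.le hV0
            linarith
        _ = N * (r1 * (r * B) - B) / 12 - r2 * (r1 * (r * B)) / 12 := by ring
        _ ≤ s := hsl
    have hc : N * r ^ 2 / 4 - 90 * r ^ 3 ≤
        N ^ 2 / 4 * (r * (r1 - r)) - 5 * N / 4 * (r * (r1 * (r2 - r) - (r1 - r))) +
        25 / 16 * W + (d - c) ^ 2 := by
      have := sq_nonneg (d - c)
      have : 0 < r ^ 3 := by positivity
      linarith
    calc _ ≤ B * (N * r ^ 2 / 12 - r ^ 3 * (5 / 12)) + B * (N * r ^ 2 / 4 - 90 * r ^ 3) := by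
          rw [← mul_add]
          gcongr
          have : 0 < r ^ 3 := by positivity
          linarith
      _ ≤ _ := by gcongr

lemma wordCr_sq_mean (n : ℕ) (c : ℝ) :
    PoissonMean (fun m => ∑ f : Fin n → Fin m, ((wordCr f : ℝ) - c) ^ 2)
      (bell n * (VarXall n + (EXall n - c) ^ 2)) := by
  have hX := poissonMean_wordCr_pow n
  have hb := (cast_bell_pos n).ne'
  have h := ((hX 2).sub ((hX 1).const_mul (2 * c))).add ((PoissonMean.pow n).const_mul (c ^ 2))
  have h' := h.congr (h := fun m => ∑ f : Fin n → Fin m, ((wordCr f : ℝ) - c) ^ 2) fun m => by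
    simp only [pow_one, sub_sq, sum_add_distrib, sum_sub_distrib, sum_const, card_univ, mul_sum]
    simp only [Fintype.card_pi, Fintype.card_fin, prod_const, card_univ, nsmul_eq_mul]
    push_cast
    congr 1
    · congr 1
      refine sum_congr rfl fun f _ => by ring
    · ring
  convert h' using 1
  simp only [pow_one]
  rw [VarXall, EXall]
  field_simp
  ring

lemma abs_VarXall_sub_le (n : ℕ) (hn : 9 ≤ n) (hrn : bellRatio n ≤ n)
    (h2 : (n : ℝ) ^ 2 ≤ bellRatio n ^ 3) (h3 : (n : ℝ) ^ 3 ≤ bellRatio n ^ 4) :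
    |VarXall n - n * bellRatio n ^ 2 / 3| ≤ 3000 * bellRatio n ^ 3 := by
  obtain ⟨z, hz, hZ⟩ := exists_correction_mean n (by omega) hrn
  obtain ⟨d, hd⟩ := exists_compGap_mean n hn hrn h2 h3
  have hb := cast_bell_pos n
  have hr := bellRatio_pos n
  have hN : (9 : ℝ) ≤ n := by exact_mod_cast hn
  set r := bellRatio n
  set B := (bell n : ℝ)
  set N := (n : ℝ)
  have hN0 : 0 < N := by linarith
  set t := r / N with ht
  have ht0 : 0 < t := by positivity
  have ht1 : t ≤ 1 := (div_le_one hN0).2 hrn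
  have htN : t * N = r := div_mul_cancel₀ _ hN0.ne'
  have hz' : (1 + 1 / t) * z ≤ B * (1200 * r ^ 3) := by
    have h1 : 1 + 1 / t ≤ 2 * (N / r) := by
      have : 1 ≤ N / r := (one_le_div hr).2 hrn
      rw [ht, one_div_div]; linarith
    calc _ ≤ (1 + 1 / t) * (600 * N ^ 2 * B) := by gcongr
      _ ≤ 2 * (N / r) * (600 * N ^ 2 * B) := by gcongr
      _ = 1200 * B * (N ^ 3 / r) := by ring
      _ ≤ 1200 * B * (r ^ 4 / r) := by gcongr
      _ = _ := by field_simp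
  have young (x y : ℝ) : (x + y) ^ 2 ≤ (1 + t) * x ^ 2 + (1 + 1 / t) * y ^ 2 := by
    have : (1 + t) * x ^ 2 + (1 + 1 / t) * y ^ 2 - (x + y) ^ 2 = (t * x - y) ^ 2 / t := by
      field_simp; ring
    have : 0 ≤ (t * x - y) ^ 2 / t := by positivity
    linarith
  rw [abs_le]
  constructor
  · obtain ⟨s, hS, -, hs⟩ := hd (EXall n)
    have hX := wordCr_sq_mean n (EXall n)
    have h := hS.mono ((hX.const_mul (1 + t)).add (hZ.const_mul (1 + 1 / t))) fun m => by
      simp only [mul_sum]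
      rw [← sum_add_distrib]
      refine sum_le_sum fun f _ => ?_
      have := young (wordCr f - EXall n) (-correction f)
      rw [neg_sq] at this
      refine le_trans (le_of_eq ?_) this
      rw [correction]; ring
    have h' : N * r ^ 2 / 3 - 1291 * r ^ 3 ≤ (1 + t) * VarXall n := by
      refine le_of_mul_le_mul_left (a := B) ?_ hb
      rw [sub_self] at h
      linarith
    by_contra! hlt
    have h4 : (1 + t) * VarXall n ≤ (1 + t) * (N * r ^ 2 / 3 - 3000 * r ^ 3) := by
      gcongr; linarith
    have h5 : t * (N * r ^ 2 / 3 - 3000 * r ^ 3) ≤ r ^ 3 / 3 := by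
      have : t * (N * r ^ 2 / 3) = r ^ 3 / 3 := by
        calc _ = (t * N) * r ^ 2 / 3 := by ring
          _ = _ := by rw [htN]; ring
      have : 0 ≤ t * (3000 * r ^ 3) := by positivity
      linarith
    have : 0 < r ^ 3 := by positivity
    linarith
  · obtain ⟨s, hS, hs, -⟩ := hd d
    have hX := wordCr_sq_mean n d
    have h := hX.mono ((hS.const_mul (1 + t)).add (hZ.const_mul (1 + 1 / t))) fun m => by
      simp only [mul_sum]
      rw [← sum_add_distrib]
      refine sum_le_sum fun f _ => ?_
      refine le_trans (le_of_eq ?_) (young _ (correction f))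
      rw [correction]; ring
    have h' : VarXall n ≤ (1 + t) * (N * r ^ 2 / 3 + 26 * r ^ 3) + 1200 * r ^ 3 := by
      refine le_of_mul_le_mul_left (a := B) ?_ hb
      have h4 : (1 + t) * s ≤ (1 + t) * (B * (N * r ^ 2 / 3 + 26 * r ^ 3 + (d - d) ^ 2)) := by
        gcongr
      rw [sub_self] at h4
      have : 0 ≤ B * (EXall n - d) ^ 2 := by positivity
      linarith
    have h5 : t * (N * r ^ 2 / 3) = r ^ 3 / 3 := by
      calc _ = (t * N) * r ^ 2 / 3 := by ring
        _ = _ := by rw [htN]; ring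
    have h6 : t * (26 * r ^ 3) ≤ 1 * (26 * r ^ 3) := by gcongr
    have : 0 < r ^ 3 := by positivity
    linarith

section

open Filter Topology

lemma tendsto_bellRatio : Tendsto bellRatio atTop atTop := by
  refine tendsto_atTop_mono (f := fun n : ℕ => Real.sqrt n + -1) (fun n => ?_)
    (tendsto_atTop_add_const_right _ _ (Real.tendsto_sqrt_atTop.comp tendsto_natCast_atTop_atTop))
  have h0 := bellRatio_pos n
  have h1 := le_bellRatio_log n
  have h2 := Real.log_le_self h0.le
  have h3 : (n : ℝ) ≤ (bellRatio n + 1) ^ 2 := by nlinarith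
  have := Real.sqrt_le_iff.2 ⟨by positivity, h3⟩
  linarith

lemma tendsto_log_bellRatio : Tendsto (fun n => Real.log (bellRatio n)) atTop atTop :=
  Real.tendsto_log_atTop.comp tendsto_bellRatio

lemma tendsto_log_pow_div_bellRatio (k : ℕ) :
    Tendsto (fun n => Real.log (bellRatio n) ^ k / bellRatio n) atTop (𝓝 0) :=
  (Real.isLittleO_pow_log_id_atTop (n := k)).tendsto_div_nhds_zero.comp tendsto_bellRatio

lemma tendsto_log_log_div :
    Tendsto (fun n => Real.log (Real.log (bellRatio n)) / Real.log (bellRatio n)) atTop (𝓝 0) :=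
  Real.isLittleO_log_id_atTop.tendsto_div_nhds_zero.comp tendsto_log_bellRatio

lemma tendsto_div_bellRatio_sub_log :
    Tendsto (fun n : ℕ => n / bellRatio n - Real.log (bellRatio n)) atTop (𝓝 0) := by
  have h := tendsto_log_pow_div_bellRatio 1
  refine squeeze_zero_norm (fun n => ?_) h
  have h0 := bellRatio_pos n
  have h1 := le_bellRatio_log n
  have h2 := bellRatio_log_le n
  rw [Real.norm_eq_abs, abs_le, pow_one, div_sub' h0.ne', ← neg_div, div_le_div_iff_of_pos_right h0,
    div_le_div_iff_of_pos_right h0]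
  constructor <;> linarith

lemma tendsto_div_bellRatio_div_log :
    Tendsto (fun n : ℕ => n / bellRatio n / Real.log (bellRatio n)) atTop (𝓝 1) := by
  have h := (tendsto_div_bellRatio_sub_log.div_atTop tendsto_log_bellRatio).const_add 1
  rw [add_zero] at h
  refine h.congr' ?_
  filter_upwards [tendsto_log_bellRatio.eventually_gt_atTop 0] with n hn
  rw [sub_div, div_self hn.ne', add_sub_cancel]

lemma tendsto_log_div_sub_log_log :
    Tendsto (fun n : ℕ => Real.log (n / bellRatio n) - Real.log (Real.log (bellRatio n)))
      atTop (𝓝 0) := by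
  have h := tendsto_div_bellRatio_div_log.log one_ne_zero
  rw [Real.log_one] at h
  refine h.congr' ?_
  filter_upwards [tendsto_log_bellRatio.eventually_gt_atTop 0, eventually_gt_atTop 0] with n hn h0
  have : (0 : ℝ) < n := by exact_mod_cast h0
  have := bellRatio_pos n
  rw [Real.log_div (by positivity) hn.ne']

lemma log_eq_add (n : ℕ) (hn : 0 < n) :
    Real.log n = Real.log (bellRatio n) + Real.log (n / bellRatio n) := by
  have : (0 : ℝ) < n := by exact_mod_cast hn
  have := bellRatio_pos n
  rw [Real.log_div (by positivity) (by positivity)]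
  ring

lemma tendsto_log_div_log_bellRatio :
    Tendsto (fun n : ℕ => Real.log n / Real.log (bellRatio n)) atTop (𝓝 1) := by
  have h := ((tendsto_log_div_sub_log_log.div_atTop tendsto_log_bellRatio).add
    tendsto_log_log_div).const_add 1
  rw [add_zero, add_zero] at h
  refine h.congr' ?_
  filter_upwards [tendsto_log_bellRatio.eventually_gt_atTop 0, eventually_gt_atTop 0] with n hn h0
  rw [log_eq_add n h0]
  field_simp
  ring

lemma tendsto_log_log_bellRatio :
    Tendsto (fun n => Real.log (Real.log (bellRatio n))) atTop atTop :=
  Real.tendsto_log_atTop.comp tendsto_log_bellRatio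

lemma tendsto_log_log : Tendsto (fun n : ℕ => Real.log (Real.log n)) atTop atTop :=
  Real.tendsto_log_atTop.comp (Real.tendsto_log_atTop.comp tendsto_natCast_atTop_atTop)

lemma tendsto_log_log_div_log_log_bellRatio :
    Tendsto (fun n : ℕ => Real.log (Real.log n) / Real.log (Real.log (bellRatio n)))
      atTop (𝓝 1) := by
  have h := ((tendsto_log_div_log_bellRatio.log one_ne_zero).div_atTop
    tendsto_log_log_bellRatio).const_add 1
  rw [add_zero] at h
  refine h.congr' ?_
  filter_upwards [tendsto_log_bellRatio.eventually_gt_atTop 0,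
    tendsto_log_log_bellRatio.eventually_gt_atTop 0,
    (Real.tendsto_log_atTop.comp tendsto_natCast_atTop_atTop).eventually_gt_atTop (0 : ℝ)]
    with n h1 h2 h3
  rw [Real.log_div (show Real.log n ≠ 0 from ne_of_gt h3) h1.ne', sub_div, div_self h2.ne',
    add_sub_cancel]

/-- The saddle point asymptotics `log n / (n / r) → 1` for the Bell ratio `r`. -/
lemma tendsto_log_div_div_bellRatio :
    Tendsto (fun n : ℕ => Real.log n / (n / bellRatio n)) atTop (𝓝 1) := by
  have h := tendsto_log_div_log_bellRatio.div tendsto_div_bellRatio_div_log one_ne_zero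
  rw [div_one] at h
  refine h.congr' ?_
  filter_upwards [tendsto_log_bellRatio.eventually_gt_atTop 0] with n hn
  exact div_div_div_cancel_right₀ hn.ne' _ _

/-- The next term of the saddle point asymptotics for the Bell ratio. -/
lemma tendsto_log_sub_div_bellRatio_div_log_log :
    Tendsto (fun n : ℕ => (Real.log n - n / bellRatio n) / Real.log (Real.log n))
      atTop (𝓝 1) := by
  have h := (((tendsto_log_div_sub_log_log.sub tendsto_div_bellRatio_sub_log).div_atTop
    tendsto_log_log_bellRatio).const_add 1).div tendsto_log_log_div_log_log_bellRatio one_ne_zero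
  rw [add_zero, div_one] at h
  refine h.congr' ?_
  filter_upwards [tendsto_log_log_bellRatio.eventually_gt_atTop 0, eventually_gt_atTop 0]
    with n h1 h0
  rw [Pi.div_apply, one_add_div h1.ne', div_div_div_cancel_right₀ h1.ne']
  congr 1
  rw [log_eq_add n h0]
  ring

lemma eventually_bellRatio_bounds : ∀ᶠ n : ℕ in atTop, 9 ≤ n ∧ bellRatio n ≤ n ∧
    (n : ℝ) ^ 2 ≤ bellRatio n ^ 3 ∧ (n : ℝ) ^ 3 ≤ bellRatio n ^ 4 := by
  filter_upwards [eventually_ge_atTop 9, tendsto_bellRatio.eventually_ge_atTop 2,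
    tendsto_log_bellRatio.eventually_ge_atTop 2,
    (tendsto_log_pow_div_bellRatio 2).eventually_le_const (show (0 : ℝ) < 1 / 4 by norm_num),
    (tendsto_log_pow_div_bellRatio 3).eventually_le_const (show (0 : ℝ) < 1 / 8 by norm_num)]
    with n hn hr hL h2 h3
  have h0 := bellRatio_pos n
  have hl := le_bellRatio_log n
  have hu := bellRatio_log_le n
  rw [div_le_iff₀ h0] at h2 h3
  set r := bellRatio n
  set L := Real.log r
  have hn2 : (n : ℝ) ≤ 2 * r * L := by nlinarith
  refine ⟨hn, by nlinarith, ?_, ?_⟩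
  · calc (n : ℝ) ^ 2 ≤ (2 * r * L) ^ 2 := by gcongr
      _ = 4 * r ^ 2 * L ^ 2 := by ring
      _ ≤ 4 * r ^ 2 * (1 / 4 * r) := by gcongr
      _ = _ := by ring
  · calc (n : ℝ) ^ 3 ≤ (2 * r * L) ^ 3 := by gcongr
      _ = 8 * r ^ 3 * L ^ 3 := by ring
      _ ≤ 8 * r ^ 3 * (1 / 8 * r) := by gcongr
      _ = _ := by ring

lemma tendsto_relative_error_div_log_log :
    Tendsto (fun n : ℕ => n / bellRatio n *
      (3 * (n / bellRatio n) ^ 2 * VarXall n / (n : ℝ) ^ 3 - 1) / Real.log (Real.log n))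
      atTop (𝓝 0) := by
  refine squeeze_zero_norm' ?_ (tendsto_log_log.const_div_atTop 9000)
  filter_upwards [eventually_bellRatio_bounds, tendsto_log_log.eventually_gt_atTop 0]
    with n ⟨hn, hrn, h2, h3⟩ hl
  have h := abs_VarXall_sub_le n hn hrn h2 h3
  have h0 := bellRatio_pos n
  have hn0 : (0 : ℝ) < n := by exact_mod_cast (show 0 < n by omega)
  rw [norm_div, Real.norm_eq_abs, Real.norm_eq_abs, abs_of_pos hl]
  gcongr
  set r := bellRatio n
  have e : n / r * (3 * (n / r) ^ 2 * VarXall n / (n : ℝ) ^ 3 - 1) =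
      3 / r ^ 3 * (VarXall n - n * r ^ 2 / 3) := by
    field_simp
  rw [e, abs_mul, abs_of_pos (by positivity)]
  calc _ ≤ 3 / r ^ 3 * (3000 * r ^ 3) := by gcongr
    _ = _ := by field_simp; norm_num

end

end CrossingVariance

/-- Asymptotics of the variance of the linear crossing number over all of `Π_n`:
`Var(X_n) = (n³/(3 (log n)²)) (1 + 2 (log log n / log n)(1 + o(1)))`. -/
theorem var_crl_all :
    Filter.Tendsto (fun n : ℕ =>
        (3 * (Real.log n) ^ 2 * VarXall n / (n : ℝ) ^ 3 - 1) * Real.log n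
          / (2 * Real.log (Real.log n)))
      Filter.atTop (nhds 1) := by
  have hx := CrossingVariance.tendsto_log_div_div_bellRatio
  have h := ((((hx.add_const 1).div_const 2).mul hx).mul
    CrossingVariance.tendsto_log_sub_div_bellRatio_div_log_log).add
    (((hx.pow 3).mul CrossingVariance.tendsto_relative_error_div_log_log).div_const 2)
  norm_num at h
  refine h.congr' ?_
  filter_upwards [CrossingVariance.tendsto_log_log.eventually_gt_atTop 0,
    Filter.eventually_gt_atTop 0] with n hl hn
  have hn0 : (0 : ℝ) < n := by exact_mod_cast hn
  have h0 := CrossingVariance.bellRatio_pos n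
  field_simp
  ring
end
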